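/- arXiv:2312.00928 — 2 statements merged into one kernel-verified Lean document; each statement's English description precedes it below -/
import Mathlib

section
/- Let G be a cactus graph. Then HG(G) = 3 if and only if G contains fewer than two triangles and G contains at least two cycles or a cycle whose length is 4 or divisible by 3. -/
/-- The hat guessing game `⟨G, h⟩` is *winning*: there exists a strategy (one
deterministic guessing function per vertex, depending only on the colors of the
neighboring vertices) such that for every assignment of hat colors at least one
vertex guesses its own color correctly. -/
def HatGame.Winning {V : Type*} (G : SimpleGraph V) (h : V → ℕ) : Prop :=
  ∃ s : ∀ v : V, (∀ u : V, Fin (h u)) → Fin (h v),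
    (∀ (v : V) (c c' : ∀ u : V, Fin (h u)),
        (∀ u : V, G.Adj v u → c u = c' u) → s v c = s v c') ∧
    ∀ c : ∀ u : V, Fin (h u), ∃ v : V, s v c = c v

/-- The hat guessing number of `G`: the largest `q` such that the game on `G`
where every vertex has hatness `q` is winning. -/
noncomputable def HatGame.number {V : Type*} (G : SimpleGraph V) : ℕ :=
  sSup {q : ℕ | HatGame.Winning G (fun _ => q)}

/-- A cactus graph: a connected graph in which every pair of (distinct) cycles
shares at most one vertex. -/
def SimpleGraph.IsCactus {V : Type*} (G : SimpleGraph V) : Prop :=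
  G.Connected ∧
    ∀ (v w : V) (c₁ : G.Walk v v) (c₂ : G.Walk w w), c₁.IsCycle → c₂.IsCycle →
      {e | e ∈ c₁.edges} ≠ {e | e ∈ c₂.edges} →
      ({x | x ∈ c₁.support} ∩ {x | x ∈ c₂.support} : Set V).Subsingleton

/-- `G` contains at least two (distinct) triangles, i.e. two cycles of length 3
with different edge sets. -/
def SimpleGraph.HasTwoTriangles {V : Type*} (G : SimpleGraph V) : Prop :=
  ∃ (v w : V) (c₁ : G.Walk v v) (c₂ : G.Walk w w),
    c₁.IsCycle ∧ c₂.IsCycle ∧ c₁.length = 3 ∧ c₂.length = 3 ∧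
    {e | e ∈ c₁.edges} ≠ {e | e ∈ c₂.edges}

/-- `G` contains at least two (distinct) cycles, i.e. two cycles with different
edge sets. -/
def SimpleGraph.HasTwoCycles {V : Type*} (G : SimpleGraph V) : Prop :=
  ∃ (v w : V) (c₁ : G.Walk v v) (c₂ : G.Walk w w),
    c₁.IsCycle ∧ c₂.IsCycle ∧ {e | e ∈ c₁.edges} ≠ {e | e ∈ c₂.edges}

/-- `G` contains a cycle whose length is 4 or divisible by 3. -/
def SimpleGraph.HasGoodCycle {V : Type*} (G : SimpleGraph V) : Prop :=
  ∃ (v : V) (c : G.Walk v v), c.IsCycle ∧ (c.length = 4 ∨ 3 ∣ c.length)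

namespace HatGame

/-- One step of the reachability relation along a path: from pairs of colors of vertices
`i - 1, i` to pairs of colors of vertices `i, i + 1` for which vertex `i`, guessing with `g`,
is wrong. -/
def stepRel {q : ℕ} (g : Fin q → Fin q → Fin q) (T : Fin q → Fin q → Prop) :
    Fin q → Fin q → Prop :=
  fun y z => ∃ x, T x y ∧ g x z ≠ y

/-- The pairs of colors of vertices `k, k + 1` for which vertices `0, 1` can have colors `a, y`
while vertices `1, …, k` all guess wrong. -/
def reach {q : ℕ} (f : ℤ → Fin q → Fin q → Fin q) (a y : Fin q) : ℕ → Fin q → Fin q → Prop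
  | 0 => fun x z => x = a ∧ z = y
  | k + 1 => stepRel (f (k + 1)) (reach f a y k)

/-- Any two columns of the relation meet. -/
def Linked {q : ℕ} (T : Fin q → Fin q → Prop) : Prop :=
  ∀ y y', y ≠ y' → ∃ x, T x y ∧ T x y'

/-- Every column of the relation misses at most one element. -/
def Thick {q : ℕ} (T : Fin q → Fin q → Prop) : Prop :=
  ∀ u y y', y ≠ y' → T y u ∨ T y' u

/-- Some row of the relation has at least two elements. -/
def Forked {q : ℕ} (T : Fin q → Fin q → Prop) : Prop :=
  ∃ x y y', y ≠ y' ∧ T x y ∧ T x y'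

/-- The strategy `f` on the cycle of length `n` with colors in `Fin q` wins against all colorings
in which vertex `0` has its color in `A`. -/
def CycStrategyWins {q : ℕ} (n : ℕ) (A : Set (Fin q)) (f : ℤ → Fin q → Fin q → Fin q) : Prop :=
  (∀ i, f (i + n) = f i) ∧ ∀ c : ℤ → Fin q, (∀ i, c (i + n) = c i) → c 0 ∈ A →
    ∃ i, f i (c (i - 1)) (c (i + 1)) = c i

section Relations

variable {q : ℕ} {T : Fin q → Fin q → Prop}

lemma Linked.thick_stepRel (h : Linked T) (g : Fin q → Fin q → Fin q) : Thick (stepRel g T) := by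
  intro u y y' hy
  obtain ⟨x, h1, h2⟩ := h y y' hy
  by_cases hg : g x u = y
  · exact Or.inr ⟨x, h2, by rw [hg]; exact hy⟩
  · exact Or.inl ⟨x, h1, hg⟩

lemma Thick.linked (hq : 3 ≤ q) (h : Thick T) : Linked T := by
  intro y y' _
  by_contra! hc
  have h01 := h y ⟨0, by omega⟩ ⟨1, by omega⟩ (by simp)
  have h02 := h y ⟨0, by omega⟩ ⟨2, by omega⟩ (by simp)
  have h12 := h y ⟨1, by omega⟩ ⟨2, by omega⟩ (by simp)
  have k01 := h y' ⟨0, by omega⟩ ⟨1, by omega⟩ (by simp)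
  have k02 := h y' ⟨0, by omega⟩ ⟨2, by omega⟩ (by simp)
  have k12 := h y' ⟨1, by omega⟩ ⟨2, by omega⟩ (by simp)
  have c0 := hc ⟨0, by omega⟩
  have c1 := hc ⟨1, by omega⟩
  have c2 := hc ⟨2, by omega⟩
  tauto

lemma linked_of_row {x : Fin q} (h : ∀ y, T x y) : Linked T := fun y y' _ => ⟨x, h y, h y'⟩

lemma Forked.exists_stepRel (h : Forked T) (g : Fin q → Fin q → Fin q) (u : Fin q) :
    ∃ y, stepRel g T y u := by
  obtain ⟨x, y, y', hy, h1, h2⟩ := h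
  by_cases hg : g x u = y
  · exact ⟨y', x, h2, by rw [hg]; exact hy⟩
  · exact ⟨y, x, h1, hg⟩

lemma Forked.stepRel (hq : 3 ≤ q) (h : Forked T) (g : Fin q → Fin q → Fin q) :
    Forked (stepRel g T) := by
  obtain ⟨x, y, y', hy, h1, h2⟩ := h
  have key : ∀ u, HatGame.stepRel g T y u ∨ HatGame.stepRel g T y' u := by
    intro u
    by_cases hg : g x u = y
    · exact Or.inr ⟨x, h2, by rw [hg]; exact hy⟩
    · exact Or.inl ⟨x, h1, hg⟩
  have h0 := key ⟨0, by omega⟩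
  have h1 := key ⟨1, by omega⟩
  have h2 := key ⟨2, by omega⟩
  have n01 : (⟨0, by omega⟩ : Fin q) ≠ ⟨1, by omega⟩ := by simp
  have n02 : (⟨0, by omega⟩ : Fin q) ≠ ⟨2, by omega⟩ := by simp
  have n12 : (⟨1, by omega⟩ : Fin q) ≠ ⟨2, by omega⟩ := by simp
  rcases h0 with h0 | h0 <;> rcases h1 with h1 | h1 <;> rcases h2 with h2 | h2 <;>
    first
    | exact ⟨_, _, _, n01, h0, h1⟩
    | exact ⟨_, _, _, n02, h0, h2⟩
    | exact ⟨_, _, _, n12, h1, h2⟩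

end Relations

section Reach

variable {q : ℕ} {f : ℤ → Fin q → Fin q → Fin q} {a y : Fin q}

lemma reach_linked_mono (hq : 3 ≤ q) {k : ℕ} (h : Linked (reach f a y k)) (j : ℕ) :
    Linked (reach f a y (k + j)) := by
  induction j with
  | zero => exact h
  | succ j ih => exact (ih.thick_stepRel _).linked hq

lemma reach_forked_mono (hq : 3 ≤ q) {k : ℕ} (h : Forked (reach f a y k)) (j : ℕ) :
    Forked (reach f a y (k + j)) := by
  induction j with
  | zero => exact h
  | succ j ih => exact ih.stepRel hq _

lemma reach_one_iff {x z : Fin q} : reach f a y 1 x z ↔ x = y ∧ f 1 a z ≠ y := by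
  simp only [reach, stepRel]
  constructor
  · rintro ⟨_, ⟨rfl, rfl⟩, h⟩
    exact ⟨rfl, by simpa using h⟩
  · rintro ⟨rfl, h⟩
    exact ⟨a, ⟨rfl, rfl⟩, by simpa using h⟩

lemma exists_path_of_reach {k : ℕ} {x z : Fin q} (h : reach f a y k x z) :
    ∃ c : ℕ → Fin q, c 0 = a ∧ c 1 = y ∧ c k = x ∧ c (k + 1) = z ∧
      ∀ i < k, f (i + 1) (c i) (c (i + 2)) ≠ c (i + 1) := by
  induction k generalizing x z with
  | zero =>
    obtain ⟨rfl, rfl⟩ := h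
    exact ⟨fun i => if i = 0 then x else z, by simp⟩
  | succ k ih =>
    obtain ⟨w, h1, h2⟩ := h
    obtain ⟨c, c0, c1, ck, ck1, hc⟩ := ih h1
    refine ⟨Function.update c (k + 2) z, ?_, ?_, ?_, ?_, ?_⟩
    · rw [Function.update_of_ne (by omega), c0]
    · rw [Function.update_of_ne (by omega), c1]
    · rw [Function.update_of_ne (by omega), ck1]
    · simp
    · intro i hi
      rcases Nat.lt_succ_iff_lt_or_eq.mp hi with hi | rfl
      · rw [Function.update_of_ne (by omega), Function.update_of_ne (by omega),
          Function.update_of_ne (by omega)]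
        exact hc i hi
      · rw [Function.update_of_ne (by omega), Function.update_self,
          Function.update_of_ne (by omega), ck, ck1]
        exact_mod_cast h2

/-- A closed sequence of colors gives a coloring of the cycle, so some vertex guesses right. -/
lemma CycStrategyWins.exists_of_closed {m : ℕ} {A : Set (Fin q)}
    (hw : CycStrategyWins (m + 1) A f) (c : ℕ → Fin q) (hA : c 0 ∈ A) (hc : c (m + 1) = c 0) :
    f 0 (c m) (c 1) = c 0 ∨ ∃ i < m, f (i + 1) (c i) (c (i + 2)) = c (i + 1) := by
  obtain ⟨hf, hw⟩ := hw
  have hper : ∀ (i k : ℤ), f (i + (m + 1 : ℕ) * k) = f i := by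
    intro i k
    have := (Function.Periodic.int_mul (f := f) (c := ((m + 1 : ℕ) : ℤ)) hf k) i
    rw [← this]; congr 1; ring_nf
    simp
  obtain ⟨i, hi⟩ := hw (fun i => c (i % (m + 1 : ℕ)).toNat) (fun i => by simp) (by simpa using hA)
  set j := (i % (m + 1 : ℕ)).toNat with hj
  have hmod := Int.emod_add_mul_ediv i (m + 1 : ℕ)
  have hlt := Int.emod_lt_of_pos i (b := (m + 1 : ℕ)) (by omega)
  have hnn := Int.emod_nonneg i (b := (m + 1 : ℕ)) (by omega)
  have hj' : ((j : ℕ) : ℤ) = i % (m + 1 : ℕ) := by omega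
  have hfi : f i = f j := by rw [← hmod, hper, hj']
  have hprev : ∀ j', j = j' + 1 → ((i - 1) % (m + 1 : ℕ)).toNat = j' := by
    intro j' h
    have : (i - 1) % (m + 1 : ℕ) = j' := by
      have : i - 1 = j' + (m + 1 : ℕ) * (i / (m + 1 : ℕ)) := by omega
      rw [this, Int.add_mul_emod_self_left]
      exact Int.emod_eq_of_lt (by omega) (by omega)
    omega
  have hnext : j < m → ((i + 1) % (m + 1 : ℕ)).toNat = j + 1 := by
    intro h
    have : (i + 1) % (m + 1 : ℕ) = (j + 1 : ℕ) := by
      have : i + 1 = (j + 1 : ℕ) + (m + 1 : ℕ) * (i / (m + 1 : ℕ)) := by omega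
      rw [this, Int.add_mul_emod_self_left]
      exact Int.emod_eq_of_lt (by omega) (by omega)
    omega
  have hnext' : j = m → ((i + 1) % (m + 1 : ℕ)).toNat = 0 := by
    intro h
    have : (i + 1) % (m + 1 : ℕ) = 0 := by
      have : i + 1 = 0 + (m + 1 : ℕ) * (i / (m + 1 : ℕ) + 1) := by rw [mul_add]; omega
      rw [this, Int.add_mul_emod_self_left]
      simp
    omega
  have hc1 : c ((i + 1) % (m + 1 : ℕ)).toNat = c (j + 1) := by
    rcases lt_or_eq_of_le (show j ≤ m by omega) with h | h
    · rw [hnext h]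
    · rw [hnext' h, h, hc]
  rw [hc1, hfi] at hi
  rcases Nat.eq_zero_or_pos j with h0 | h0
  · left
    have : ((i - 1) % (m + 1 : ℕ)).toNat = m := by
      have : (i - 1) % (m + 1 : ℕ) = m := by
        have : i - 1 = m + (m + 1 : ℕ) * (i / (m + 1 : ℕ) - 1) := by rw [mul_sub]; omega
        rw [this, Int.add_mul_emod_self_left]
        exact Int.emod_eq_of_lt (by omega) (by omega)
      omega
    rw [this, h0] at hi
    simpa using hi
  · right
    obtain ⟨j', hj''⟩ : ∃ j', j = j' + 1 := ⟨j - 1, by omega⟩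
    rw [hprev j' hj'', hj''] at hi
    exact ⟨j', by omega, by exact_mod_cast hi⟩

lemma CycStrategyWins.guess_eq_of_reach {m : ℕ} {A : Set (Fin q)}
    (hw : CycStrategyWins (m + 1) A f) (ha : a ∈ A) {w : Fin q} (h : reach f a y m w a) :
    f 0 w y = a := by
  obtain ⟨c, c0, c1, cm, cm1, hc⟩ := exists_path_of_reach h
  rcases hw.exists_of_closed c (c0 ▸ ha) (cm1.trans c0.symm) with h | ⟨i, hi, h⟩
  · rwa [cm, c1, c0] at h
  · exact absurd h (hc i hi)

lemma CycStrategyWins.guess_of_linked {m k : ℕ} {A : Set (Fin q)} (hq : 3 ≤ q)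
    (hw : CycStrategyWins (m + 1) A f) (ha : a ∈ A) (hk : k < m) (h : Linked (reach f a y k))
    {w w' : Fin q} (hww : w ≠ w') : f 0 w y = a ∨ f 0 w' y = a := by
  obtain ⟨j, rfl⟩ : ∃ j, m = k + j + 1 := ⟨m - k - 1, by omega⟩
  exact ((reach_linked_mono hq h j).thick_stepRel _ a w w' hww).imp
    (hw.guess_eq_of_reach ha) (hw.guess_eq_of_reach ha)

lemma CycStrategyWins.guess_of_forked {m k : ℕ} {A : Set (Fin q)} (hq : 3 ≤ q)
    (hw : CycStrategyWins (m + 1) A f) (ha : a ∈ A) (hk : k < m) (h : Forked (reach f a y k)) :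
    ∃ w, f 0 w y = a := by
  obtain ⟨j, rfl⟩ : ∃ j, m = k + j + 1 := ⟨m - k - 1, by omega⟩
  obtain ⟨w, hw'⟩ := (reach_forked_mono hq h j).exists_stepRel (f ((k + j : ℕ) + 1)) a
  exact ⟨w, hw.guess_eq_of_reach ha hw'⟩

end Reach

/-- The number of times the row `r` takes the value `y`. -/
def rowCount (r : Fin 3 → Fin 3) (y : Fin 3) : ℕ := (Finset.univ.filter fun z => r z = y).card

section Rows

lemma rowCount_eq_zero_iff : ∀ (r : Fin 3 → Fin 3) (y : Fin 3),
    rowCount r y = 0 ↔ ∀ z, r z ≠ y := by decide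

lemma rowCount_eq_one_iff : ∀ (r : Fin 3 → Fin 3) (y : Fin 3),
    rowCount r y = 1 ↔ ∃ p, ∀ z, r z = y ↔ z = p := by decide

lemma rowCount_eq_two_iff : ∀ (r : Fin 3 → Fin 3) (y : Fin 3),
    rowCount r y = 2 ↔ ∃ p, ∀ z, r z = y ↔ z ≠ p := by decide

lemma rowCount_sum : ∀ r : Fin 3 → Fin 3, rowCount r 0 + rowCount r 1 + rowCount r 2 = 3 := by
  decide

lemma two_le_rowCount_iff : ∀ (r : Fin 3 → Fin 3) (y : Fin 3),
    2 ≤ rowCount r y ↔ ∀ w w', w ≠ w' → r w = y ∨ r w' = y := by decide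

lemma exists_row_data : ∀ r : Fin 3 → Fin 3, (∀ y, rowCount r y ≤ 2) → (∃ y, rowCount r y ≠ 1) →
    ∃ t o m p, t ≠ o ∧ o ≠ m ∧ t ≠ m ∧ (∀ z, r z = t ↔ z ≠ p) ∧ r p = o := by decide

end Rows

section Rules

variable {n : ℕ} {f : ℤ → Fin 3 → Fin 3 → Fin 3}

lemma CycStrategyWins.rotate {q : ℕ} {f : ℤ → Fin q → Fin q → Fin q}
    (hw : CycStrategyWins n Set.univ f) (j : ℤ) :
    CycStrategyWins n Set.univ (fun i => f (i + j)) := by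
  refine ⟨fun i => ?_, fun c hc _ => ?_⟩
  · have := hw.1 (i + j)
    rwa [add_right_comm] at this
  · obtain ⟨i, hi⟩ := hw.2 (fun i => c (i - j))
      (fun i => by rw [← hc (i - j)]; congr 1; ring) (Set.mem_univ _)
    refine ⟨i - j, ?_⟩
    simpa [sub_right_comm, add_sub_right_comm] using hi

lemma reach_one_forked {a y : Fin 3} (h : rowCount (f 1 a) y ≤ 1) :
    Forked (reach f a y 1) := by
  have key : ∀ (r : Fin 3 → Fin 3) (y : Fin 3), rowCount r y ≤ 1 →
      ∃ z z', z ≠ z' ∧ r z ≠ y ∧ r z' ≠ y := by decide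
  obtain ⟨z, z', hz, h1, h2⟩ := key _ _ h
  exact ⟨y, z, z', hz, reach_one_iff.2 ⟨rfl, h1⟩, reach_one_iff.2 ⟨rfl, h2⟩⟩

lemma CycStrategyWins.rowCount_add_ge (hn : 5 ≤ n) (hw : CycStrategyWins n Set.univ f)
    (a y : Fin 3) : 2 ≤ rowCount (f 1 a) y + rowCount (fun w => f 0 w y) a := by
  obtain ⟨m, rfl⟩ : ∃ m, n = m + 1 := ⟨n - 1, by omega⟩
  by_contra! hlt
  rcases Nat.eq_zero_or_pos (rowCount (f 1 a) y) with h0 | h0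
  · have hl : Linked (reach f a y 1) := linked_of_row (x := y) fun z =>
      reach_one_iff.2 ⟨rfl, (rowCount_eq_zero_iff _ _).1 h0 z⟩
    have := (two_le_rowCount_iff (fun w => f 0 w y) a).2 fun w w' hww =>
      hw.guess_of_linked le_rfl (Set.mem_univ a) (by omega) hl hww
    omega
  · have hF := reach_one_forked (f := f) (a := a) (y := y) (by omega)
    obtain ⟨w, hw'⟩ := hw.guess_of_forked le_rfl (Set.mem_univ a) (by omega) hF
    have h2 : rowCount (fun w => f 0 w y) a = 0 := by omega
    exact (rowCount_eq_zero_iff _ _).1 h2 w hw'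

lemma eq_two_of_sum_le {X : Fin 3 → Fin 3 → ℕ} (h : ∀ a y, 2 ≤ X a y)
    (hs : ∑ a, ∑ y, X a y ≤ 18) (a y : Fin 3) : X a y = 2 := by
  simp only [Fin.sum_univ_three] at hs
  have h00 := h 0 0
  have h01 := h 0 1
  have h02 := h 0 2
  have h10 := h 1 0
  have h11 := h 1 1
  have h12 := h 1 2
  have h20 := h 2 0
  have h21 := h 2 1
  have h22 := h 2 2
  clear h
  have key : ∀ x : Fin 3, x = 0 ∨ x = 1 ∨ x = 2 := by decide
  rcases key a with rfl | rfl | rfl <;> rcases key y with rfl | rfl | rfl <;> omega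

lemma CycStrategyWins.rowCount_add_zero (hn : 5 ≤ n) (hw : CycStrategyWins n Set.univ f)
    (a y : Fin 3) : rowCount (f 1 a) y + rowCount (fun w => f 0 w y) a = 2 := by
  refine eq_two_of_sum_le (X := fun a y => rowCount (f 1 a) y + rowCount (fun w => f 0 w y) a)
    (hw.rowCount_add_ge hn) ?_ a y
  simp only [Finset.sum_add_distrib]
  have h1 : ∑ a, ∑ y, rowCount (f 1 a) y = 9 := by
    simp only [Fin.sum_univ_three, rowCount_sum]
  have h2 : ∑ a, ∑ y, rowCount (fun w => f 0 w y) a = 9 := by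
    rw [Finset.sum_comm]
    simp only [Fin.sum_univ_three, rowCount_sum]
  omega

lemma CycStrategyWins.not_linked (hn : 5 ≤ n) (hw : CycStrategyWins n Set.univ f)
    {a y : Fin 3} (h : rowCount (f 1 a) y = 1) : ¬ Linked (reach f a y 3) := by
  obtain ⟨m, rfl⟩ : ∃ m, n = m + 1 := ⟨n - 1, by omega⟩
  intro hl
  have := (two_le_rowCount_iff (fun w => f 0 w y) a).2 fun w w' hww =>
      hw.guess_of_linked le_rfl (Set.mem_univ a) (by omega) hl hww
  have := hw.rowCount_add_zero hn a y
  omega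

lemma CycStrategyWins.not_forked (hn : 5 ≤ n) (hw : CycStrategyWins n Set.univ f)
    {a y : Fin 3} (h : rowCount (f 1 a) y = 2) : ¬ Forked (reach f a y 2) := by
  obtain ⟨m, rfl⟩ : ∃ m, n = m + 1 := ⟨n - 1, by omega⟩
  intro hl
  obtain ⟨w, hw'⟩ := hw.guess_of_forked le_rfl (Set.mem_univ a) (by omega) hl
  have := hw.rowCount_add_zero hn a y
  have h2 : rowCount (fun w => f 0 w y) a = 0 := by omega
  exact (rowCount_eq_zero_iff _ _).1 h2 w hw'

lemma CycStrategyWins.rowCount_add (hn : 5 ≤ n) (hw : CycStrategyWins n Set.univ f) (i : ℤ)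
    (a y : Fin 3) : rowCount (f (i + 1) a) y + rowCount (fun w => f i w y) a = 2 := by
  simpa [add_comm] using (hw.rotate i).rowCount_add_zero hn a y

lemma CycStrategyWins.rowCount_le (hn : 5 ≤ n) (hw : CycStrategyWins n Set.univ f) (i : ℤ)
    (a y : Fin 3) : rowCount (f i a) y ≤ 2 := by
  have := hw.rowCount_add hn (i - 1) a y
  rw [sub_add_cancel] at this
  omega

lemma CycStrategyWins.col_sum (hn : 5 ≤ n) (hw : CycStrategyWins n Set.univ f) (i : ℤ)
    (y : Fin 3) : rowCount (f i 0) y + rowCount (f i 1) y + rowCount (f i 2) y = 3 := by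
  have h0 := hw.rowCount_add hn (i - 1) 0 y
  have h1 := hw.rowCount_add hn (i - 1) 1 y
  have h2 := hw.rowCount_add hn (i - 1) 2 y
  have := rowCount_sum (fun w => f (i - 1) w y)
  rw [sub_add_cancel] at h0 h1 h2
  omega

lemma CycStrategyWins.rowCount_next_eq_two (hn : 5 ≤ n) (hw : CycStrategyWins n Set.univ f)
    (i : ℤ) {a y p : Fin 3} (h : rowCount (f i a) y = 2) (hp : f i a p ≠ y) :
    rowCount (f (i + 1) y) p = 2 := by
  have hF := (hw.rotate (i - 1)).not_forked hn (a := a) (y := y) (by simpa using h)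
  have e1 : f (((1 : ℕ) : ℤ) + 1 + (i - 1)) = f (i + 1) := by congr 1; push_cast; ring
  refine le_antisymm (hw.rowCount_le hn _ _ _) ?_
  rw [two_le_rowCount_iff]
  intro w w' hww
  by_contra! hc
  refine hF ⟨p, w, w', hww, ⟨y, reach_one_iff.2 ⟨rfl, by simpa using hp⟩, ?_⟩,
    ⟨y, reach_one_iff.2 ⟨rfl, by simpa using hp⟩, ?_⟩⟩
  · beta_reduce
    rw [e1]
    exact hc.1
  · beta_reduce
    rw [e1]
    exact hc.2

lemma CycStrategyWins.exists_next_eq (hn : 5 ≤ n) (hw : CycStrategyWins n Set.univ f)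
    (i : ℤ) {a y z : Fin 3} (h : rowCount (f i a) y = 1) (hz : f i a z ≠ y) :
    ∃ w, f (i + 1) y w = z := by
  have hL := (hw.rotate (i - 1)).not_linked hn (a := a) (y := y) (by simpa using h)
  have e1 : f (((1 : ℕ) : ℤ) + 1 + (i - 1)) = f (i + 1) := by congr 1; push_cast; ring
  by_contra! hc
  refine hL (reach_linked_mono le_rfl (k := 2) (linked_of_row (x := z) fun w => ?_) 1)
  refine ⟨y, reach_one_iff.2 ⟨rfl, by simpa using hz⟩, ?_⟩
  beta_reduce
  rw [e1]
  exact hc w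

lemma CycStrategyWins.exists_next_next_eq (hn : 5 ≤ n) (hw : CycStrategyWins n Set.univ f)
    (i : ℤ) {a y : Fin 3} (h : rowCount (f i a) y = 1) (w : Fin 3) :
    ∃ u, ∀ z, f i a z ≠ y → f (i + 1) y w ≠ z → f (i + 1 + 1) z u = w := by
  have hL := (hw.rotate (i - 1)).not_linked hn (a := a) (y := y) (by simpa using h)
  have e1 : f (((1 : ℕ) : ℤ) + 1 + (i - 1)) = f (i + 1) := by congr 1; push_cast; ring
  have e2 : f (((2 : ℕ) : ℤ) + 1 + (i - 1)) = f (i + 1 + 1) := by congr 1; push_cast; ring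
  by_contra! hc
  refine hL (linked_of_row (x := w) fun u => ?_)
  obtain ⟨z, hz, hw1, hw2⟩ := hc u
  refine ⟨z, ⟨y, reach_one_iff.2 ⟨rfl, by simpa using hz⟩, ?_⟩, ?_⟩
  · beta_reduce
    rw [e1]
    exact hw1
  · beta_reduce
    rw [e2]
    exact hw2

lemma forall_of_periodic {P : ℤ → Prop} {n : ℕ} (hn : 0 < n) (hP : ∀ i, P (i + n) = P i)
    (hs : ∀ i, P i → P (i + 1)) {i : ℤ} (hi : P i) (j : ℤ) : P j := by
  have h1 : ∀ k : ℕ, P (i + k) := by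
    intro k
    induction k with
    | zero => simpa using hi
    | succ k ih => simpa [add_assoc] using hs _ ih
  have h2 : P (j + (n * (i - j).natAbs : ℕ)) := by
    have h4 : ((i - j).natAbs : ℤ) ≤ (n * (i - j).natAbs : ℕ) := by
      exact_mod_cast Nat.le_mul_of_pos_left _ hn
    obtain ⟨k, hk⟩ : ∃ k : ℕ, j + (n * (i - j).natAbs : ℕ) = i + k :=
      ⟨(j - i + (n * (i - j).natAbs : ℕ)).toNat, by omega⟩
    rw [hk]
    exact h1 _
  have h3 : ∀ k : ℕ, P (j + (n * k : ℕ)) → P j := by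
    intro k
    induction k with
    | zero => simp
    | succ k ih =>
      intro h
      apply ih
      rw [← hP]
      convert h using 1
      push_cast; ring
  exact h3 _ h2

end Rules

section Odd

variable {n : ℕ} {f : ℤ → Fin 3 → Fin 3 → Fin 3}

lemma fin_three_cases (x : Fin 3) : x = 0 ∨ x = 1 ∨ x = 2 := by
  revert x; decide

lemma not_forall_rowCount_eq_one (hn : 5 ≤ n) (hw : CycStrategyWins n Set.univ f) :
    ¬ ∀ i a y, rowCount (f i a) y = 1 := by
  intro h
  obtain ⟨p, hp⟩ := (rowCount_eq_one_iff _ _).1 (h 0 0 0)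
  obtain ⟨w, hw'⟩ := (rowCount_eq_one_iff _ _).1 (h (0 + 1) 0 p)
  obtain ⟨u, hu⟩ := hw.exists_next_next_eq hn 0 (h 0 0 0) w
  have h1 := hw.rowCount_add hn (0 + 1 + 1) w u
  rw [h (0 + 1 + 1 + 1) w u] at h1
  have h2 : rowCount (fun z => f (0 + 1 + 1) z u) w = 1 := by omega
  obtain ⟨z0, hz0⟩ := (rowCount_eq_one_iff _ _).1 h2
  have h3 : ∀ z, z ≠ p → z = z0 := fun z hz => (hz0 z).1
    (hu z (fun h => hz ((hp z).1 h)) (fun h => hz (((hw' w).2 rfl).symm.trans h).symm))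
  have h4 : ∀ p z0 : Fin 3, ¬ ∀ z, z ≠ p → z = z0 := by decide
  exact h4 _ _ h3

/-- The `3 × 3` table `g` has one balanced row `x₀`; in the two other rows one color is guessed
twice. -/
structure Mixed (g : Fin 3 → Fin 3 → Fin 3) (x₀ x₁ x₂ y₀ y₁ y₂ p₁ p₂ : Fin 3) : Prop where
  hx : ∀ x, x = x₀ ∨ x = x₁ ∨ x = x₂
  hy₀₁ : y₀ ≠ y₁
  hy₀₂ : y₀ ≠ y₂
  hy₁₂ : y₁ ≠ y₂
  row₀ : ∀ y, rowCount (g x₀) y = 1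
  row₁ : ∀ z, g x₁ z = y₁ ↔ z ≠ p₁
  row₁' : g x₁ p₁ = y₀
  row₂ : ∀ z, g x₂ z = y₂ ↔ z ≠ p₂
  row₂' : g x₂ p₂ = y₀

/-- Classification of the tables with a balanced row and two further rows that have a repeated
color. -/
lemma exists_mixed {g : Fin 3 → Fin 3 → Fin 3} {x₀ x₁ x₂ y₁ y₂ : Fin 3}
    (hx : ∀ x, x = x₀ ∨ x = x₁ ∨ x = x₂)
    (hc : ∀ y, rowCount (g 0) y + rowCount (g 1) y + rowCount (g 2) y = 3)
    (h₀ : ∀ y, rowCount (g x₀) y = 1) (h₁ : rowCount (g x₁) y₁ = 2)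
    (h₂ : rowCount (g x₂) y₂ = 2) :
    ∃ y₀ p₁ p₂, Mixed g x₀ x₁ x₂ y₀ y₁ y₂ p₁ p₂ := by
  have hperm : ∀ x₀ x₁ x₂ : Fin 3, (∀ x, x = x₀ ∨ x = x₁ ∨ x = x₂) →
      ∀ F : Fin 3 → ℕ, F 0 + F 1 + F 2 = F x₀ + F x₁ + F x₂ := by
    intro x₀ x₁ x₂ h F
    have := h 0
    have := h 1
    have := h 2
    rcases fin_three_cases x₀ with rfl | rfl | rfl <;>
    rcases fin_three_cases x₁ with rfl | rfl | rfl <;>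
    rcases fin_three_cases x₂ with rfl | rfl | rfl <;> omega
  have hc' : ∀ y, rowCount (g x₀) y + rowCount (g x₁) y + rowCount (g x₂) y = 3 := fun y => by
    rw [← hc y, hperm _ _ _ hx (fun x => rowCount (g x) y)]
  have hc1 := hc' y₁
  have hc2 := hc' y₂
  rw [h₀, h₁] at hc1
  rw [h₀, h₂] at hc2
  have hy : y₁ ≠ y₂ := by rintro rfl; omega
  have hex : ∀ y₁ y₂ : Fin 3, y₁ ≠ y₂ → ∃ y₀, y₀ ≠ y₁ ∧ y₀ ≠ y₂ := by decide
  obtain ⟨y₀, hy1, hy2⟩ := hex _ _ hy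
  have key : ∀ (r : Fin 3 → Fin 3) (y₀ y₁ y₂ : Fin 3), y₀ ≠ y₁ → y₀ ≠ y₂ → y₁ ≠ y₂ →
      rowCount r y₂ = 0 → ∀ p, (∀ z, r z = y₁ ↔ z ≠ p) → r p = y₀ := by
    intro r y₀ y₁ y₂ h01 h02 h12 h0 p hp
    have e1 := (rowCount_eq_zero_iff _ _).1 h0 p
    have e2 : r p ≠ y₁ := fun h => (hp p).1 h rfl
    have : ∀ a b c d : Fin 3, a ≠ b → a ≠ c → b ≠ c → d ≠ c → d ≠ b → d = a := by omega
    exact this _ _ _ _ h01 h02 h12 e1 e2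
  obtain ⟨p₁, hp1⟩ := (rowCount_eq_two_iff _ _).1 h₁
  obtain ⟨p₂, hp2⟩ := (rowCount_eq_two_iff _ _).1 h₂
  exact ⟨y₀, p₁, p₂, hx, hy1, hy2, hy, h₀, hp1, key _ y₀ y₁ y₂ hy1 hy2 hy (by omega) _ hp1, hp2,
    key _ y₀ y₂ y₁ hy2 hy1 hy.symm (by omega) _ hp2⟩

lemma Mixed.next (hn : 5 ≤ n) (hw : CycStrategyWins n Set.univ f) {i : ℤ}
    {x₀ x₁ x₂ y₀ y₁ y₂ p₁ p₂ : Fin 3} (h : Mixed (f i) x₀ x₁ x₂ y₀ y₁ y₂ p₁ p₂)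
    (hB : ∃ a, ∀ y, rowCount (f (i + 1) a) y = 1) :
    ∃ Q r₁ r₂, Mixed (f (i + 1)) y₀ y₁ y₂ Q p₁ p₂ r₁ r₂ ∧ (∀ z, f i x₀ z = y₀ ↔ z = Q) := by
  have h1 : rowCount (f (i + 1) y₁) p₁ = 2 := hw.rowCount_next_eq_two hn i
    ((rowCount_eq_two_iff _ _).2 ⟨p₁, h.row₁⟩) (fun hh => (h.row₁ p₁).1 hh rfl)
  have h2 : rowCount (f (i + 1) y₂) p₂ = 2 := hw.rowCount_next_eq_two hn i
    ((rowCount_eq_two_iff _ _).2 ⟨p₂, h.row₂⟩) (fun hh => (h.row₂ p₂).1 hh rfl)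
  have hy : ∀ y, y = y₀ ∨ y = y₁ ∨ y = y₂ := by
    have : ∀ a b c : Fin 3, a ≠ b → a ≠ c → b ≠ c → ∀ y, y = a ∨ y = b ∨ y = c := by decide
    exact this _ _ _ h.hy₀₁ h.hy₀₂ h.hy₁₂
  obtain ⟨b, hb⟩ := hB
  obtain rfl : b = y₀ := by
    rcases hy b with rfl | rfl | rfl
    · rfl
    · rw [hb] at h1; omega
    · rw [hb] at h2; omega
  obtain ⟨Q, r₁, r₂, hM⟩ := exists_mixed hy (hw.col_sum hn (i + 1)) hb h1 h2
  refine ⟨Q, r₁, r₂, hM, ?_⟩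
  obtain ⟨p, hp⟩ := (rowCount_eq_one_iff _ _).1 (h.row₀ b)
  have hE : ∀ u, rowCount (fun w => f i w u) b = 1 := fun u => by
    have := hw.rowCount_add hn i b u
    rw [hb] at this
    omega
  have hne : ∀ {x u}, f i x u = b → x ≠ x₀ → u ≠ p := by
    rintro x u hxu hx rfl
    obtain ⟨v, hv⟩ := (rowCount_eq_one_iff _ _).1 (hE u)
    exact hx (((hv x).1 hxu).trans ((hv x₀).1 ((hp u).2 rfl)).symm)
  have hx1 : x₁ ≠ x₀ := by
    rintro rfl
    have := (rowCount_eq_two_iff _ _).2 ⟨p₁, h.row₁⟩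
    rw [h.row₀] at this
    omega
  have hx2 : x₂ ≠ x₀ := by
    rintro rfl
    have := (rowCount_eq_two_iff _ _).2 ⟨p₂, h.row₂⟩
    rw [h.row₀] at this
    omega
  have hp1 := hne h.row₁' hx1
  have hp2 := hne h.row₂' hx2
  have : ∀ a b c d : Fin 3, a ≠ b → a ≠ c → b ≠ c → b ≠ d → c ≠ d → d = a := by omega
  obtain rfl := this _ _ _ _ hM.hy₀₁ hM.hy₀₂ hM.hy₁₂ hp1 hp2
  exact hp

lemma not_mixed (hn : 5 ≤ n) (hw : CycStrategyWins n Set.univ f)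
    (hB : ∀ i, ∃ a, ∀ y, rowCount (f i a) y = 1) {i : ℤ} {x₀ x₁ x₂ y₀ y₁ y₂ p₁ p₂ : Fin 3}
    (h : Mixed (f i) x₀ x₁ x₂ y₀ y₁ y₂ p₁ p₂) : False := by
  obtain ⟨Q, r₁, r₂, hg, hQ⟩ := h.next hn hw (hB _)
  obtain ⟨Q', a₁, a₂, hh, hQ'⟩ := hg.next hn hw (hB _)
  obtain ⟨_, _, _, hk, _⟩ := hh.next hn hw (hB _)
  obtain ⟨u, hu⟩ := hw.exists_next_next_eq hn i (h.row₀ y₀) Q'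
  have hQQ : f (i + 1) y₀ Q' = Q := (hQ' Q').2 rfl
  have h1 := hu p₁ (fun e => hg.hy₀₁ ((hQ p₁).1 e).symm) (fun e => hg.hy₀₁ (hQQ.symm.trans e))
  have h2 := hu p₂ (fun e => hg.hy₀₂ ((hQ p₂).1 e).symm) (fun e => hg.hy₀₂ (hQQ.symm.trans e))
  have e1 : u = a₁ := by
    by_contra hne
    exact hh.hy₀₁ (h1.symm.trans ((hh.row₁ u).2 hne))
  have e2 : u = a₂ := by
    by_contra hne
    exact hh.hy₀₂ (h2.symm.trans ((hh.row₂ u).2 hne))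
  exact hk.hy₁₂ (e1.symm.trans e2)

lemma exists_rowCount_eq_two : ∀ r : Fin 3 → Fin 3, (∀ y, rowCount r y ≤ 2) →
    (∃ y, rowCount r y ≠ 1) → ∃ y, rowCount r y = 2 := by decide

/-- A winning strategy on a cycle of length at least 5 has no balanced row. -/
lemma forall_exists_rowCount_ne_one (hn : 5 ≤ n) (hw : CycStrategyWins n Set.univ f) (i : ℤ)
    (a : Fin 3) : ∃ y, rowCount (f i a) y ≠ 1 := by
  by_contra! hc
  have htwo : ∀ i a, (∃ y, rowCount (f i a) y ≠ 1) → ∃ y, rowCount (f i a) y = 2 :=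
    fun i a => exists_rowCount_eq_two _ (hw.rowCount_le hn i a)
  have hnext : ∀ i a y, rowCount (f i a) y = 2 → ∃ z, rowCount (f (i + 1) y) z = 2 := by
    intro i a y h
    obtain ⟨p, hp⟩ := (rowCount_eq_two_iff _ _).1 h
    exact ⟨p, hw.rowCount_next_eq_two hn i h (fun e => (hp p).1 e rfl)⟩
  have hper : ∀ i : ℤ, f (i + n) = f i := hw.1
  have hB : ∀ i, ∃ a, ∀ y, rowCount (f i a) y = 1 := by
    by_contra! hN
    obtain ⟨j, hj⟩ := hN
    have hstep : ∀ i, (∀ a, ∃ y, rowCount (f i a) y ≠ 1) →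
        ∀ a, ∃ y, rowCount (f (i + 1) a) y ≠ 1 := by
      intro i hi
      choose t ht using fun a => htwo i a (hi a)
      have hinj : Function.Injective t := by
        intro a a' h
        by_contra hne
        have h1 := hw.col_sum hn i (t a)
        have h2 := ht a
        have h3 := ht a'
        rw [← h] at h3
        rcases fin_three_cases a with rfl | rfl | rfl <;>
        rcases fin_three_cases a' with rfl | rfl | rfl <;> omega
      intro a
      obtain ⟨b, rfl⟩ := (Finite.injective_iff_surjective.1 hinj) a
      obtain ⟨z, hz⟩ := hnext i b _ (ht b)
      exact ⟨z, by omega⟩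
    obtain ⟨y, hy⟩ := forall_of_periodic (P := fun i => ∀ a, ∃ y, rowCount (f i a) y ≠ 1)
      (n := n) (by omega) (fun i => by simp only [hper]) hstep hj i a
    exact hy (hc y)
  by_cases hA : ∀ i a y, rowCount (f i a) y = 1
  · exact not_forall_rowCount_eq_one hn hw hA
  · push Not at hA
    obtain ⟨i, x₁, y, hy⟩ := hA
    obtain ⟨y₁, h₁⟩ := htwo i x₁ ⟨y, hy⟩
    obtain ⟨x₀, h₀⟩ := hB i
    have hx10 : x₁ ≠ x₀ := by
      rintro rfl
      exact hy (h₀ y)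
    have hex : ∀ a b : Fin 3, a ≠ b → ∃ c, ∀ x, x = b ∨ x = a ∨ x = c := by decide
    obtain ⟨x₂, hx⟩ := hex _ _ hx10
    have h₂ : ∃ y, rowCount (f i x₂) y ≠ 1 := by
      by_contra! h2
      have hs := hw.col_sum hn i y₁
      have h0 := h₀ y₁
      have h2' := h2 y₁
      have k0 := hx 0
      have k1 := hx 1
      have k2 := hx 2
      rcases fin_three_cases x₀ with rfl | rfl | rfl <;>
      rcases fin_three_cases x₁ with rfl | rfl | rfl <;>
      rcases fin_three_cases x₂ with rfl | rfl | rfl <;> omega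
    obtain ⟨y₂, h₂⟩ := htwo i x₂ h₂
    obtain ⟨y₀, p₁, p₂, hM⟩ := exists_mixed hx (hw.col_sum hn i) h₀ h₁ h₂
    exact not_mixed hn hw hB hM

lemma injective_of_cols : ∀ t o : Fin 3 → Fin 3, (∀ x, t x ≠ o x) →
    (∀ y : Fin 3, (if t 0 = y then 2 else if o 0 = y then 1 else 0) +
      (if t 1 = y then 2 else if o 1 = y then 1 else 0) +
      (if t 2 = y then 2 else if o 2 = y then 1 else 0) = 3) →
    Function.Injective t ∧ Function.Injective o := by
  intro t o h hy
  have h0 := h 0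
  have h1 := h 1
  have h2 := h 2
  have y0 := hy 0
  have y1 := hy 1
  have y2 := hy 2
  clear h hy
  have aux : ∀ t0 t1 t2 o0 o1 o2 : Fin 3, t0 ≠ o0 → t1 ≠ o1 → t2 ≠ o2 →
      (if t0 = 0 then 2 else if o0 = 0 then 1 else 0) +
      (if t1 = 0 then 2 else if o1 = 0 then 1 else 0) +
      (if t2 = 0 then 2 else if o2 = 0 then 1 else 0) = 3 →
      (if t0 = 1 then 2 else if o0 = 1 then 1 else 0) +
      (if t1 = 1 then 2 else if o1 = 1 then 1 else 0) +
      (if t2 = 1 then 2 else if o2 = 1 then 1 else 0) = 3 →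
      (if t0 = 2 then 2 else if o0 = 2 then 1 else 0) +
      (if t1 = 2 then 2 else if o1 = 2 then 1 else 0) +
      (if t2 = 2 then 2 else if o2 = 2 then 1 else 0) = 3 →
      (t0 ≠ t1 ∧ t0 ≠ t2 ∧ t1 ≠ t2) ∧ o0 ≠ o1 ∧ o0 ≠ o2 ∧ o1 ≠ o2 := by
    set_option synthInstance.maxSize 1000 in decide
  obtain ⟨⟨ht1, ht2, ht3⟩, ho1, ho2, ho3⟩ := aux _ _ _ _ _ _ h0 h1 h2 y0 y1 y2
  clear aux y0 y1 y2 h0 h1 h2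
  have inj : ∀ r : Fin 3 → Fin 3, r 0 ≠ r 1 → r 0 ≠ r 2 → r 1 ≠ r 2 → Function.Injective r := by
    intro r h1 h2 h3 a b hab
    rcases fin_three_cases a with rfl | rfl | rfl <;>
    rcases fin_three_cases b with rfl | rfl | rfl <;> first | rfl | omega
  exact ⟨inj t ht1 ht2 ht3, inj o ho1 ho2 ho3⟩

lemma exists_fixed : ∀ ρ σ : Fin 3 → Fin 3, Function.Injective ρ → (∀ x, σ x ≠ x) →
    (∃ x, ρ x = x) ∨ (∃ x, ρ (σ x) = x) ∨ ∃ x, ρ (σ (σ x)) = x := by decide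

lemma iterate_three : ∀ σ : Fin 3 → Fin 3, Function.Injective σ → (∀ x, σ x ≠ x) →
    ∀ x, σ (σ (σ x)) = x := by decide

theorem not_cycStrategyWins_three (hn : 5 ≤ n) (h3 : ¬ 3 ∣ n) :
    ¬ CycStrategyWins n Set.univ f := by
  intro hw
  have hdata : ∀ r : Fin 3 → Fin 3, ∃ t o m p, (∀ y, rowCount r y ≤ 2) →
      (∃ y, rowCount r y ≠ 1) → t ≠ o ∧ o ≠ m ∧ t ≠ m ∧ (∀ z, r z = t ↔ z ≠ p) ∧ r p = o := by
    intro r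
    by_cases h : (∀ y, rowCount r y ≤ 2) ∧ ∃ y, rowCount r y ≠ 1
    · obtain ⟨t, o, m, p, h'⟩ := exists_row_data r h.1 h.2
      exact ⟨t, o, m, p, fun _ _ => h'⟩
    · exact ⟨0, 0, 0, 0, fun h1 h2 => absurd ⟨h1, h2⟩ h⟩
  choose t o m p hdata using hdata
  replace hdata := fun i x => hdata (f i x) (hw.rowCount_le hn i x)
    (forall_exists_rowCount_ne_one hn hw i x)
  have hto := fun i x => (hdata i x).1
  have hom := fun i x => (hdata i x).2.1
  have htm := fun i x => (hdata i x).2.2.1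
  have hp := fun i x => (hdata i x).2.2.2.1
  have hpo := fun i x => (hdata i x).2.2.2.2
  clear hdata
  have third : ∀ a b c d : Fin 3, a ≠ b → a ≠ c → b ≠ c → d ≠ a → d ≠ b → d = c := by omega
  have hct : ∀ i x, rowCount (f i x) (t (f i x)) = 2 := fun i x =>
    (rowCount_eq_two_iff _ _).2 ⟨_, hp i x⟩
  have hco : ∀ i x z, f i x z = o (f i x) ↔ z = p (f i x) := by
    intro i x z
    refine ⟨fun h => ?_, fun h => h ▸ hpo i x⟩
    by_contra hne
    exact hto i x (((hp i x z).2 hne).symm.trans h)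
  have hco1 : ∀ i x, rowCount (f i x) (o (f i x)) = 1 := fun i x =>
    (rowCount_eq_one_iff _ _).2 ⟨_, hco i x⟩
  have hfm : ∀ i x z, f i x z ≠ m (f i x) := by
    intro i x z h
    by_cases hz : z = p (f i x)
    · exact hom i x (((hco i x z).2 hz).symm.trans h)
    · exact htm i x (((hp i x z).2 hz).symm.trans h)
  have hTT : ∀ i x, t (f (i + 1) (t (f i x))) = p (f i x) := by
    intro i x
    have h2 := hw.rowCount_next_eq_two hn i (hct i x) (p := p (f i x))
      (fun h => (hp i x _).1 h rfl)
    obtain ⟨u, hu⟩ := (rowCount_eq_two_iff _ _).1 h2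
    by_contra hne
    have : ∀ a b : Fin 3, ∃ z, z ≠ a ∧ z ≠ b := by decide
    obtain ⟨z, hz1, hz2⟩ := this u (p (f (i + 1) (t (f i x))))
    exact hne (((hp _ _ z).2 hz2).symm.trans ((hu z).2 hz1))
  have hMO : ∀ i x, m (f (i + 1) (o (f i x))) = p (f i x) := by
    intro i x
    by_contra hne
    obtain ⟨w, hw'⟩ := hw.exists_next_eq hn i (hco1 i x) (z := m (f (i + 1) (o (f i x))))
      (fun h => hne ((hco i x _).1 h))
    exact hfm _ _ _ hw'
  have hinj : ∀ i, Function.Injective (fun x => t (f i x)) ∧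
      Function.Injective (fun x => o (f i x)) := by
    intro i
    refine injective_of_cols _ _ (hto i) fun y => ?_
    have hy := hw.col_sum hn i y
    have : ∀ x, rowCount (f i x) y =
        if t (f i x) = y then 2 else if o (f i x) = y then 1 else 0 := by
      intro x
      split_ifs with h1 h2
      · rw [← h1, hct]
      · rw [← h2, hco1]
      · rw [third _ _ _ y (hto i x) (htm i x) (hom i x) (Ne.symm h1) (Ne.symm h2)]
        exact (rowCount_eq_zero_iff _ _).2 (hfm i x)
    rwa [this, this, this] at hy
  let g : ℕ → Fin 3 → Fin 3 := fun k => Nat.rec (motive := fun _ => Fin 3 → Fin 3) id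
    (fun k gk x => t (f (k + 1) (gk x))) k
  have hg0 : ∀ x, g 0 x = x := fun _ => rfl
  have hgs : ∀ k x, g (k + 1) x = t (f (k + 1) (g k x)) := fun _ _ => rfl
  have hginj : ∀ k, Function.Injective (g k) := by
    intro k
    induction k with
    | zero => exact Function.injective_id
    | succ k ih => exact (hinj _).1.comp ih
  obtain ⟨σ, hσ⟩ : ∃ σ : Fin 3 → Fin 3, ∀ x, t (f 1 (σ x)) = o (f 1 x) := by
    choose σ hσ using fun x => (Finite.injective_iff_surjective.1 (hinj 1).1) (o (f 1 x))
    exact ⟨σ, hσ⟩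
  have hσne : ∀ x, σ x ≠ x := by
    intro x h
    have := hσ x
    rw [h] at this
    exact hto 1 x this
  have hσinj : Function.Injective σ := by
    intro x y h
    apply (hinj 1).2
    show o (f 1 x) = o (f 1 y)
    rw [← hσ, ← hσ, h]
  have hσ3 := iterate_three σ hσinj hσne
  have hσ2 : ∀ x, σ (σ x) ≠ x := fun x h => hσne x (by simpa [h] using hσ3 x)
  have key : ∀ k x, o (f (k + 1 : ℕ) (g k x)) = g (k + 1) (σ x) ∧
      m (f (k + 1 : ℕ) (g k x)) = g (k + 1) (σ (σ x)) := by
    intro k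
    induction k with
    | zero =>
      intro x
      simp only [hgs, hg0]
      norm_num
      refine ⟨(hσ x).symm, ?_⟩
      refine (third _ _ _ _ (hto 1 x) (htm 1 x) (hom 1 x) ?_ ?_).symm
      · exact fun h => hσ2 x ((hinj 1).1 h)
      · rw [← hσ x]
        exact fun h => hσne _ ((hinj 1).1 h)
    | succ k ih =>
      have hM : ∀ x, m (f (k + 1 + 1 : ℕ) (g (k + 1) x)) = g (k + 1 + 1) (σ (σ x)) := by
        intro x
        have h1 := hMO (k + 1) (g k (σ (σ x)))
        have h2 := hTT (k + 1) (g k (σ (σ x)))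
        have h3 := (ih (σ (σ x))).1
        rw [hσ3] at h3
        rw [hgs (k + 1), hgs k]
        push_cast at h3 ⊢
        rw [h2, ← h1, h3]
      intro x
      refine ⟨?_, hM x⟩
      have e1 := hto (k + 1 + 1 : ℕ) (g (k + 1) x)
      have e2 := hom (k + 1 + 1 : ℕ) (g (k + 1) x)
      have e3 := htm (k + 1 + 1 : ℕ) (g (k + 1) x)
      have e4 := hgs (k + 1) x
      have e5 := hM x
      push_cast at e1 e2 e3 e4 e5 ⊢
      refine (third _ _ _ _ e3 e1 e2.symm ?_ ?_).symm
      · rw [← e4]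
        exact fun h => hσne x (hginj (k + 1 + 1) h)
      · rw [e5]
        exact fun h => hσne _ (hginj (k + 1 + 1) h).symm
  have chain : ∀ (E : (Fin 3 → Fin 3) → Fin 3),
      (∀ i x, f i x (E (f (i + 1) (E (f i x)))) ≠ E (f i x)) →
      ∀ c : ℕ → Fin 3, (∀ k : ℕ, c (k + 1) = E (f (k + 1 : ℕ) (c k))) → c n ≠ c 0 := by
    intro E hE c hc hn0
    obtain ⟨m, rfl⟩ : ∃ m, n = m + 1 := ⟨n - 1, by omega⟩
    have hwrong : ∀ k : ℕ, f (k + 1 : ℕ) (c k) (c (k + 2)) ≠ c (k + 1) := by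
      intro k
      have := hE (k + 1 : ℕ) (c k)
      rw [← hc k] at this
      have h2 := hc (k + 1)
      push_cast at h2 this ⊢
      rwa [← h2] at this
    rcases hw.exists_of_closed c (Set.mem_univ _) hn0 with h | ⟨i, -, h⟩
    · have h1 := hwrong m
      have hf0 : f (m + 1 : ℕ) = f 0 := by
        have := hw.1 0
        rwa [zero_add] at this
      have hf1 : f (m + 1 + 1 : ℕ) = f 1 := by
        have := hw.1 1
        rw [← this]
        congr 1
        push_cast
        ring
      have h2 := hc (m + 1)
      rw [hf1, hn0] at h2
      have h3 := hc 0
      rw [hf0, hn0, h2] at h1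
      norm_num at h3
      rw [← h3] at h1
      exact h1 h
    · exact hwrong i (by exact_mod_cast h)
  have hT := chain t (fun i x h => (hp i x _).1 h (hTT i x))
  have hO := chain o (fun i x h => hom _ _ (((hco i x _).1 h).trans (hMO i x).symm))
  have hM := chain m (fun i x => hfm i x _)
  have hσit : ∀ j x, σ^[3 * j] x = x := by
    intro j x
    rw [Function.iterate_mul]
    have : σ^[3] = id := funext hσ3
    rw [this, Function.iterate_id]
    rfl
  have c0 : ∀ x, g n x ≠ x := fun x => hT (fun k => g k x) (fun k => by simp [hgs])
  have c1 : ∀ x, g n (σ^[n] x) ≠ x := fun x => hO (fun k => g k (σ^[k] x)) (fun k => by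
    rw [(key k _).1, Function.iterate_succ_apply'])
  have c2 : ∀ x, g n (σ^[2 * n] x) ≠ x := fun x => hM (fun k => g k (σ^[2 * k] x)) (fun k => by
    rw [(key k _).2, mul_add, mul_one, Function.iterate_succ_apply', Function.iterate_succ_apply'])
  have hn3 : n % 3 = 1 ∨ n % 3 = 2 := by omega
  have hfix := exists_fixed (g n) σ (hginj n) hσne
  rcases hn3 with h | h
  · have d1 : ∀ x, σ^[n] x = σ x := fun x => by
      rw [show n = 1 + 3 * (n / 3) by omega, Function.iterate_add_apply, hσit]
      rfl
    have d2 : ∀ x, σ^[2 * n] x = σ (σ x) := fun x => by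
      rw [show 2 * n = 2 + 3 * (2 * (n / 3)) by omega, Function.iterate_add_apply, hσit]
      rfl
    simp only [d1] at c1
    simp only [d2] at c2
    rcases hfix with ⟨x, hx⟩ | ⟨x, hx⟩ | ⟨x, hx⟩
    · exact c0 x hx
    · exact c1 x hx
    · exact c2 x hx
  · have d1 : ∀ x, σ^[n] x = σ (σ x) := fun x => by
      rw [show n = 2 + 3 * (n / 3) by omega, Function.iterate_add_apply, hσit]
      rfl
    have d2 : ∀ x, σ^[2 * n] x = σ x := fun x => by
      rw [show 2 * n = 1 + 3 * (2 * (n / 3) + 1) by omega, Function.iterate_add_apply, hσit]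
      rfl
    simp only [d1] at c1
    simp only [d2] at c2
    rcases hfix with ⟨x, hx⟩ | ⟨x, hx⟩ | ⟨x, hx⟩
    · exact c0 x hx
    · exact c2 x hx
    · exact c1 x hx

end Odd

section Four

variable {n : ℕ} {f : ℤ → Fin 4 → Fin 4 → Fin 4}

lemma card_fiber_sum (r : Fin 4 → Fin 4) :
    ∑ y, (Finset.univ.filter fun z => r z = y).card = 4 := by
  rw [← Finset.card_eq_sum_card_fiberwise (f := r) (s := Finset.univ) (t := Finset.univ)
    (fun _ _ => Finset.mem_coe.2 (Finset.mem_univ _))]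
  rfl

lemma card_filter_bool (P : Fin 4 → Prop) [DecidablePred P] :
    (Finset.univ.filter P).card = (Finset.univ.filter fun z => decide (P z) = true).card := by
  simp

lemma three_le_card {P : Fin 4 → Prop} [DecidablePred P] (h : ∀ w w', w ≠ w' → P w ∨ P w') :
    3 ≤ (Finset.univ.filter P).card := by
  rw [card_filter_bool]
  have key : ∀ P : Fin 4 → Bool, (∀ w w', w ≠ w' → P w = true ∨ P w' = true) →
      3 ≤ (Finset.univ.filter fun z => P z = true).card := by decide
  exact key _ (by simpa using h)

lemma two_le_card {P : Fin 4 → Prop} [DecidablePred P] {w w' : Fin 4} (hw : w ≠ w') (h : P w)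
    (h' : P w') : 2 ≤ (Finset.univ.filter P).card := by
  have : Finset.card {w, w'} ≤ (Finset.univ.filter P).card := by
    apply Finset.card_le_card
    intro x hx
    simp only [Finset.mem_insert, Finset.mem_singleton] at hx
    rcases hx with rfl | rfl <;> simpa
  rwa [Finset.card_pair hw] at this

lemma exists_of_card_le_one {P : Fin 4 → Prop} [DecidablePred P]
    (h : (Finset.univ.filter P).card ≤ 1) : ∃ z0, ∀ z, z ≠ z0 → ¬ P z := by
  rw [card_filter_bool] at h
  have key : ∀ P : Fin 4 → Bool, (Finset.univ.filter fun z => P z = true).card ≤ 1 →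
      ∃ z0, ∀ z, z ≠ z0 → ¬ P z = true := by decide
  simpa using key _ h

lemma exists_of_card_le_two {P : Fin 4 → Prop} [DecidablePred P]
    (h : (Finset.univ.filter P).card ≤ 2) : ∃ z z', z ≠ z' ∧ ¬ P z ∧ ¬ P z' := by
  rw [card_filter_bool] at h
  have key : ∀ P : Fin 4 → Bool, (Finset.univ.filter fun z => P z = true).card ≤ 2 →
      ∃ z z', z ≠ z' ∧ ¬ P z = true ∧ ¬ P z' = true := by decide
  simpa using key _ h

lemma Forked.exists_two {T : Fin 4 → Fin 4 → Prop} (h : Forked T) (g g' : Fin 4 → Fin 4 → Fin 4)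
    (u : Fin 4) : ∃ v v', v ≠ v' ∧ HatGame.stepRel g' (HatGame.stepRel g T) v u ∧
      HatGame.stepRel g' (HatGame.stepRel g T) v' u := by
  obtain ⟨x, y, y', hy, h1, h2⟩ := h
  have key : ∀ a b : Fin 4, ∃ v v' : Fin 4, v ≠ v' ∧ a ≠ v ∧ b ≠ v ∧ a ≠ v' ∧ b ≠ v' := by
    decide
  have step : ∀ v, g' y u ≠ v → g' y' u ≠ v → HatGame.stepRel g' (HatGame.stepRel g T) v u := by
    intro v hv hv'
    by_cases hg : g x v = y
    · exact ⟨y', ⟨x, h2, by rw [hg]; exact hy⟩, hv'⟩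
    · exact ⟨y, ⟨x, h1, hg⟩, hv⟩
  obtain ⟨v, v', hv, a1, a2, a3, a4⟩ := key (g' y u) (g' y' u)
  exact ⟨v, v', hv, step v a1 a2, step v' a3 a4⟩

lemma reach_two_linked {a y : Fin 4}
    (h : (Finset.univ.filter fun z => f 1 a z = y).card ≤ 1) : Linked (reach f a y 2) := by
  obtain ⟨z0, hz0⟩ := exists_of_card_le_one h
  intro u u' _
  have key : ∀ z0 a b : Fin 4, ∃ z, z ≠ z0 ∧ a ≠ z ∧ b ≠ z := by decide
  obtain ⟨z, h0, h1, h2⟩ := key z0 (f ((1 : ℕ) + 1) y u) (f ((1 : ℕ) + 1) y u')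
  exact ⟨z, ⟨y, reach_one_iff.2 ⟨rfl, hz0 z h0⟩, h1⟩, ⟨y, reach_one_iff.2 ⟨rfl, hz0 z h0⟩, h2⟩⟩

/-- The cycle of length at least 4 with one vertex of hatness 2 and all others of hatness 4 is
losing. -/
theorem not_cycStrategyWins_two_four (hn : 4 ≤ n) :
    ¬ CycStrategyWins n {a | a.val < 2} f := by
  intro hw
  obtain ⟨m, rfl⟩ : ∃ m, n = m + 3 := ⟨n - 3, by omega⟩
  set A : Fin 4 → Fin 4 → ℕ := fun a y => (Finset.univ.filter fun z => f 1 a z = y).card with hA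
  set B : Fin 4 → Fin 4 → ℕ := fun y a => (Finset.univ.filter fun w => f 0 w y = a).card with hB
  have h3 : ∀ a y, a.val < 2 → A a y ≤ 1 → 3 ≤ B y a := by
    intro a y ha h
    exact three_le_card fun w w' hww =>
      hw.guess_of_linked (by norm_num) ha (by omega) (reach_two_linked h) hww
  have h2 : ∀ a y, a.val < 2 → A a y ≤ 2 → 2 ≤ B y a := by
    intro a y ha h
    obtain ⟨z, z', hz, h1, h2⟩ := exists_of_card_le_two h
    have hF : Forked (reach f a y 1) :=
      ⟨y, z, z', hz, reach_one_iff.2 ⟨rfl, h1⟩, reach_one_iff.2 ⟨rfl, h2⟩⟩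
    have hF' := reach_forked_mono (by norm_num) hF (m - 1)
    rw [show 1 + (m - 1) = m by omega] at hF'
    obtain ⟨v, v', hv, k1, k2⟩ := hF'.exists_two (f (m + 1)) (f ((m + 1 : ℕ) + 1)) a
    exact two_le_card hv (hw.guess_eq_of_reach ha k1) (hw.guess_eq_of_reach ha k2)
  have hAs : ∀ a, A a 0 + A a 1 + A a 2 + A a 3 = 4 := fun a => by
    have := card_fiber_sum (f 1 a)
    rwa [Fin.sum_univ_four] at this
  have hBs : ∀ y, B y 0 + B y 1 + B y 2 + B y 3 = 4 := fun a => by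
    have := card_fiber_sum (fun w => f 0 w a)
    rwa [Fin.sum_univ_four] at this
  have key : ∀ a : Fin 4, a.val < 2 → 9 ≤ B 0 a + B 1 a + B 2 a + B 3 a := by
    intro a ha
    have e := hAs a
    have a0 := h3 a 0 ha
    have a1 := h3 a 1 ha
    have a2 := h3 a 2 ha
    have a3 := h3 a 3 ha
    have b0 := h2 a 0 ha
    have b1 := h2 a 1 ha
    have b2 := h2 a 2 ha
    have b3 := h2 a 3 ha
    omega
  have k0 := key 0 (by decide)
  have k1 := key 1 (by decide)
  have e0 := hBs 0
  have e1 := hBs 1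
  have e2 := hBs 2
  have e3 := hBs 3
  omega

/-- The triangle with all hatnesses 4 is losing. -/
theorem not_cycStrategyWins_triangle : ¬ CycStrategyWins 3 Set.univ f := by
  intro hw
  set A : Fin 4 → Fin 4 → ℕ := fun a y => (Finset.univ.filter fun z => f 1 a z = y).card with hA
  set B : Fin 4 → Fin 4 → ℕ := fun y a => (Finset.univ.filter fun w => f 0 w y = a).card with hB
  have h4 : ∀ a y, 3 ≤ A a y + B y a := by
    intro a y
    have hsub : (Finset.univ : Finset (Fin 4)) ⊆
        (Finset.univ.filter fun z => f 1 a z = y) ∪ (Finset.univ.filter fun w => f 0 w y = a) ∪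
          {f ((1 : ℕ) + 1) y a} := by
      intro z _
      simp only [Finset.mem_union, Finset.mem_filter, Finset.mem_univ, true_and,
        Finset.mem_singleton]
      by_contra! hc
      exact hc.1.2 (hw.guess_eq_of_reach (m := 2) (Set.mem_univ a)
        ⟨y, reach_one_iff.2 ⟨rfl, hc.1.1⟩, hc.2.symm⟩)
    have h1 := Finset.card_le_card hsub
    have h2 := Finset.card_union_le
      ((Finset.univ.filter fun z => f 1 a z = y) ∪ (Finset.univ.filter fun w => f 0 w y = a))
      {f ((1 : ℕ) + 1) y a}
    have h3 := Finset.card_union_le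
      (Finset.univ.filter fun z => f 1 a z = y) (Finset.univ.filter fun w => f 0 w y = a)
    rw [Finset.card_singleton] at h2
    rw [Finset.card_univ, Fintype.card_fin] at h1
    simp only [hA, hB]
    omega
  have h5 : ∑ _a : Fin 4, ∑ _y : Fin 4, 3 ≤ ∑ a, ∑ y, (A a y + B y a) :=
    Finset.sum_le_sum fun a _ => Finset.sum_le_sum fun y _ => h4 a y
  simp only [Finset.sum_add_distrib] at h5
  rw [Finset.sum_comm (f := fun a y => B y a)] at h5
  have h6 : ∀ a, ∑ y, A a y = 4 := fun a => card_fiber_sum (f 1 a)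
  have h7 : ∀ y, ∑ a, B y a = 4 := fun y => card_fiber_sum (fun w => f 0 w y)
  simp only [h6, h7] at h5
  simp at h5

end Four

/-- The hat guessing game on the cycle of length `n`, with `n`-periodic hatness function `h`, is
winning. -/
def CycWin (n : ℕ) (h : ℤ → ℕ) : Prop :=
  ∃ f : ℤ → ℕ → ℕ → ℕ, (∀ i, f (i + n) = f i) ∧
    ∀ c : ℤ → ℕ, (∀ i, c (i + n) = c i) → (∀ i, c i < h i) →
      ∃ i, f i (c (i - 1)) (c (i + 1)) = c i

/-- Hatness `2` at vertex `0` and hatness `q` at all others. -/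
def oneTwo (n q : ℕ) : ℤ → ℕ := fun i => if (n : ℤ) ∣ i then 2 else q

section Cycles

lemma CycWin.mono {n : ℕ} {h h' : ℤ → ℕ} (hw : CycWin n h) (hh : ∀ i, h' i ≤ h i) :
    CycWin n h' := by
  obtain ⟨f, hf, hw⟩ := hw
  exact ⟨f, hf, fun c hc hlt => hw c hc fun i => (hlt i).trans_le (hh i)⟩

lemma CycWin.of_nat {m : ℕ} {h : ℤ → ℕ} (f : ℕ → ℕ → ℕ → ℕ)
    (hf : ∀ c : ℕ → ℕ, (∀ i : ℕ, c i < h i) → (∀ i, c (i + (m + 1)) = c i) →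
      f 0 (c m) (c 1) = c 0 ∨ ∃ i < m, f (i + 1) (c i) (c (i + 2)) = c (i + 1)) :
    CycWin (m + 1) h := by
  have hmod : ∀ k : ℕ, k ≤ m → ((k : ℤ) % ((m + 1 : ℕ) : ℤ)).toNat = k := fun k hk => by
    rw [Int.emod_eq_of_lt (by omega) (by omega)]
    simp
  refine ⟨fun i => f (i % ((m + 1 : ℕ) : ℤ)).toNat, fun i => by simp, fun c hc hlt => ?_⟩
  rcases hf (fun k => c k) (fun i => hlt i) (fun i => by simpa [add_assoc] using hc i) with
    h | ⟨i, hi, h⟩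
  · refine ⟨0, ?_⟩
    have h1 := hc (0 - 1)
    rw [show (0 - 1 + ((m + 1 : ℕ) : ℤ)) = m by push_cast; ring] at h1
    simpa [h1] using h
  · refine ⟨(i + 1 : ℕ), ?_⟩
    beta_reduce
    rw [hmod (i + 1) hi]
    convert h using 3
    · push_cast
      ring
    · push_cast
      ring

/-- Repeat the color of the previous vertex, unless this is the color of the next one. -/
def stdGuess (x z : ℕ) : ℕ := if x = z then (x + 1) % 3 else x

lemma cycWin_triangle : CycWin 3 (oneTwo 3 4) := by
  refine CycWin.of_nat (m := 2) (fun i x z =>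
    if i = 0 then ((x + z) % 4) / 2 else if i = 1 then (2 + 2 * x + 3 * z) % 4
      else (3 + 3 * x + 2 * z) % 4) fun c hc hper => ?_
  have h0 : c 0 < 2 := by simpa [oneTwo] using hc 0
  have h1 : c 1 < 4 := by simpa [oneTwo] using hc 1
  have h2 : c 2 < 4 := by
    have := hc 2
    have h : ¬ (3 : ℤ) ∣ 2 := by norm_num
    simpa [oneTwo, h] using this
  have h3 : c 3 = c 0 := hper 0
  have key : ∀ a < 2, ∀ b < 4, ∀ d < 4, (d + b) % 4 / 2 = a ∨ (2 + 2 * a + 3 * d) % 4 = b ∨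
      (3 + 3 * b + 2 * a) % 4 = d := by decide
  rcases key _ h0 _ h1 _ h2 with h | h | h
  · exact Or.inl (by simpa using h)
  · exact Or.inr ⟨0, by norm_num, by simpa using h⟩
  · exact Or.inr ⟨1, by norm_num, by simpa [h3] using h⟩

lemma cycWin_four : CycWin 4 (fun _ => 3) := by
  refine CycWin.of_nat (m := 3) (fun i x z =>
    if i = 0 then (x + z) % 3 else if i = 3 then (2 * x + 2 * z) % 3
      else (2 * x + z) % 3) fun c hc hper => ?_
  have h4 : c 4 = c 0 := hper 0
  have key : ∀ c0 < 3, ∀ c1 < 3, ∀ c2 < 3, ∀ c3 < 3, (c3 + c1) % 3 = c0 ∨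
      (2 * c0 + c2) % 3 = c1 ∨ (2 * c1 + c3) % 3 = c2 ∨ (2 * c2 + 2 * c0) % 3 = c3 := by
    set_option synthInstance.maxSize 1000 in decide
  rcases key _ (hc 0) _ (hc 1) _ (hc 2) _ (hc 3) with h | h | h | h
  · exact Or.inl (by simpa using h)
  · exact Or.inr ⟨0, by norm_num, by simpa using h⟩
  · exact Or.inr ⟨1, by norm_num, by simpa using h⟩
  · exact Or.inr ⟨2, by norm_num, by simpa [h4] using h⟩

lemma stdGuess_step : ∀ x < 3, ∀ y < 3, ∀ z < 3, stdGuess x z ≠ y →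
    (z + 3 - y) % 3 ≤ (y + 3 - x) % 3 := by
  unfold stdGuess
  decide

lemma cycWin_of_three_dvd {n : ℕ} (hn : 3 ≤ n) (h3 : 3 ∣ n) : CycWin n (fun _ => 3) := by
  obtain ⟨m, rfl⟩ : ∃ m, n = m + 1 := ⟨n - 1, by omega⟩
  refine CycWin.of_nat (fun i x z =>
    if i = 0 then (stdGuess x ((z + 1) % 3) + 2) % 3 else if i = m then stdGuess x ((z + 1) % 3)
      else stdGuess x z) fun c hc hper => ?_
  by_contra! hwrong
  obtain ⟨hw0, hw⟩ := hwrong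
  set C : ℕ → ℕ := fun i => if i ≤ m then c i else (c i + 1) % 3 with hC
  have hC3 : ∀ i, C i < 3 := fun i => by
    simp only [hC]
    split_ifs
    · exact hc i
    · omega
  have hCle : ∀ i ≤ m, C i = c i := fun i hi => if_pos hi
  have hc1 : c (m + 1) = c 0 := by simpa using hper 0
  have hc2 : c (m + 2) = c 1 := by simpa [add_comm, add_left_comm] using hper 1
  have hCm : C (m + 1) = (c 0 + 1) % 3 := by simp [hC, hc1]
  have hCm' : C (m + 2) = (c 1 + 1) % 3 := by simp [hC, hc2]
  have hstd : ∀ i ≤ m, stdGuess (C i) (C (i + 2)) ≠ C (i + 1) := by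
    intro i hi
    rcases lt_or_eq_of_le hi with hi | rfl
    · have := hw i hi
      rw [if_neg (by omega)] at this
      rcases lt_or_eq_of_le (show i + 1 ≤ m from hi) with hi' | hi'
      · rw [if_neg (by omega)] at this
        rwa [hCle i (by omega), hCle (i + 1) (by omega), hCle (i + 2) (by omega)]
      · rw [if_pos hi'] at this
        rw [hCle i (by omega), hCle (i + 1) (by omega), show i + 2 = m + 1 by omega, hCm]
        rwa [show i + 2 = m + 1 by omega, hc1] at this
    · rw [if_pos rfl] at hw0
      rw [hCle i le_rfl, hCm, hCm']
      intro h
      rw [h] at hw0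
      have := hc 0
      exact hw0 (by omega)
  set d : ℕ → ℕ := fun i => (C (i + 1) + 3 - C i) % 3 with hd
  have hdle : ∀ i ≤ m, d (i + 1) ≤ d i := fun i hi =>
    stdGuess_step _ (hC3 _) _ (hC3 _) _ (hC3 _) (hstd i hi)
  have hd0 : d (m + 1) = d 0 := by
    simp only [hd]
    rw [hCm', hCm, hCle 0 (by omega), hCle 1 (by omega)]
    have := hc 0
    have := hc 1
    omega
  have hle : ∀ k ≤ m + 1, d k ≤ d 0 := by
    intro k hk
    induction k with
    | zero => exact le_rfl
    | succ k ih => exact (hdle k (by omega)).trans (ih (by omega))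
  have hge : ∀ k ≤ m + 1, d (m + 1) ≤ d (m + 1 - k) := by
    intro k hk
    induction k with
    | zero => exact le_rfl
    | succ k ih =>
      refine (ih (by omega)).trans ?_
      rw [show m + 1 - k = m + 1 - (k + 1) + 1 by omega]
      exact hdle _ (by omega)
  have hconst : ∀ k ≤ m + 1, d k = d 0 := by
    intro k hk
    have h1 := hle k hk
    have h2 := hge (m + 1 - k) (by omega)
    rw [show m + 1 - (m + 1 - k) = k by omega] at h2
    omega
  have hCk : ∀ k ≤ m + 1, C k % 3 = (C 0 + k * d 0) % 3 := by
    intro k hk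
    induction k with
    | zero => simp
    | succ k ih =>
      have h1 := ih (by omega)
      have h2 : (C (k + 1) + 3 - C k) % 3 = d 0 := hconst k (by omega)
      have h3 := hC3 k
      rw [add_mul, one_mul]
      omega
  have h1 := hCk (m + 1) le_rfl
  obtain ⟨k, hk⟩ := h3
  rw [hk, mul_assoc, Nat.add_mul_mod_self_left, ← hk, hCm, hCle 0 (by omega)] at h1
  omega

lemma cycWin_oneTwo_three {n : ℕ} (hn : 3 ≤ n) : CycWin n (oneTwo n 3) := by
  by_cases h3 : 3 ∣ n
  · refine (cycWin_of_three_dvd hn h3).mono fun i => ?_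
    unfold oneTwo
    split_ifs <;> norm_num
  obtain ⟨m, rfl⟩ : ∃ m, n = m + 1 := ⟨n - 1, by omega⟩
  refine CycWin.of_nat (fun i x z =>
    if i = 0 then (if z ≠ 0 ∧ x ≠ 1 then 0 else 1)
    else if i = 1 then (if x = 0 then 0 else if z = 1 then 2 else 1)
    else if i = m then (if z = 0 then 1 else if x = 0 then 0 else 2)
    else stdGuess x z) fun c hc hper => ?_
  by_contra! hwrong
  obtain ⟨hw0, hw⟩ := hwrong
  have hc0 : c 0 < 2 := by simpa [oneTwo] using hc 0
  have hc3 : ∀ i, c i < 3 := fun i => by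
    have := hc i
    unfold oneTwo at this
    split_ifs at this <;> omega
  have hcm : c (m + 1) = c 0 := by simpa using hper 0
  have hw1 := hw 0 (by omega)
  have hwm := hw (m - 1) (by omega)
  rw [if_pos rfl] at hw0
  rw [if_neg (by omega), if_pos rfl] at hw1
  rw [if_neg (by omega), if_neg (by omega), if_pos (by omega), show m - 1 + 2 = m + 1 by omega,
    show m - 1 + 1 = m by omega, hcm] at hwm
  norm_num at hw1
  have b1 := hc3 1
  have b2 := hc3 2
  have bm := hc3 m
  have bm' := hc3 (m - 1)
  have hinv : ∀ i, i + 2 ≤ m → c 0 = 1 →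
      c (i + 2) = c (i + 1) ∨ (c (i + 1) % 3 = (i + 2) % 3 ∧ c (i + 2) % 3 = i % 3) := by
    intro i hi h1
    induction i with
    | zero =>
      rw [h1] at hw0 hw1
      norm_num at hw0 hw1 ⊢
      split_ifs at hw1 <;> omega
    | succ i ih =>
      have h2 := ih (by omega)
      have h3 := hw (i + 1) (by omega)
      rw [if_neg (by omega), if_neg (by omega), if_neg (by omega), stdGuess] at h3
      have := hc3 (i + 1)
      have := hc3 (i + 2)
      have := hc3 (i + 3)
      rw [show i + 1 + 1 = i + 2 by omega, show i + 1 + 2 = i + 3 by omega] at h3 ⊢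
      split_ifs at h3 <;> omega
  have hend := hinv (m - 2) (by omega)
  rw [show m - 2 + 2 = m by omega, show m - 2 + 1 = m - 1 by omega] at hend
  split_ifs at hw0 hw1 hwm <;> omega

end Cycles

section Transfer

lemma cycStrategyWins_of_cycWin {n q : ℕ} (hq : 0 < q) {A : Set (Fin q)} {h : ℤ → ℕ}
    (hA : ∀ c : ℤ → Fin q, (∀ i, c (i + n) = c i) → c 0 ∈ A → ∀ i, (c i : ℕ) < h i)
    (hw : CycWin n h) : ∃ f : ℤ → Fin q → Fin q → Fin q, CycStrategyWins n A f := by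
  obtain ⟨f, hf, hw⟩ := hw
  refine ⟨fun i x z => ⟨f i x z % q, Nat.mod_lt _ hq⟩, fun i => by simp only [hf], ?_⟩
  intro c hc h0
  obtain ⟨i, hi⟩ := hw (fun i => c i) (fun i => by simp only [hc]) (hA c hc h0)
  refine ⟨i, Fin.ext ?_⟩
  simp only [hi]
  exact Nat.mod_eq_of_lt (c i).2

lemma not_cycWin_three {n : ℕ} (hn : 5 ≤ n) (h3 : ¬ 3 ∣ n) : ¬ CycWin n (fun _ => 3) := by
  intro hw
  obtain ⟨f, hf⟩ := cycStrategyWins_of_cycWin (q := 3) (by norm_num) (A := Set.univ)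
    (fun c _ _ i => (c i).2) hw
  exact not_cycStrategyWins_three hn h3 hf

lemma not_cycWin_triangle : ¬ CycWin 3 (fun _ => 4) := by
  intro hw
  obtain ⟨f, hf⟩ := cycStrategyWins_of_cycWin (q := 4) (by norm_num) (A := Set.univ)
    (fun c _ _ i => (c i).2) hw
  exact not_cycStrategyWins_triangle hf

lemma not_cycWin_oneTwo_four {n : ℕ} (hn : 4 ≤ n) : ¬ CycWin n (oneTwo n 4) := by
  intro hw
  have hlt : ∀ c : ℤ → Fin 4, (∀ i, c (i + n) = c i) → c 0 ∈ {a : Fin 4 | a.val < 2} →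
      ∀ i, (c i : ℕ) < oneTwo n 4 i := fun c hc h0 i => by
    unfold oneTwo
    split_ifs with h
    · obtain ⟨k, rfl⟩ := h
      have := (Function.Periodic.int_mul (f := c) (c := (n : ℤ)) hc k) 0
      rw [zero_add, mul_comm, Int.cast_id] at this
      rw [this]
      exact h0
    · exact (c i).2
  obtain ⟨f, hf⟩ := cycStrategyWins_of_cycWin (by norm_num) hlt hw
  exact not_cycStrategyWins_two_four hn hf

end Transfer

/-- The game on the part `S` of the graph `G`, with colors in `ℕ`, is winning. -/
def Win {V : Type*} (G : SimpleGraph V) (S : Set V) (h : V → ℕ) : Prop :=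
  ∃ s : V → (V → ℕ) → ℕ,
    (∀ v ∈ S, ∀ c c' : V → ℕ, (∀ u ∈ S, G.Adj v u → c u = c' u) → s v c = s v c') ∧
    ∀ c : V → ℕ, (∀ u ∈ S, c u < h u) → ∃ v ∈ S, s v c = c v

section Win

variable {V : Type*} {G : SimpleGraph V} {S S' : Set V} {h h' : V → ℕ}

lemma Win.mono (hw : Win G S h) (hS : S ⊆ S') (hh : ∀ v ∈ S, h' v ≤ h v) : Win G S' h' := by
  classical
  obtain ⟨s, hs, hw⟩ := hw
  refine ⟨fun v c => if v ∈ S then s v c else 0, fun v _ c c' hc => ?_, fun c hc => ?_⟩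
  · beta_reduce
    split_ifs with hv
    · exact hs v hv c c' fun u hu hvu => hc u (hS hu) hvu
    · rfl
  · obtain ⟨v, hv, hvc⟩ := hw c fun u hu => (hc u (hS hu)).trans_le (hh u hu)
    exact ⟨v, hS hv, by simpa [hv] using hvc⟩

lemma winning_iff_win {q : ℕ} (hq : 0 < q) :
    Winning G (fun _ => q) ↔ Win G Set.univ (fun _ => q) := by
  constructor
  · rintro ⟨s, hs, hw⟩
    refine ⟨fun v c => s v fun u => ⟨c u % q, Nat.mod_lt _ hq⟩, fun v _ c c' hc => ?_,
      fun c hc => ?_⟩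
    · beta_reduce
      rw [hs v]
      intro u hu
      simp only [hc u trivial hu]
    · obtain ⟨v, hv⟩ := hw fun u => ⟨c u % q, Nat.mod_lt _ hq⟩
      refine ⟨v, trivial, ?_⟩
      beta_reduce
      rw [hv]
      exact Nat.mod_eq_of_lt (hc v trivial)
  · rintro ⟨s, hs, hw⟩
    refine ⟨fun v c => ⟨s v (fun u => c u) % q, Nat.mod_lt _ hq⟩, fun v c c' hc => ?_,
      fun c => ?_⟩
    · simp only [Fin.mk.injEq]
      rw [hs v trivial]
      intro u _ hu
      rw [hc u hu]
    · obtain ⟨v, -, hv⟩ := hw (fun u => c u) fun u _ => (c u).2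
      refine ⟨v, Fin.ext ?_⟩
      simp only [hv]
      exact Nat.mod_eq_of_lt (c v).2

lemma winning_zero [Nonempty V] : Winning G (fun _ => 0) :=
  ⟨fun _ c => c (Classical.arbitrary V), fun _ c => (c (Classical.arbitrary V)).elim0,
    fun c => (c (Classical.arbitrary V)).elim0⟩

lemma Winning.anti {q q' : ℕ} [Nonempty V] (hw : Winning G (fun _ => q)) (hq : q' ≤ q) :
    Winning G (fun _ => q') := by
  rcases Nat.eq_zero_or_pos q' with rfl | h
  · exact winning_zero
  · rw [winning_iff_win h]
    rw [winning_iff_win (by omega)] at hw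
    exact hw.mono subset_rfl fun _ _ => hq

/-- A parametrization of a cycle of length `n` by the integers. -/
structure CycParam (n : ℕ) (v : ℤ → V) : Prop where
  periodic : ∀ i, v (i + n) = v i
  inj : ∀ i j, v i = v j → (n : ℤ) ∣ i - j

lemma apply_eq_of_dvd_sub {α : Type*} {n : ℕ} {w : ℤ → α} (hw : ∀ i, w (i + n) = w i) {i j : ℤ}
    (h : (n : ℤ) ∣ i - j) : w i = w j := by
  obtain ⟨k, hk⟩ := h
  have := (Function.Periodic.int_mul (f := w) (c := (n : ℤ)) hw k) j
  rw [← this, Int.cast_id, mul_comm, ← hk, add_sub_cancel]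

lemma CycParam.exists_index {n : ℕ} {v : ℤ → V} (hv : CycParam n v) :
    ∃ idx : V → ℤ, ∀ i, (n : ℤ) ∣ idx (v i) - i := by
  classical
  refine ⟨fun x => if h : ∃ i, v i = x then h.choose else 0, fun i => ?_⟩
  have h : ∃ j, v j = v i := ⟨i, rfl⟩
  simp only [h, dif_pos]
  exact hv.inj _ _ h.choose_spec

lemma CycParam.win {n : ℕ} {v : ℤ → V} (hv : CycParam n v)
    (hadj : ∀ i, G.Adj (v i) (v (i + 1))) (hw : CycWin n (h ∘ v)) : Win G (Set.range v) h := by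
  obtain ⟨f, hf, hw⟩ := hw
  obtain ⟨idx, hidx⟩ := hv.exists_index
  refine ⟨fun x c => f (idx x) (c (v (idx x - 1))) (c (v (idx x + 1))), ?_, fun c hc => ?_⟩
  · rintro x ⟨i, rfl⟩ c c' hcc
    have e : v (idx (v i)) = v i := apply_eq_of_dvd_sub hv.periodic (hidx i)
    beta_reduce
    have h1 : G.Adj (v i) (v (idx (v i) + 1)) := by simpa only [e] using hadj (idx (v i))
    have h2 : G.Adj (v i) (v (idx (v i) - 1)) := by
      simpa only [sub_add_cancel, e] using (hadj (idx (v i) - 1)).symm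
    rw [hcc _ ⟨_, rfl⟩ h1, hcc _ ⟨_, rfl⟩ h2]
  · obtain ⟨i, hi⟩ := hw (c ∘ v) (fun i => congrArg c (hv.periodic i)) fun i => hc _ ⟨i, rfl⟩
    refine ⟨v i, ⟨i, rfl⟩, ?_⟩
    beta_reduce
    have e1 : v (idx (v i) - 1) = v (i - 1) :=
      apply_eq_of_dvd_sub hv.periodic (by simpa using hidx i)
    have e2 : v (idx (v i) + 1) = v (i + 1) :=
      apply_eq_of_dvd_sub hv.periodic (by simpa using hidx i)
    rw [apply_eq_of_dvd_sub hf (hidx i), e1, e2]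
    exact hi

lemma CycParam.cycWin {n : ℕ} {v : ℤ → V} (hv : CycParam n v)
    (hadj : ∀ i w, G.Adj (v i) w → w = v (i - 1) ∨ w = v (i + 1)) (hw : Win G (Set.range v) h) :
    CycWin n (h ∘ v) := by
  classical
  obtain ⟨s, hs, hw⟩ := hw
  obtain ⟨idx, hidx⟩ := hv.exists_index
  refine ⟨fun i x z => s (v i)
    (Function.update (Function.update (fun _ => 0) (v (i - 1)) x) (v (i + 1)) z),
    fun i => ?_, fun c hc hlt => ?_⟩
  · have e1 : v (i + n - 1) = v (i - 1) := apply_eq_of_dvd_sub hv.periodic (by simp)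
    have e2 : v (i + n + 1) = v (i + 1) := apply_eq_of_dvd_sub hv.periodic (by simp)
    simp only [hv.periodic, e1, e2]
  · have hC : ∀ i, c (idx (v i)) = c i := fun i => apply_eq_of_dvd_sub hc (hidx i)
    obtain ⟨x, ⟨i, rfl⟩, hx⟩ := hw (fun x => c (idx x)) (by
      rintro _ ⟨i, rfl⟩
      rw [hC]
      exact hlt i)
    refine ⟨i, ?_⟩
    rw [hC] at hx
    rw [← hx]
    refine hs _ ⟨i, rfl⟩ _ _ fun u _ hu => ?_
    by_cases h2 : u = v (i + 1)
    · rw [h2, Function.update_self, hC]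
    · rw [Function.update_of_ne h2]
      obtain rfl := (hadj i u hu).resolve_right h2
      rw [Function.update_self, hC]

/-- Gluing two winning games at a vertex multiplies the hatnesses of that vertex. -/
lemma Win.product {S₁ S₂ : Set V} {h₁ h₂ : V → ℕ} {v : V} (hw₁ : Win G S₁ h₁) (hw₂ : Win G S₂ h₂)
    (hS : S₁ ∩ S₂ ⊆ {v}) (hv₁ : v ∈ S₁) (hv₂ : v ∈ S₂) (e₁ : ∀ u ∈ S₁, u ≠ v → h u = h₁ u)
    (e₂ : ∀ u ∈ S₂, u ≠ v → h u = h₂ u) (hv : h v ≤ h₁ v * h₂ v) : Win G (S₁ ∪ S₂) h := by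
  classical
  obtain ⟨s₁, hs₁, hw₁⟩ := hw₁
  obtain ⟨s₂, hs₂, hw₂⟩ := hw₂
  set a := h₁ v with ha
  let l : (V → ℕ) → V → ℕ := fun c => Function.update c v (c v % a)
  let r : (V → ℕ) → V → ℕ := fun c => Function.update c v (c v / a)
  refine ⟨fun u c => if u = v then s₁ v (l c) + a * s₂ v (r c) else
    if u ∈ S₁ then s₁ u (l c) else s₂ u (r c), fun u hu c c' hc => ?_, fun c hc => ?_⟩
  · have hl : u ∈ S₁ → s₁ u (l c) = s₁ u (l c') := fun hu => by
      refine hs₁ u hu _ _ fun x hx hux => ?_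
      have := hc x (Or.inl hx) hux
      by_cases hxv : x = v
      · subst hxv
        simp [l, this]
      · simp [l, hxv, this]
    have hr : u ∈ S₂ → s₂ u (r c) = s₂ u (r c') := fun hu => by
      refine hs₂ u hu _ _ fun x hx hux => ?_
      have := hc x (Or.inr hx) hux
      by_cases hxv : x = v
      · subst hxv
        simp [r, this]
      · simp [r, hxv, this]
    beta_reduce
    split_ifs with h1 h2
    · subst h1
      rw [hl hv₁, hr hv₂]
    · exact hl h2
    · exact hr (hu.resolve_left h2)
  · have hcv := (hc v (Or.inl hv₁)).trans_le hv
    have ha0 : 0 < a := by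
      rcases Nat.eq_zero_or_pos a with h0 | h0
      · rw [h0, zero_mul] at hcv
        omega
      · exact h0
    obtain ⟨u₁, hu₁, hc₁⟩ := hw₁ (l c) fun u hu => by
      by_cases huv : u = v
      · subst huv
        simpa [l] using Nat.mod_lt _ ha0
      · simpa [l, huv, e₁ u hu huv] using hc u (Or.inl hu)
    obtain ⟨u₂, hu₂, hc₂⟩ := hw₂ (r c) fun u hu => by
      by_cases huv : u = v
      · subst huv
        simpa [r] using Nat.div_lt_of_lt_mul hcv
      · simpa [r, huv, e₂ u hu huv] using hc u (Or.inr hu)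
    by_cases h1 : u₁ = v
    · by_cases h2 : u₂ = v
      · subst h1
        refine ⟨u₁, Or.inl hv₁, ?_⟩
        subst h2
        simp only [if_true, hc₁, hc₂]
        simp only [l, r, Function.update_self]
        exact Nat.mod_add_div _ _
      · refine ⟨u₂, Or.inr hu₂, ?_⟩
        have : u₂ ∉ S₁ := fun h => h2 (hS ⟨h, hu₂⟩)
        simp only [h2, this, if_false, hc₂]
        simp [r, h2]
    · refine ⟨u₁, Or.inl hu₁, ?_⟩
      simp only [h1, hu₁, if_false, if_true, hc₁]
      simp [l, h1]

lemma win_edge {a b : V} (hab : G.Adj a b) : Win G {a, b} (fun _ => 2) := by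
  classical
  refine ⟨fun u c => if u = a then c b else 1 - c a, fun u hu c c' hc => ?_, fun c hc => ?_⟩
  · beta_reduce
    rcases hu with rfl | hu
    · simpa using hc b (by simp) hab
    · obtain rfl := Set.mem_singleton_iff.1 hu
      simp only [hab.ne.symm, if_false]
      rw [hc a (by simp) hab.symm]
  · have ha : c a < 2 := hc a (by simp)
    have hb : c b < 2 := hc b (by simp)
    by_cases h : c b = c a
    · exact ⟨a, by simp, by simpa⟩
    · exact ⟨b, by simp, by simp only [hab.ne.symm, if_false]; omega⟩

/-- A hatness of `2` can be moved along a path. -/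
lemma Win.extend [DecidableEq V] {q : ℕ} (hq : q ≤ 4) {a b : V} (p : G.Walk a b)
    (hp : p.IsPath) (hS : ∀ x ∈ S, x ∈ p.support → x = a) (ha : a ∈ S)
    (hw : Win G S (Function.update (fun _ => q) a 2)) :
    ∃ S', b ∈ S' ∧ S' ⊆ S ∪ {x | x ∈ p.support} ∧
      Win G S' (Function.update (fun _ => q) b 2) := by
  induction p generalizing S with
  | nil => exact ⟨S, ha, Set.subset_union_left, hw⟩
  | @cons a x b hax p ih =>
    rw [SimpleGraph.Walk.cons_isPath_iff] at hp
    have hxS : x ∉ S := fun hx => by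
      have := hS x hx (by simp)
      exact hax.ne this.symm
    have hw' : Win G (S ∪ {a, x}) (Function.update (fun _ => q) x 2) := by
      refine hw.product (win_edge hax) (v := a) ?_ ha (by simp) (fun u hu hua => ?_)
        (fun u hu hua => ?_) ?_
      · rintro y ⟨hy, rfl | rfl⟩
        · rfl
        · exact absurd hy hxS
      · rw [Function.update_of_ne hua, Function.update_of_ne]
        rintro rfl
        exact hxS hu
      · obtain rfl : u = x := by simpa [hua] using hu
        simp
      · rw [Function.update_of_ne hax.ne]
        simpa using hq
    obtain ⟨S', hb, hsub, hS'⟩ := ih hp.1 (S := S ∪ {a, x}) (fun y hy hyp => by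
      rcases hy with hy | rfl | rfl
      · have := hS y hy (by simp [hyp])
        subst this
        exact absurd hyp hp.2
      · exact absurd hyp hp.2
      · rfl) (by simp) hw'
    refine ⟨S', hb, hsub.trans ?_, hS'⟩
    intro y hy
    simp only [Set.mem_union, Set.mem_insert_iff, Set.mem_singleton_iff, Set.mem_ofPred_eq,
      SimpleGraph.Walk.support_cons, List.mem_cons] at hy ⊢
    rcases hy with (hy | rfl | rfl) | hy
    · exact Or.inl hy
    · exact Or.inl ha
    · exact Or.inr (Or.inr p.start_mem_support)
    · exact Or.inr (Or.inr hy)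

end Win

end HatGame

namespace SimpleGraph

variable {V : Type*} {G G' : SimpleGraph V}

/-- Every pair of distinct cycles of `G` shares at most one vertex. -/
def AlmostDisjointCycles (G : SimpleGraph V) : Prop :=
  ∀ (v w : V) (c₁ : G.Walk v v) (c₂ : G.Walk w w), c₁.IsCycle → c₂.IsCycle →
    {e | e ∈ c₁.edges} ≠ {e | e ∈ c₂.edges} →
    ({x | x ∈ c₁.support} ∩ {x | x ∈ c₂.support} : Set V).Subsingleton

lemma AlmostDisjointCycles.mono (h : G.AlmostDisjointCycles) (hle : G' ≤ G) :
    G'.AlmostDisjointCycles := by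
  intro v w c₁ c₂ h₁ h₂ hne
  simpa using h v w (c₁.mapLe hle) (c₂.mapLe hle) (by simpa using h₁) (by simpa using h₂)
    (by simpa using hne)

/-- In a graph with almost disjoint cycles, deleting the edges of a cycle disconnects its
vertices. -/
lemma AlmostDisjointCycles.not_reachable (h : G.AlmostDisjointCycles) {a x y : V}
    {c : G.Walk a a} (hc : c.IsCycle) (hx : x ∈ c.support) (hy : y ∈ c.support)
    (hr : (G.deleteEdges {e | e ∈ c.edges}).Reachable x y) : x = y := by
  classical
  by_contra hxy
  obtain ⟨p₀, hp₀⟩ := hr.exists_isPath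
  set p : G.Walk x y := p₀.mapLe (G.deleteEdges_le _) with hp
  have hpc : ∀ e ∈ p.edges, e ∉ c.edges := fun e he => by
    rw [hp, Walk.edges_mapLe_eq_edges] at he
    have := p₀.edges_subset_edgeSet he
    rw [edgeSet_deleteEdges] at this
    exact this.2
  have hyr : y ∈ (c.rotate x hx).support := by simpa using hy
  set q : G.Walk x y := (c.rotate x hx).takeUntil y hyr with hq
  have hqc : ∀ e ∈ q.edges, e ∈ c.edges := fun e he =>
    (c.rotate_edges x hx).mem_iff.1 (Walk.edges_takeUntil_subset_edges _ hyr he)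
  have hqs : ∀ z ∈ q.support, z ∈ c.support := fun z hz =>
    (c.mem_support_rotate_iff x hx).1 (Walk.support_takeUntil_subset_support _ hyr hz)
  have hpP : p.IsPath := by simpa [hp] using hp₀
  have hqP : q.IsPath := (hc.rotate hx).isPath_takeUntil hyr
  have hpq : p ≠ q := by
    intro e
    cases hp' : p with
    | nil => exact hxy rfl
    | @cons _ z _ hadj r =>
      have : s(x, z) ∈ p.edges := by rw [hp', Walk.edges_cons]; exact List.mem_cons_self
      exact hpc _ this (hqc _ (e ▸ this))
  obtain ⟨u, w, p', q', hp', hq', hcyc⟩ := hpP.exists_isCycle_of_ne hqP hpq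
  have hp'P : p'.IsPath := by
    obtain ⟨r, t, e⟩ := hp'
    rw [e] at hpP
    exact hpP.of_append_left.of_append_right
  have hq'P : q'.IsPath := by
    obtain ⟨r, t, e⟩ := hq'
    rw [e] at hqP
    exact hqP.of_append_left.of_append_right
  have huw : u ≠ w := by
    rintro rfl
    rw [Walk.isPath_iff_nil] at hp'P hq'P
    rw [hp'P.eq_nil, hq'P.eq_nil] at hcyc
    simp at hcyc
  refine huw (h _ _ _ c hcyc hc ?_ ⟨?_, hqs _ (hq'.support_subset q'.start_mem_support)⟩
    ⟨?_, hqs _ (hq'.support_subset q'.end_mem_support)⟩)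
  · intro e
    cases hp'' : p' with
    | nil => exact huw rfl
    | @cons _ z _ hadj r =>
      have h1 : s(u, z) ∈ p'.edges := by rw [hp'', Walk.edges_cons]; exact List.mem_cons_self
      refine hpc _ (hp'.edges_subset h1) ?_
      have : s(u, z) ∈ {e | e ∈ (p'.append q'.reverse).edges} := by
        simp only [Set.mem_ofPred_eq, Walk.edges_append, List.mem_append]
        exact Or.inl h1
      rwa [e] at this
  · simp
  · simp

end SimpleGraph

namespace HatGame

variable {V : Type*} {G H K : SimpleGraph V} {h : V → ℕ}

open SimpleGraph

lemma exists_cycParam {a x : V} {c : G.Walk a a} (hc : c.IsCycle) (hx : x ∈ c.support) :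
    ∃ v : ℤ → V, v 0 = x ∧ CycParam c.length v ∧ Set.range v = {y | y ∈ c.support} ∧
      (∀ i, s(v i, v (i + 1)) ∈ c.edges) ∧ ∀ e ∈ c.edges, ∃ i, e = s(v i, v (i + 1)) := by
  classical
  wlog hax : a = x generalizing a
  · obtain ⟨v, h0, h1, h2, h3, h4⟩ := this (c := c.rotate x hx) (hc.rotate hx) (by simp) rfl
    refine ⟨v, h0, by simpa using h1, by simpa using h2, fun i => ?_, fun e he => ?_⟩
    · exact (c.rotate_edges x hx).mem_iff.1 (h3 i)
    · exact h4 e ((c.rotate_edges x hx).mem_iff.2 he)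
  subst hax
  have hn := hc.three_le_length
  set n := c.length with hndef
  have hn0 : (0 : ℤ) < n := by omega
  have hlt : ∀ i : ℤ, (i % n).toNat < n := fun i => by
    have := Int.emod_nonneg i hn0.ne'
    have := Int.emod_lt_of_pos i hn0
    omega
  have hsucc : ∀ i : ℤ, c.getVert ((i + 1) % n).toNat = c.getVert ((i % n).toNat + 1) := by
    intro i
    have h1 := Int.emod_nonneg i hn0.ne'
    have h2 := Int.emod_lt_of_pos i hn0
    rcases eq_or_ne (i % n + 1) n with h | h
    · have h3 : (i + 1) % n = 0 := by rw [← Int.emod_add_emod, h, Int.emod_self]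
      have h4 : (i % n).toNat + 1 = n := by omega
      rw [h3, h4, hndef, Walk.getVert_length]
      simp
    · have h3 : (i + 1) % n = i % n + 1 := by
        rw [← Int.emod_add_emod, Int.emod_eq_of_lt (by omega) (by omega)]
      congr 1
      omega
  have hnat : ∀ k : ℕ, k < n → (((k : ℤ) % n).toNat) = k := fun k hk => by
    rw [Int.emod_eq_of_lt (by omega) (by omega)]
    simp
  refine ⟨fun i => c.getVert (i % n).toNat, by simp, ⟨fun i => by simp, fun i j hij => ?_⟩,
    ?_, fun i => ?_, fun e he => ?_⟩
  · have := hc.getVert_injOn' (by have := hlt i; simp only [Set.mem_ofPred_eq]; omega)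
      (by have := hlt j; simp only [Set.mem_ofPred_eq]; omega) hij
    have h1 := Int.emod_nonneg i hn0.ne'
    have h2 := Int.emod_nonneg j hn0.ne'
    exact Int.ModEq.dvd (show j % n = i % n by omega)
  · ext y
    simp only [Set.mem_range, Set.mem_ofPred_eq, Walk.mem_support_iff_exists_getVert]
    constructor
    · rintro ⟨i, rfl⟩
      exact ⟨_, rfl, (hlt i).le⟩
    · rintro ⟨k, rfl, hk⟩
      rcases hk.lt_or_eq with hk | hk
      · exact ⟨k, by rw [hnat k hk]⟩
      · exact ⟨0, by simp [hk]⟩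
  · beta_reduce
    rw [hsucc]
    have : (i % n).toNat < c.edges.length := by rw [Walk.length_edges]; exact hlt i
    rw [← Walk.getElem_edges this]
    exact List.getElem_mem this
  · obtain ⟨k, hk, rfl⟩ := List.getElem_of_mem he
    refine ⟨k, ?_⟩
    rw [Walk.length_edges] at hk
    beta_reduce
    rw [Walk.getElem_edges, hsucc, hnat k hk]

lemma update_comp_cycParam [DecidableEq V] {n q : ℕ} {v : ℤ → V} {x : V} (hv : CycParam n v)
    (h0 : v 0 = x) : Function.update (fun _ => q) x 2 ∘ v = oneTwo n q := by
  subst h0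
  funext i
  unfold oneTwo
  simp only [Function.comp, Function.update_apply]
  refine if_congr ⟨fun h => by simpa using hv.inj _ _ h, fun h => ?_⟩ rfl rfl
  exact apply_eq_of_dvd_sub hv.periodic (by simpa using h)

lemma win_update_of_isCycle [DecidableEq V] {q : ℕ} {a x : V} {c : G.Walk a a} (hc : c.IsCycle)
    (hx : x ∈ c.support) (hw : CycWin c.length (oneTwo c.length q)) :
    Win G {y | y ∈ c.support} (Function.update (fun _ => q) x 2) := by
  obtain ⟨v, rfl, hv, hr, he, -⟩ := exists_cycParam hc hx
  rw [← hr]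
  refine hv.win (fun i => c.edges_subset_edgeSet (he i)) ?_
  rwa [update_comp_cycParam hv rfl]

lemma win_of_isCycle {q : ℕ} {a : V} {c : G.Walk a a} (hc : c.IsCycle)
    (hw : CycWin c.length (fun _ => q)) : Win G Set.univ (fun _ => q) := by
  obtain ⟨v, -, hv, -, he, -⟩ := exists_cycParam hc c.start_mem_support
  exact (hv.win (h := fun _ => q) (fun i => c.edges_subset_edgeSet (he i)) hw).mono
    (Set.subset_univ _) fun _ _ => le_rfl

/-- Two distinct cycles which win with a vertex of hatness `2` can be combined. -/
lemma win_of_two_cycles {q : ℕ} (hq : q ≤ 4) (hG : G.Connected) (hd : G.AlmostDisjointCycles)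
    {a₁ a₂ : V} {c₁ : G.Walk a₁ a₁} {c₂ : G.Walk a₂ a₂} (h₁ : c₁.IsCycle) (h₂ : c₂.IsCycle)
    (hne : {e | e ∈ c₁.edges} ≠ {e | e ∈ c₂.edges})
    (hw₁ : CycWin c₁.length (oneTwo c₁.length q)) (hw₂ : CycWin c₂.length (oneTwo c₂.length q)) :
    Win G Set.univ (fun _ => q) := by
  classical
  have hex : ∃ n a b, a ∈ c₁.support ∧ b ∈ c₂.support ∧ ∃ p : G.Walk a b, p.length = n :=
    ⟨_, a₁, a₂, c₁.start_mem_support, c₂.start_mem_support, (hG a₁ a₂).some, rfl⟩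
  obtain ⟨a, b, ha, hb, p, hp⟩ := Nat.find_spec hex
  have hmin : ∀ {x y : V} (r : G.Walk x y), x ∈ c₁.support → y ∈ c₂.support →
      p.length ≤ r.length := fun r hx hy => by
    rw [hp]
    exact Nat.find_min' hex ⟨_, _, hx, hy, r, rfl⟩
  have hpath : p.IsPath := by
    refine p.isPath_of_length_eq_dist (le_antisymm ?_ (G.dist_le p))
    obtain ⟨r, hr⟩ := (hG a b).exists_walk_length_eq_dist
    rw [← hr]
    exact hmin r ha hb
  have hp₁ : ∀ x ∈ {x | x ∈ c₁.support}, x ∈ p.support → x = a := fun x hx hxp => by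
    have h := hmin (p.dropUntil x hxp) hx hb
    have e := congrArg Walk.length (p.take_spec hxp)
    rw [Walk.length_append] at e
    exact (Walk.eq_of_length_eq_zero (p := p.takeUntil x hxp) (by omega)).symm
  have hp₂ : ∀ x ∈ c₂.support, x ∈ p.support → x = b := fun x hx hxp => by
    have h := hmin (p.takeUntil x hxp) ha hx
    have e := congrArg Walk.length (p.take_spec hxp)
    rw [Walk.length_append] at e
    exact Walk.eq_of_length_eq_zero (p := p.dropUntil x hxp) (by omega)
  obtain ⟨S, hbS, hS, hw⟩ := (win_update_of_isCycle h₁ ha hw₁).extend hq p hpath hp₁ ha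
  refine (hw.product (win_update_of_isCycle h₂ hb hw₂) (h := fun _ => q) ?_ hbS hb
    (fun u _ hu => by simp [hu]) (fun u _ hu => by simp [hu]) (by simpa using hq)).mono
    (Set.subset_univ _) fun _ _ => le_rfl
  rintro x ⟨hxS, hx⟩
  rcases hS hxS with hx1 | hxp
  · have h := hmin (Walk.nil : G.Walk x x) hx1 hx
    have hab : a = b := Walk.eq_of_length_eq_zero (p := p) (by simpa using h)
    exact hd _ _ _ _ h₁ h₂ hne ⟨hx1, hx⟩ ⟨hab ▸ ha, hb⟩
  · exact hp₂ x hx hxp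

/-- If the components of `H` hanging off the vertices of `U` lose even when their vertex in `U`
has hatness `2`, then they cannot help the game on `K`. -/
lemma not_win_glue {U : Set V} (hGHK : ∀ x y, G.Adj x y → H.Adj x y ∨ K.Adj x y)
    (hK : ∀ x y, K.Adj x y → x ∈ U) (hU : ∀ u ∈ U, ∀ x ∈ U, H.Reachable u x → u = x)
    (hlose : ∀ u ∈ U, ∀ h', h' u = 2 → (∀ x ≠ u, h' x = h x) → ¬ Win H {x | H.Reachable u x} h')
    (hrest : ¬ Win H {x | ∀ u ∈ U, ¬ H.Reachable u x} h) (hwK : ¬ Win K U h) :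
    ¬ Win G Set.univ h := by
  classical
  rintro ⟨s, hs, hw⟩
  let Bad : V → (V → ℕ) → ℕ → Prop := fun u d a => a < h u ∧
    ∀ c : V → ℕ, (∀ x, H.Reachable u x → c x < h x) → c u = a → (∀ x, K.Adj u x → c x = d x) →
      ∃ x, H.Reachable u x ∧ s x c = c x
  have hKu : ∀ {u x y : V}, u ∈ U → H.Reachable u x → K.Adj x y → x = u :=
    fun hu hux hxy => (hU _ hu _ (hK _ _ hxy) hux).symm
  have hBad : ∀ u ∈ U, ∀ d a a', Bad u d a → Bad u d a' → a = a' := by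
    rintro u hu d a a' ⟨ha, hba⟩ ⟨ha', hba'⟩
    by_contra hne
    let φ : (V → ℕ) → V → ℕ := fun c w =>
      if w = u then (if c u = 0 then a else a') else if K.Adj u w then d w else c w
    refine hlose u hu (Function.update h u 2) (by simp) (fun x hx => by simp [hx])
      ⟨fun x c => if x = u then (if s u (φ c) = a then 0 else 1) else s x (φ c), ?_, ?_⟩
    · intro x hx c c' hcc
      have : s x (φ c) = s x (φ c') := by
        refine hs x trivial _ _ fun y _ hxy => ?_
        simp only [φ]
        rcases hGHK x y hxy with hxy | hxy
        · have := hcc y (Reachable.trans hx hxy.reachable) hxy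
          by_cases hy : y = u
          · subst hy
            simp [this]
          · simp [this, hy]
        · obtain rfl := hKu hu hx hxy
          simp [hxy, hxy.ne.symm]
      by_cases hxu : x = u
      · subst hxu
        simp only [this]
      · simp only [this, hxu, if_false]
    · intro c hc
      have hc2 : c u < 2 := by simpa using hc u (Reachable.refl u)
      obtain ⟨x, hx, hsx⟩ : ∃ x, H.Reachable u x ∧ s x (φ c) = φ c x := by
        have hlt : ∀ x, H.Reachable u x → φ c x < h x := by
          intro x hx
          simp only [φ]
          split_ifs with h1 h2 h3
          · exact h1 ▸ ha
          · exact h1 ▸ ha'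
          · exact absurd (hKu hu hx h3.symm) h1
          · simpa [h1] using hc x hx
        have hd : ∀ x, K.Adj u x → φ c x = d x := fun x hx => by simp [φ, hx, hx.ne.symm]
        by_cases h0 : c u = 0
        · exact hba _ hlt (by simp [φ, h0]) hd
        · exact hba' _ hlt (by simp [φ, h0]) hd
      refine ⟨x, hx, ?_⟩
      by_cases hxu : x = u
      · subst hxu
        simp only [if_true, hsx]
        simp only [φ, if_true]
        by_cases h0 : c x = 0
        · simp [h0]
        · simp only [h0, if_false, Ne.symm hne]
          omega
      · simp only [hxu, if_false, hsx, φ]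
        rw [if_neg]
        exact fun hK' => hxu (hKu hu hx hK'.symm)
  obtain ⟨d, hdU, hd⟩ : ∃ d : V → ℕ, (∀ u ∈ U, d u < h u) ∧ ∀ u ∈ U, ¬ Bad u d (d u) := by
    by_contra! hcon
    refine hwK ⟨fun u d => if hb : ∃ a, Bad u d a then hb.choose else 0, ?_, ?_⟩
    · intro u hu d d' hdd
      have : Bad u d = Bad u d' := by
        funext a
        simp only [Bad]
        congr! 7 with c h1 h2 x h3
        rw [hdd x (hK _ _ h3.symm) h3]
      simp only [this]
    · intro d hdU
      obtain ⟨u, hu, hb⟩ := hcon d hdU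
      have hex : ∃ a, Bad u d a := ⟨_, hb⟩
      refine ⟨u, hu, ?_⟩
      simp only [hex, dif_pos]
      exact hBad u hu d _ _ hex.choose_spec hb
  have hcol : ∀ u, ∃ c : V → ℕ, u ∈ U → (∀ x, H.Reachable u x → c x < h x) ∧ c u = d u ∧
      (∀ x, K.Adj u x → c x = d x) ∧ ∀ x, H.Reachable u x → s x c ≠ c x := by
    intro u
    by_cases hu : u ∈ U
    · have := hd u hu
      simp only [Bad, not_and] at this
      have := this (hdU u hu)
      push Not at this
      obtain ⟨c, h1, h2, h3, h4⟩ := this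
      exact ⟨c, fun _ => ⟨h1, h2, h3, h4⟩⟩
    · exact ⟨d, fun hu' => absurd hu' hu⟩
  choose C hC using hcol
  obtain ⟨c₀, hc₀, hl₀⟩ : ∃ c : V → ℕ, (∀ x, (∀ u ∈ U, ¬ H.Reachable u x) → c x < h x) ∧
      ∀ x, (∀ u ∈ U, ¬ H.Reachable u x) → s x c ≠ c x := by
    by_contra! hcon
    refine hrest ⟨s, fun x hx c c' hcc => hs x trivial _ _ fun y _ hxy => ?_, hcon⟩
    rcases hGHK x y hxy with hxy | hxy
    · exact hcc y (fun u hu huy => hx u hu (huy.trans hxy.symm.reachable)) hxy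
    · exact absurd (Reachable.refl x) (hx x (hK _ _ hxy))
  let c : V → ℕ := fun x => if hx : ∃ u ∈ U, H.Reachable u x then C hx.choose x else c₀ x
  have hcC : ∀ u ∈ U, ∀ x, H.Reachable u x → c x = C u x := by
    intro u hu x hux
    have hx : ∃ u ∈ U, H.Reachable u x := ⟨u, hu, hux⟩
    simp only [c, hx, dif_pos]
    rw [hU _ hx.choose_spec.1 u hu (hx.choose_spec.2.trans hux.symm)]
  have hc0 : ∀ x, (∀ u ∈ U, ¬ H.Reachable u x) → c x = c₀ x := by
    intro x hx
    have : ¬ ∃ u ∈ U, H.Reachable u x := by simpa using hx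
    simp only [c, this, dif_neg, not_false_eq_true]
  obtain ⟨x, -, hx⟩ := hw c fun x _ => by
    by_cases hx : ∃ u ∈ U, H.Reachable u x
    · obtain ⟨u, hu, hux⟩ := hx
      rw [hcC u hu x hux]
      exact (hC u hu).1 x hux
    · push Not at hx
      rw [hc0 x hx]
      exact hc₀ x hx
  by_cases hxU : ∃ u ∈ U, H.Reachable u x
  · obtain ⟨u, hu, hux⟩ := hxU
    refine (hC u hu).2.2.2 x hux ?_
    rw [← hcC u hu x hux, ← hx]
    refine hs x trivial _ _ fun y _ hxy => ?_
    rcases hGHK x y hxy with hxy | hxy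
    · exact (hcC u hu y (hux.trans hxy.reachable)).symm
    · obtain rfl := hKu hu hux hxy
      have hy := hK _ _ hxy.symm
      rw [hcC y hy y (Reachable.refl y), (hC y hy).2.1, (hC x hu).2.2.1 y hxy]
  · push Not at hxU
    refine hl₀ x hxU ?_
    rw [← hc0 x hxU, ← hx]
    refine hs x trivial _ _ fun y _ hxy => ?_
    rcases hGHK x y hxy with hxy | hxy
    · exact (hc0 y fun u hu huy => hxU u hu (huy.trans hxy.symm.reachable)).symm
    · exact absurd (Reachable.refl x) (hxU x (hK _ _ hxy))

lemma not_win_edge {x y : V} (hxy : x ≠ y) (hx : 2 ≤ h x) (hy : 3 ≤ h y) : ¬ Win G {x, y} h := by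
  classical
  rintro ⟨s, hs, hw⟩
  let d : ℕ → V → ℕ := fun a v => if v = x then a else 0
  obtain ⟨b, hb, hb0, hb1⟩ : ∃ b < 3, b ≠ s y (d 0) ∧ b ≠ s y (d 1) := by
    by_contra! hcon
    have h0 := hcon 0
    have h1 := hcon 1
    have h2 := hcon 2
    grind
  let e : V → ℕ := fun v => if v = y then b else 0
  let a := if s x e = 0 then 1 else 0
  have ha : a = 0 ∨ a = 1 := by grind
  obtain ⟨v, hv, hvc⟩ := hw (fun v => if v = x then a else b) fun u hu => by
    rcases hu with rfl | rfl
    · simp only [if_true]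
      omega
    · simp only [hxy.symm, if_false]
      omega
  rcases hv with rfl | rfl
  · rw [hs v (by simp) _ e] at hvc
    · simp only [if_true, a] at hvc
      split_ifs at hvc <;> omega
    · rintro u (rfl | rfl) hu
      · exact absurd rfl hu.ne
      · simp [e, hxy.symm]
  · rw [hs v (by simp) _ (d a)] at hvc
    · simp only [hxy.symm, if_false] at hvc
      rcases ha with ha | ha <;> rw [ha] at hvc <;> omega
    · rintro u (rfl | rfl) hu
      · simp [d]
      · exact absurd rfl hu.ne

lemma not_win_bot {S : Set V} (hh : ∀ x, 2 ≤ h x) : ¬ Win ⊥ S h := by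
  rintro ⟨s, hs, hw⟩
  obtain ⟨v, hv, hvc⟩ := hw (fun v => if s v 0 = 0 then 1 else 0) fun u _ => by
    have := hh u
    split_ifs <;> omega
  rw [hs v hv _ 0 (by simp)] at hvc
  split_ifs at hvc <;> omega

lemma not_win_cycle {a x : V} {c : G.Walk a a} (hc : c.IsCycle) (hx : x ∈ c.support)
    {g : ℤ → ℕ} (hg : ∀ v : ℤ → V, v 0 = x → CycParam c.length v → h ∘ v = g)
    (hw : ¬ CycWin c.length g) : ¬ Win (fromEdgeSet {e | e ∈ c.edges}) {y | y ∈ c.support} h := by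
  intro hwin
  obtain ⟨v, h0, hv, hr, -, he⟩ := exists_cycParam hc hx
  rw [← hr] at hwin
  refine hw ?_
  rw [← hg v h0 hv]
  refine hv.cycWin (fun i w hiw => ?_) hwin
  obtain ⟨j, hj⟩ := he _ ((fromEdgeSet_adj _).1 hiw).1
  rcases Sym2.eq_iff.1 hj with ⟨h1, rfl⟩ | ⟨h1, rfl⟩
  · refine Or.inr (apply_eq_of_dvd_sub hv.periodic ?_)
    have := hv.inj _ _ h1.symm
    simpa using this
  · refine Or.inl (apply_eq_of_dvd_sub hv.periodic ?_)
    have := hv.inj _ _ h1.symm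
    rwa [show j - (i - 1) = j + 1 - i by ring]

lemma adj_deleteEdges_or_fromEdgeSet (s : Set (Sym2 V)) {x y : V} (hxy : G.Adj x y) :
    (G.deleteEdges s).Adj x y ∨ (fromEdgeSet s).Adj x y := by
  by_cases h : s(x, y) ∈ s
  · exact Or.inr ((fromEdgeSet_adj _).2 ⟨h, hxy.ne⟩)
  · exact Or.inl (deleteEdges_adj.2 ⟨hxy, h⟩)

lemma deleteEdges_lt {s : Set (Sym2 V)} {e : Sym2 V} (he : e ∈ G.edgeSet) (hs : e ∈ s) :
    G.deleteEdges s < G := by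
  refine lt_of_le_of_ne (deleteEdges_le _) fun h => ?_
  rw [← h, edgeSet_deleteEdges] at he
  exact he.2 hs

/-- `not_win_glue` for deleting a set of edges, when the remaining graph loses with any vertex of
hatness `2`. -/
lemma not_win_glue_deleteEdges [DecidableEq V] {q : ℕ} {U : Set V} {s : Set (Sym2 V)} {h : V → ℕ}
    (hs : ∀ x y, s(x, y) ∈ s → x ∈ U)
    (hU : ∀ u ∈ U, ∀ x ∈ U, (G.deleteEdges s).Reachable u x → u = x)
    (hh : ∀ u ∈ U, ∀ x, (G.deleteEdges s).Reachable u x → x ≠ u → q ≤ h x)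
    (hlose : ∀ r, ¬ Win (G.deleteEdges s) Set.univ (Function.update (fun _ => q) r 2))
    (hrest : ¬ Win (G.deleteEdges s) Set.univ h) (hK : ¬ Win (fromEdgeSet s) U h) :
    ¬ Win G Set.univ h := by
  refine not_win_glue (fun x y hxy => adj_deleteEdges_or_fromEdgeSet s hxy)
    (fun x y hxy => hs x y ((fromEdgeSet_adj _).1 hxy).1) hU (fun u hu h' h2 he hw => ?_)
    (fun hw => hrest (hw.mono (Set.subset_univ _) fun _ _ => le_rfl)) hK
  refine hlose u (hw.mono (Set.subset_univ _) fun x hx => ?_)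
  by_cases hxu : x = u
  · simp [hxu, h2]
  · rw [Function.update_of_ne hxu, he x hxu]
    exact hh u hu x hx hxu

/-- If no cycle wins with one vertex of hatness `2` and the others of hatness `q`, then neither
does the whole graph. -/
theorem not_win_update [Finite V] [DecidableEq V] {q : ℕ} (hq : 3 ≤ q)
    (hd : G.AlmostDisjointCycles)
    (hcyc : ∀ (a : V) (c : G.Walk a a), c.IsCycle → ¬ CycWin c.length (oneTwo c.length q)) (r : V) :
    ¬ Win G Set.univ (Function.update (fun _ => q) r 2) := by
  induction G using WellFoundedLT.induction generalizing r with
  | ind G ih =>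
    have h2 : ∀ x, 2 ≤ Function.update (fun _ => q) r 2 x := fun x => by
      rw [Function.update_apply]
      split_ifs <;> omega
    by_cases hbot : G = ⊥
    · exact hbot ▸ not_win_bot h2
    obtain ⟨x, y, hxy, hr⟩ : ∃ x y, G.Adj x y ∧ ∀ H ≤ G, ∀ u, u ≠ r → H.Reachable u r → r = x := by
      by_cases hiso : ∃ y, G.Adj r y
      · obtain ⟨y, hy⟩ := hiso
        exact ⟨r, y, hy, fun _ _ _ _ _ => rfl⟩
      · obtain ⟨x, y, hxy⟩ := ne_bot_iff_exists_adj.1 hbot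
        refine ⟨x, y, hxy, fun H hH u hur hu => absurd ?_ hiso⟩
        obtain ⟨p⟩ := hu.symm
        cases p with
        | nil => exact absurd rfl hur
        | cons hadj p => exact ⟨_, hH hadj⟩
    have hsub : ∀ s, s(x, y) ∈ s → ∀ r, ¬ Win (G.deleteEdges s) Set.univ
        (Function.update (fun _ => q) r 2) := fun s hs r => by
      refine ih _ (deleteEdges_lt hxy hs) (hd.mono (deleteEdges_le _)) (fun a c hc => ?_) r
      simpa using hcyc a (c.mapLe (deleteEdges_le _)) (by simpa using hc)
    have hglue : ∀ s U, s(x, y) ∈ s → (∀ x y, s(x, y) ∈ s → x ∈ U) →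
        (∀ u ∈ U, ∀ x ∈ U, (G.deleteEdges s).Reachable u x → u = x) →
        ¬ Win (fromEdgeSet s) U (Function.update (fun _ => q) r 2) →
        ¬ Win G Set.univ (Function.update (fun _ => q) r 2) := by
      intro s U hxs hs hU hK
      refine not_win_glue_deleteEdges hs hU (fun u hu z huz hzu => ?_) (hsub s hxs) (hsub s hxs r)
        hK
      rw [Function.update_of_ne]
      rintro rfl
      obtain rfl := hr _ (deleteEdges_le s) u hzu.symm huz
      exact hzu (hU u hu _ (hs _ _ hxs) huz).symm
    by_cases hb : G.IsBridge s(x, y)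
    · rw [isBridge_iff] at hb
      refine hglue {s(x, y)} {x, y} rfl (fun z w hzw => ?_) ?_ ?_
      · rcases Sym2.eq_iff.1 hzw with ⟨rfl, rfl⟩ | ⟨rfl, rfl⟩ <;> simp
      · rintro u (rfl | rfl) z (rfl | rfl) huz
        · rfl
        · exact absurd huz hb
        · exact absurd huz.symm hb
        · rfl
      · by_cases hry : r = y
        · rw [Set.pair_comm]
          refine not_win_edge hxy.ne.symm (h2 y) ?_
          rwa [Function.update_of_ne (hry ▸ hxy.ne)]
        · refine not_win_edge hxy.ne (h2 x) ?_
          rwa [Function.update_of_ne (Ne.symm hry)]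
    · rw [isBridge_iff_forall_cycle_notMem hxy] at hb
      push Not at hb
      obtain ⟨a, c, hc, he⟩ := hb
      refine hglue {e | e ∈ c.edges} {z | z ∈ c.support} he
        (fun z w hzw => c.fst_mem_support_of_mem_edges hzw)
        (fun u hu z hz huz => hd.not_reachable hc hu hz huz) ?_
      by_cases hrc : r ∈ c.support
      · refine not_win_cycle hc hrc (fun v hv0 hv => update_comp_cycParam hv hv0) (hcyc a c hc)
      · intro hw
        refine not_win_cycle hc c.start_mem_support (h := Function.update (fun _ => q) a 2)
          (fun v hv0 hv => update_comp_cycParam hv hv0) (hcyc a c hc)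
          (hw.mono subset_rfl fun z hz => ?_)
        have hzr : z ≠ r := by
          rintro rfl
          exact hrc hz
        rw [Function.update_of_ne hzr, Function.update_apply]
        split_ifs <;> omega

lemma number_eq_three_iff [Nonempty V] :
    number G = 3 ↔ Winning G (fun _ => 3) ∧ ¬ Winning G (fun _ => 4) := by
  constructor
  · intro hn
    have hbdd : BddAbove {q | Winning G (fun _ => q)} := by
      by_contra hb
      have := Nat.sSup_of_not_bddAbove hb
      unfold number at hn
      omega
    refine ⟨?_, fun h4 => ?_⟩
    · have := Nat.sSup_mem ⟨0, winning_zero⟩ hbdd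
      unfold number at hn
      rwa [hn] at this
    · have := le_csSup hbdd h4
      unfold number at hn
      omega
  · rintro ⟨h3, h4⟩
    have hub : ∀ q ∈ {q | Winning G (fun _ => q)}, q ≤ 3 := fun q hq => by
      by_contra hlt
      exact h4 (Winning.anti hq (by omega))
    exact le_antisymm (csSup_le ⟨3, h3⟩ hub) (le_csSup ⟨3, hub⟩ h3)

lemma not_win_of_forall_cycle [Finite V] [Nonempty V] {q : ℕ} (hq : 3 ≤ q)
    (hd : G.AlmostDisjointCycles)
    (hcyc : ∀ (a : V) (c : G.Walk a a), c.IsCycle → ¬ CycWin c.length (oneTwo c.length q)) :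
    ¬ Win G Set.univ (fun _ => q) := by
  classical
  refine fun hw => not_win_update hq hd hcyc (Classical.arbitrary V) (hw.mono subset_rfl ?_)
  intro x _
  rw [Function.update_apply]
  split_ifs <;> omega

lemma not_win_of_isCycle [Finite V] {q : ℕ} (hq : 3 ≤ q) (hd : G.AlmostDisjointCycles)
    {a : V} {c : G.Walk a a} (hc : c.IsCycle) (hw : ¬ CycWin c.length (fun _ => q))
    (hcyc : ∀ (b : V) (d : G.Walk b b), d.IsCycle → {e | e ∈ c.edges} ≠ {e | e ∈ d.edges} →
      ¬ CycWin d.length (oneTwo d.length q)) :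
    ¬ Win G Set.univ (fun _ => q) := by
  classical
  have : Nonempty V := ⟨a⟩
  have hcyc' : ∀ (b : V) (d : (G.deleteEdges {e | e ∈ c.edges}).Walk b b), d.IsCycle →
      ¬ CycWin d.length (oneTwo d.length q) := by
    intro b d hd'
    have := hcyc b (d.mapLe (deleteEdges_le _)) (by simpa using hd') fun he => ?_
    · simpa using this
    · rw [Walk.edges_mapLe_eq_edges] at he
      cases d with
      | nil => simp at hd'
      | @cons _ z _ hadj d =>
        have h1 : s(b, z) ∈ {e | e ∈ (Walk.cons hadj d).edges} := by simp
        rw [← he] at h1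
        exact (deleteEdges_adj.1 hadj).2 h1
  have hd' := hd.mono (deleteEdges_le (G := G) {e | e ∈ c.edges})
  exact not_win_glue_deleteEdges (fun z w hzw => c.fst_mem_support_of_mem_edges hzw)
    (fun u hu z hz huz => hd.not_reachable hc hu hz huz) (fun _ _ _ _ _ => le_rfl)
    (not_win_update hq hd' hcyc') (not_win_of_forall_cycle hq hd' hcyc')
    (not_win_cycle hc c.start_mem_support (fun _ _ _ => rfl) hw)

lemma win_four_iff [Finite V] (hG : G.IsCactus) :
    Win G Set.univ (fun _ => 4) ↔ G.HasTwoTriangles := by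
  have := hG.1.nonempty
  have hlong : ∀ (a : V) (c : G.Walk a a), c.IsCycle → c.length ≠ 3 →
      ¬ CycWin c.length (oneTwo c.length 4) := fun a c hc h3 => by
    have := hc.three_le_length
    exact not_cycWin_oneTwo_four (by omega)
  constructor
  · intro hw
    by_contra htwo
    by_cases hex : ∃ (a : V) (c : G.Walk a a), c.IsCycle ∧ c.length = 3
    · obtain ⟨a, c, hc, h3⟩ := hex
      exact not_win_of_isCycle (by norm_num) hG.2 hc (h3 ▸ not_cycWin_triangle)
        (fun b d hd hne => hlong b d hd fun h3' => htwo ⟨a, b, c, d, hc, hd, h3, h3', hne⟩) hw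
    · push Not at hex
      exact not_win_of_forall_cycle (by norm_num) hG.2 (fun a c hc => hlong a c hc (hex a c hc)) hw
  · rintro ⟨a, b, c, d, hc, hd, hc3, hd3, hne⟩
    refine win_of_two_cycles le_rfl hG.1 hG.2 hc hd hne ?_ ?_
    · exact hc3 ▸ cycWin_triangle
    · exact hd3 ▸ cycWin_triangle

lemma win_three_iff [Finite V] (hG : G.IsCactus) :
    Win G Set.univ (fun _ => 3) ↔ G.HasTwoCycles ∨ G.HasGoodCycle := by
  have := hG.1.nonempty
  constructor
  · intro hw
    by_contra! hcon
    obtain ⟨htwo, hgood⟩ := hcon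
    by_cases hex : ∃ (a : V) (c : G.Walk a a), c.IsCycle
    · obtain ⟨a, c, hc⟩ := hex
      have h3 : ¬ 3 ∣ c.length := fun h => hgood ⟨a, c, hc, Or.inr h⟩
      have h4 : c.length ≠ 4 := fun h => hgood ⟨a, c, hc, Or.inl h⟩
      have := hc.three_le_length
      exact not_win_of_isCycle le_rfl hG.2 hc (not_cycWin_three (by omega) h3)
        (fun b d hd hne => absurd ⟨a, b, c, d, hc, hd, hne⟩ htwo) hw
    · push Not at hex
      exact not_win_of_forall_cycle le_rfl hG.2 (fun a c hc => absurd hc (hex a c)) hw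
  · rintro (⟨a, b, c, d, hc, hd, hne⟩ | ⟨a, c, hc, h4 | h3⟩)
    · exact win_of_two_cycles (by norm_num) hG.1 hG.2 hc hd hne
        (cycWin_oneTwo_three hc.three_le_length) (cycWin_oneTwo_three hd.three_le_length)
    · exact win_of_isCycle hc (h4 ▸ cycWin_four)
    · exact win_of_isCycle hc (cycWin_of_three_dvd hc.three_le_length h3)

end HatGame

/-- For a cactus graph `G`, the hat guessing number equals 3 iff `G` contains
fewer than two triangles, and contains at least two cycles or a cycle of length
4 or divisible by 3. -/
theorem cactus_hgNumber_eq_three_iff {V : Type*} [Fintype V] (G : SimpleGraph V)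
    (hG : G.IsCactus) :
    HatGame.number G = 3 ↔
      (¬ G.HasTwoTriangles ∧ (G.HasTwoCycles ∨ G.HasGoodCycle)) := by
  have := hG.1.nonempty
  rw [HatGame.number_eq_three_iff, HatGame.winning_iff_win (by norm_num),
    HatGame.winning_iff_win (by norm_num), HatGame.win_four_iff hG, HatGame.win_three_iff hG,
    and_comm]
end

section
/- Let G be a cactus graph. Then HG(G) = 2 if and only if G is a pseudotree with at least one edge and G has no cycle whose length is 4 or divisible by 3. -/
/-- A pseudotree: a connected graph with at most one cycle (any two cycles have
the same edge set). -/
def SimpleGraph.IsPseudotree {V : Type*} (G : SimpleGraph V) : Prop :=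
  G.Connected ∧
    ∀ (v w : V) (c₁ : G.Walk v v) (c₂ : G.Walk w w), c₁.IsCycle → c₂.IsCycle →
      {e | e ∈ c₁.edges} = {e | e ∈ c₂.edges}

/-- The number of arguments at which `g` takes the value `b`. -/
def hitCount (g : Fin 3 → Fin 3) (b : Fin 3) : ℕ :=
  (if g 0 = b then 1 else 0) + (if g 1 = b then 1 else 0) + (if g 2 = b then 1 else 0)

theorem hitCount_sum (g : Fin 3 → Fin 3) :
    hitCount g 0 + hitCount g 1 + hitCount g 2 = 3 := by
  have h : ∀ x y z : Fin 3, hitCount ![x, y, z] 0 + hitCount ![x, y, z] 1 +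
      hitCount ![x, y, z] 2 = 3 := by decide
  exact h (g 0) (g 1) (g 2)

theorem exists_unique_hit_of_hitCount_le_one (g : Fin 3 → Fin 3) (b : Fin 3)
    (h : hitCount g b ≤ 1) : ∃ t, ∀ c, c ≠ t → g c ≠ b := by
  have key : ∀ x y z b : Fin 3, hitCount ![x, y, z] b ≤ 1 →
      ∃ t, ∀ c, c ≠ t → ![x, y, z] c ≠ b := by decide
  obtain ⟨t, ht⟩ := key (g 0) (g 1) (g 2) b h
  refine ⟨t, fun c hc => ?_⟩
  have := ht c hc
  fin_cases c <;> exact this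

theorem not_hit_of_hitCount_eq_zero (g : Fin 3 → Fin 3) (b : Fin 3)
    (h : hitCount g b = 0) : ∀ c, g c ≠ b := by
  intro c hc
  unfold hitCount at h
  fin_cases c <;> simp_all

/-- Two sets of colors, each meeting the complement of every point, intersect. -/
theorem exists_common_color {P Q : Fin 3 → Prop} (hP : ∀ t, ∃ x, x ≠ t ∧ P x)
    (hQ : ∀ t, ∃ x, x ≠ t ∧ Q x) : ∃ x, P x ∧ Q x := by
  obtain ⟨x, -, hx⟩ := hP 0
  obtain ⟨y, hyx, hy⟩ := hP x
  obtain ⟨z, -, hz⟩ := hQ 0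
  obtain ⟨w, hwz, hw⟩ := hQ z
  have : x = z ∨ x = w ∨ y = z ∨ y = w := by omega
  rcases this with rfl | rfl | rfl | rfl
  exacts [⟨_, hx, hz⟩, ⟨_, hx, hw⟩, ⟨_, hy, hz⟩, ⟨_, hy, hw⟩]

theorem exists_ne_ne (x y : Fin 3) : ∃ z, z ≠ x ∧ z ≠ y := by
  revert x y; decide

/-- An all-wrong coloring of a path with fixed colors `a`, `z` just beyond its ends, whose last
color avoids `t`. -/
theorem exists_path_coloring_last_ne (f : ℕ → Fin 3 → Fin 3 → Fin 3) (a : Fin 3) (m : ℕ) :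
    ∀ z t : Fin 3, ∃ c : ℕ → Fin 3, c 0 = a ∧ c (m + 2) = z ∧ c (m + 1) ≠ t ∧
      ∀ i < m + 1, f i (c i) (c (i + 2)) ≠ c (i + 1) := by
  induction m with
  | zero =>
    intro z t
    obtain ⟨b, hb, hbt⟩ := exists_ne_ne (f 0 a z) t
    refine ⟨fun i => if i = 0 then a else if i = 1 then b else z, ?_⟩
    simp [hbt, hb.symm]
  | succ m ih =>
    intro z t
    set F : Fin 3 → Fin 3 → Prop := fun y x => ∃ c : ℕ → Fin 3, c 0 = a ∧ c (m + 2) = y ∧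
      c (m + 1) = x ∧ ∀ i < m + 1, f i (c i) (c (i + 2)) ≠ c (i + 1) with hF
    have hF' : ∀ y t, ∃ x, x ≠ t ∧ F y x := by
      intro y t
      obtain ⟨c, h0, h1, h2, h3⟩ := ih y t
      exact ⟨_, h2, c, h0, h1, rfl, h3⟩
    obtain ⟨b, hbt, -⟩ := exists_ne_ne t t
    obtain ⟨b', hbt', hbb⟩ := exists_ne_ne t b
    obtain ⟨x, hx, hx'⟩ := exists_common_color (hF' b) (hF' b')
    have : ∃ y, y ≠ t ∧ F y x ∧ f (m + 1) x z ≠ y := by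
      by_cases h : f (m + 1) x z = b
      · exact ⟨b', hbt', hx', by rw [h]; exact hbb.symm⟩
      · exact ⟨b, hbt, hx, h⟩
    obtain ⟨y, hyt, ⟨c, h0, h1, h2, h3⟩, hy⟩ := this
    refine ⟨fun i => if i = m + 3 then z else c i, by simp [h0], by simp, by simp [h1, hyt], ?_⟩
    intro i hi
    rcases Nat.lt_succ_iff_lt_or_eq.1 hi with hi | rfl
    · have := h3 i hi
      simpa [show i ≠ m + 3 by omega, show i ≠ m + 1 by omega, show i ≠ m + 2 by omega] using this
    · simpa [h1, h2] using hy

/-- An all-wrong coloring of a path with fixed colors `a`, `z` just beyond its ends, whose first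
color avoids `t`. -/
theorem exists_path_coloring_first_ne (f : ℕ → Fin 3 → Fin 3 → Fin 3) (z : Fin 3) (m : ℕ)
    (a t : Fin 3) : ∃ c : ℕ → Fin 3, c 0 = a ∧ c (m + 2) = z ∧ c 1 ≠ t ∧
      ∀ i < m + 1, f i (c i) (c (i + 2)) ≠ c (i + 1) := by
  obtain ⟨c, h0, h1, h2, h3⟩ :=
    exists_path_coloring_last_ne (fun i x y => f (m - i) y x) z m a t
  refine ⟨fun i => c (m + 2 - i), by simpa using h1, by simpa using h0, h2, fun i hi => ?_⟩
  have := h3 (m - i) (by omega)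
  rw [show m - (m - i) = i by omega, show m - i + 2 = m + 2 - i by omega,
    show m - i + 1 = m + 2 - (i + 1) by omega, show m - i = m + 2 - (i + 2) by omega] at this
  exact this

/-- `f i a c` is the guess of the vertex `i + 1` of a cycle of length `n`, whose neighbors `i` and
`i + 2` have colors `a` and `c`. The cycle is losing if some coloring makes all guesses wrong. -/
def CycleLosing (n : ℕ) (f : ℕ → Fin 3 → Fin 3 → Fin 3) : Prop :=
  ∃ c : ℕ → Fin 3, (∀ i, c (i + n) = c i) ∧ ∀ i, f i (c i) (c (i + 2)) ≠ c (i + 1)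

section Cycle

variable {n : ℕ} {f : ℕ → Fin 3 → Fin 3 → Fin 3}

theorem CycleLosing.of_shift (hn : 0 < n) (hf : ∀ i, f (i + n) = f i) (k : ℕ)
    (h : CycleLosing n (fun i => f (i + k))) : CycleLosing n f := by
  obtain ⟨c, hc, h⟩ := h
  have hck : ∀ j i, c (i + n * j) = c i := by
    intro j
    induction j with
    | zero => simp
    | succ j ih => intro i; rw [Nat.mul_succ, ← add_assoc, hc, ih]
  have hfk : ∀ j i, f (i + n * j) = f i := by
    intro j
    induction j with
    | zero => simp
    | succ j ih => intro i; rw [Nat.mul_succ, ← add_assoc, hf, ih]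
  obtain ⟨l, hl⟩ : ∃ l, l + k = n * k := ⟨n * k - k, Nat.sub_add_cancel (Nat.le_mul_of_pos_left k hn)⟩
  refine ⟨fun i => c (i + l), fun i => ?_, fun i => ?_⟩
  · change c (i + n + l) = c (i + l)
    rw [← hc (i + l)]
    congr 1
    omega
  · have : f (i + l + k) (c (i + l)) (c (i + l + 2)) ≠ c (i + l + 1) := h (i + l)
    rw [add_assoc i l k, hl, hfk] at this
    rwa [show i + l + 2 = i + 2 + l by omega, show i + l + 1 = i + 1 + l by omega] at this

theorem CycleLosing.of_closed (hn : 0 < n) (hf : ∀ i, f (i + n) = f i) (c : ℕ → Fin 3)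
    (h0 : c n = c 0) (h1 : c (n + 1) = c 1)
    (h : ∀ i < n, f i (c i) (c (i + 2)) ≠ c (i + 1)) : CycleLosing n f := by
  have hmod : ∀ i, f i = f (i % n) := by
    intro i
    induction i using Nat.strong_induction_on with
    | _ i ih =>
      rcases lt_or_ge i n with hi | hi
      · rw [Nat.mod_eq_of_lt hi]
      · rw [← Nat.sub_add_cancel hi, hf, Nat.add_mod_right, ih _ (by omega)]
  refine ⟨fun i => c (i % n), fun i => by simp, fun i => ?_⟩
  have hi := Nat.mod_lt i hn
  have := h _ hi
  rw [hmod]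
  have e1 : c ((i + 1) % n) = c (i % n + 1) := by
    rw [Nat.add_mod_eq_add_mod_right (c := 1) (Nat.mod_mod i n).symm]
    rcases (show i % n + 1 < n ∨ i % n + 1 = n by omega) with h | h
    · rw [Nat.mod_eq_of_lt h]
    · rw [h, Nat.mod_self, h0]
  have e2 : c ((i + 2) % n) = c (i % n + 2) := by
    rw [Nat.add_mod_eq_add_mod_right (c := 2) (Nat.mod_mod i n).symm]
    rcases (show i % n + 2 < n ∨ i % n + 2 = n ∨ i % n + 2 = n + 1 by omega) with h | h | h
    · rw [Nat.mod_eq_of_lt h]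
    · rw [h, Nat.mod_self, h0]
    · rw [h, h1, Nat.add_mod_left]
      rcases (show n = 1 ∨ 1 < n by omega) with rfl | hn
      · simp [h0]
      · rw [Nat.mod_eq_of_lt hn]
  simpa only [e1, e2] using this

theorem CycleLosing.of_edge (hn : 3 ≤ n) (hf : ∀ i, f (i + n) = f i) (i : ℕ) (a b : Fin 3)
    (h : hitCount (f (i + 1) a) b + hitCount (fun x => f i x b) a ≤ 1) : CycleLosing n f := by
  obtain ⟨m, rfl⟩ : ∃ m, n = m + 3 := ⟨n - 3, by omega⟩
  refine CycleLosing.of_shift (by omega) hf (i + 1) ?_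
  have key : ∃ c : ℕ → Fin 3, c 0 = b ∧ c (m + 2) = a ∧ f (i + 1) a (c 1) ≠ b ∧
      f i (c (m + 1)) b ≠ a ∧ ∀ j < m + 1, f (j + 1 + (i + 1)) (c j) (c (j + 2)) ≠ c (j + 1) := by
    rcases (show hitCount (f (i + 1) a) b = 0 ∨ hitCount (fun x => f i x b) a = 0 by omega)
      with h0 | h0
    · obtain ⟨t, ht⟩ := exists_unique_hit_of_hitCount_le_one (fun x => f i x b) a (by omega)
      obtain ⟨c, h1, h2, h3, h4⟩ :=
        exists_path_coloring_last_ne (fun j => f (j + 1 + (i + 1))) b m a t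
      exact ⟨c, h1, h2, not_hit_of_hitCount_eq_zero _ _ h0 _, ht _ h3, h4⟩
    · obtain ⟨t, ht⟩ := exists_unique_hit_of_hitCount_le_one (f (i + 1) a) b (by omega)
      obtain ⟨c, h1, h2, h3, h4⟩ :=
        exists_path_coloring_first_ne (fun j => f (j + 1 + (i + 1))) a m b t
      exact ⟨c, h1, h2, ht _ h3, not_hit_of_hitCount_eq_zero (fun x => f i x b) _ h0 _, h4⟩
  obtain ⟨c, h0, h1, h2, h3, h4⟩ := key
  refine CycleLosing.of_closed (by omega) (fun j => ?_)
    (fun j => if j = 0 then a else if j = m + 4 then b else c (j - 1)) ?_ ?_ ?_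
  · rw [← hf (j + (i + 1))]; congr 1; omega
  · simp [h1]
  · simp [h0]
  · intro j hj
    rcases Nat.eq_zero_or_pos j with rfl | hj0
    · simpa [h0] using h2
    · rcases (show j = m + 2 ∨ j < m + 2 by omega) with rfl | hj2
      · have : f (m + 2 + (i + 1)) = f i := by rw [← hf i]; congr 1; omega
        simpa [this, h1] using h3
      · obtain ⟨k, rfl⟩ : ∃ k, j = k + 1 := ⟨j - 1, by omega⟩
        have := h4 k (by omega)
        simpa [show k + 1 ≠ m + 4 by omega, show k ≠ m + 1 by omega, show k ≠ m + 2 by omega,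
          show k ≠ m + 3 by omega] using this

theorem CycleLosing.of_path (hn : 4 ≤ n) (hf : ∀ i, f (i + n) = f i) (i : ℕ) (a b d : Fin 3)
    (hb : f (i + 1) a d ≠ b)
    (h : hitCount (f (i + 2) b) d + hitCount (fun x => f i x b) a ≤ 1) : CycleLosing n f := by
  obtain ⟨m, rfl⟩ : ∃ m, n = m + 4 := ⟨n - 4, by omega⟩
  refine CycleLosing.of_shift (by omega) hf (i + 1) ?_
  have key : ∃ c : ℕ → Fin 3, c 0 = d ∧ c (m + 2) = a ∧ f (i + 2) b (c 1) ≠ d ∧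
      f i (c (m + 1)) b ≠ a ∧ ∀ j < m + 1, f (j + 2 + (i + 1)) (c j) (c (j + 2)) ≠ c (j + 1) := by
    rcases (show hitCount (f (i + 2) b) d = 0 ∨ hitCount (fun x => f i x b) a = 0 by omega)
      with h0 | h0
    · obtain ⟨t, ht⟩ := exists_unique_hit_of_hitCount_le_one (fun x => f i x b) a (by omega)
      obtain ⟨c, h1, h2, h3, h4⟩ :=
        exists_path_coloring_last_ne (fun j => f (j + 2 + (i + 1))) d m a t
      exact ⟨c, h1, h2, not_hit_of_hitCount_eq_zero _ _ h0 _, ht _ h3, h4⟩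
    · obtain ⟨t, ht⟩ := exists_unique_hit_of_hitCount_le_one (f (i + 2) b) d (by omega)
      obtain ⟨c, h1, h2, h3, h4⟩ :=
        exists_path_coloring_first_ne (fun j => f (j + 2 + (i + 1))) a m d t
      exact ⟨c, h1, h2, ht _ h3, not_hit_of_hitCount_eq_zero (fun x => f i x b) _ h0 _, h4⟩
  obtain ⟨c, h0, h1, h2, h3, h4⟩ := key
  refine CycleLosing.of_closed (by omega) (fun j => ?_)
    (fun j => if j = 0 then a else if j = 1 then b else if j = m + 5 then b else c (j - 2)) ?_ ?_ ?_
  · rw [← hf (j + (i + 1))]; congr 1; omega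
  · simp [h1]
  · simp
  · intro j hj
    rcases (show j = 0 ∨ j = 1 ∨ 2 ≤ j by omega) with rfl | rfl | hj0
    · simpa [h0] using hb
    · have : f (1 + (i + 1)) = f (i + 2) := by congr 1; omega
      simpa [this, h0] using h2
    · rcases (show j = m + 3 ∨ j < m + 3 by omega) with rfl | hj2
      · have : f (m + 3 + (i + 1)) = f i := by rw [← hf i]; congr 1; omega
        simpa [this, h1] using h3
      · obtain ⟨k, rfl⟩ : ∃ k, j = k + 2 := ⟨j - 2, by omega⟩
        have := h4 k (by omega)
        simpa [show k + 1 ≠ m + 4 by omega, show k ≠ m + 1 by omega, show k ≠ m + 2 by omega,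
          show k ≠ m + 3 by omega] using this

end Cycle

/-- The number of `c` with `f a c = b`. -/
def rowHits (f : Fin 3 → Fin 3 → Fin 3) (a b : Fin 3) : ℕ := hitCount (f a) b

/-- The number of `a` with `f a c = b`. -/
def colHits (f : Fin 3 → Fin 3 → Fin 3) (b c : Fin 3) : ℕ := hitCount (fun a => f a c) b

/-- The number of pairs at which `R` takes the value `1`. -/
def onesCount (R : Fin 3 → Fin 3 → ℕ) : ℕ :=
  hitCount (fun b => if R 0 b = 1 then 1 else 0) 1 +
  hitCount (fun b => if R 1 b = 1 then 1 else 0) 1 +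
  hitCount (fun b => if R 2 b = 1 then 1 else 0) 1

/-- The function that sees `x`, `z` and guesses `x + 1` if they agree and `x` otherwise. -/
def shiftGuess (x z : Fin 3) : Fin 3 := if z = x then x + 1 else x

/-- The necessary local conditions on the guessing functions of a winning cycle. -/
def IsBalancedGuess (f : Fin 3 → Fin 3 → Fin 3) : Prop :=
  (∀ b, rowHits f 0 b + rowHits f 1 b + rowHits f 2 b = 3) ∧
  (∀ a b, rowHits f a b ≤ 2) ∧ (∀ b c, colHits f b c ≤ 2) ∧
  ∀ a b c, f a c ≠ b → rowHits f a b + colHits f b c ≤ 2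

/-- A guessing function with exceptional colors `β`, `β'`, `β''` for the left neighbor, the vertex
itself and the right neighbor. -/
def IsPivotGuess (f : Fin 3 → Fin 3 → Fin 3) (β β' β'' : Fin 3) : Prop :=
  (∀ c, f β c = β' ↔ c = β'') ∧ (∀ a, a ≠ β → f a β'' ≠ β' ∧ ∃ z, z ≠ β'' ∧ f a z ≠ β') ∧
  (∀ a b, rowHits f a b = 1 ↔ a = β ∨ b = β') ∧ ∀ b c, colHits f b c = 1 ↔ b = β' ∨ c = β''

instance (f a b c) : Decidable (IsPivotGuess f a b c) := by unfold IsPivotGuess; infer_instance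

/-- The function with the given table of values. -/
def tableGuess (x₀ x₁ x₂ y₀ y₁ y₂ z₀ z₁ z₂ : Fin 3) (a c : Fin 3) : Fin 3 :=
  match a with
  | 0 => match c with | 0 => x₀ | 1 => x₁ | 2 => x₂
  | 1 => match c with | 0 => y₀ | 1 => y₁ | 2 => y₂
  | 2 => match c with | 0 => z₀ | 1 => z₁ | 2 => z₂

/-- The multiset `{x, y, z}` of colors, written in base four. -/
def lineCode (x y z : ℕ) : ℕ := Nat.add (Nat.add (Nat.pow 4 x) (Nat.pow 4 y)) (Nat.pow 4 z)

def digitFour (n b : ℕ) : ℕ := Nat.mod (Nat.div n (Nat.pow 4 b)) 4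

def lowAt (l m x b : ℕ) : Bool :=
  Nat.beq x b || Nat.ble (Nat.add (digitFour l b) (digitFour m b)) 2

def lowCell (l m x : ℕ) : Bool := lowAt l m x 0 && (lowAt l m x 1 && lowAt l m x 2)

def notConstCode (n : ℕ) : Bool := !(Nat.beq n 3) && (!(Nat.beq n 12) && !(Nat.beq n 48))

/-- A version of `IsBalancedGuess` for `tableGuess` that the kernel evaluates quickly. -/
def balancedCheck (x₀ x₁ x₂ y₀ y₁ y₂ z₀ z₁ z₂ : ℕ) : Bool :=
  Nat.beq (Nat.add (lineCode x₀ x₁ x₂) (Nat.add (lineCode y₀ y₁ y₂) (lineCode z₀ z₁ z₂))) 63 &&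
  (notConstCode (lineCode x₀ x₁ x₂) && (notConstCode (lineCode y₀ y₁ y₂) &&
  (notConstCode (lineCode z₀ z₁ z₂) && (notConstCode (lineCode x₀ y₀ z₀) &&
  (notConstCode (lineCode x₁ y₁ z₁) && (notConstCode (lineCode x₂ y₂ z₂) &&
  (lowCell (lineCode x₀ x₁ x₂) (lineCode x₀ y₀ z₀) x₀ &&
  (lowCell (lineCode x₀ x₁ x₂) (lineCode x₁ y₁ z₁) x₁ &&
  (lowCell (lineCode x₀ x₁ x₂) (lineCode x₂ y₂ z₂) x₂ &&
  (lowCell (lineCode y₀ y₁ y₂) (lineCode x₀ y₀ z₀) y₀ &&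
  (lowCell (lineCode y₀ y₁ y₂) (lineCode x₁ y₁ z₁) y₁ &&
  (lowCell (lineCode y₀ y₁ y₂) (lineCode x₂ y₂ z₂) y₂ &&
  (lowCell (lineCode z₀ z₁ z₂) (lineCode x₀ y₀ z₀) z₀ &&
  (lowCell (lineCode z₀ z₁ z₂) (lineCode x₁ y₁ z₁) z₁ &&
  lowCell (lineCode z₀ z₁ z₂) (lineCode x₂ y₂ z₂) z₂))))))))))))))

set_option maxRecDepth 100000 in
theorem tableGuess_classification : ∀ x₀ x₁ x₂ y₀ y₁ y₂ z₀ z₁ z₂ : Fin 3,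
    balancedCheck x₀.val x₁.val x₂.val y₀.val y₁.val y₂.val z₀.val z₁.val z₂.val = true →
    onesCount (colHits (tableGuess x₀ x₁ x₂ y₀ y₁ y₂ z₀ z₁ z₂)) =
      onesCount (rowHits (tableGuess x₀ x₁ x₂ y₀ y₁ y₂ z₀ z₁ z₂)) ∧
    (onesCount (rowHits (tableGuess x₀ x₁ x₂ y₀ y₁ y₂ z₀ z₁ z₂)) = 9 ∨
    onesCount (rowHits (tableGuess x₀ x₁ x₂ y₀ y₁ y₂ z₀ z₁ z₂)) = 5 ∧
      (∃ β β' β'', IsPivotGuess (tableGuess x₀ x₁ x₂ y₀ y₁ y₂ z₀ z₁ z₂) β β' β'') ∨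
    onesCount (rowHits (tableGuess x₀ x₁ x₂ y₀ y₁ y₂ z₀ z₁ z₂)) = 3 ∧
      ∃ p, p ≠ 0 ∧ ∃ q m, q ≠ 0 ∧
        ∃ n₀, (∀ x, tableGuess x₀ x₁ x₂ y₀ y₁ y₂ z₀ z₁ z₂ (p * x) n₀ =
          m + q * shiftGuess x 0) ∧
        ∃ n₁, n₁ ≠ n₀ ∧ (∀ x, tableGuess x₀ x₁ x₂ y₀ y₁ y₂ z₀ z₁ z₂ (p * x) n₁ =
          m + q * shiftGuess x 1) ∧
        ∃ n₂, n₂ ≠ n₁ ∧ n₂ ≠ n₀ ∧ ∀ x, tableGuess x₀ x₁ x₂ y₀ y₁ y₂ z₀ z₁ z₂ (p * x) n₂ =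
          m + q * shiftGuess x 2) := by
  decide +kernel

theorem lineCode_eq (g : Fin 3 → Fin 3) : lineCode (g 0).val (g 1).val (g 2).val =
    hitCount g 0 + 4 * hitCount g 1 + 16 * hitCount g 2 := by
  have : ∀ x y z : Fin 3, lineCode x.val y.val z.val = hitCount ![x, y, z] 0 +
    4 * hitCount ![x, y, z] 1 + 16 * hitCount ![x, y, z] 2 := by decide
  exact this (g 0) (g 1) (g 2)

theorem digitFour_lineCode (g : Fin 3 → Fin 3) (b : Fin 3) :
    digitFour (lineCode (g 0).val (g 1).val (g 2).val) b.val = hitCount g b := by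
  have : ∀ x y z b : Fin 3, digitFour (lineCode x.val y.val z.val) b.val =
    hitCount ![x, y, z] b := by decide
  exact this (g 0) (g 1) (g 2) b

theorem notConstCode_lineCode (g : Fin 3 → Fin 3) (h : ∀ b, hitCount g b ≤ 2) :
    notConstCode (lineCode (g 0).val (g 1).val (g 2).val) = true := by
  have : ∀ x y z : Fin 3, (∀ b, hitCount ![x, y, z] b ≤ 2) →
    notConstCode (lineCode x.val y.val z.val) = true := by decide
  exact this (g 0) (g 1) (g 2) h

theorem IsBalancedGuess.lowCell {f : Fin 3 → Fin 3 → Fin 3} (hf : IsBalancedGuess f)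
    (a c : Fin 3) : lowCell (lineCode (f a 0).val (f a 1).val (f a 2).val)
      (lineCode (f 0 c).val (f 1 c).val (f 2 c).val) (f a c).val = true := by
  have key : ∀ b : Fin 3, lowAt (lineCode (f a 0).val (f a 1).val (f a 2).val)
      (lineCode (f 0 c).val (f 1 c).val (f 2 c).val) (f a c).val b.val = true := by
    intro b
    unfold lowAt
    rw [digitFour_lineCode (f a), digitFour_lineCode (fun a => f a c)]
    rw [Bool.or_eq_true, Nat.beq_eq, Nat.ble_eq]
    by_cases h : f a c = b
    · exact Or.inl (congrArg Fin.val h)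
    · exact Or.inr (hf.2.2.2 a b c h)
  unfold _root_.lowCell
  simp only [Bool.and_eq_true]
  exact ⟨key 0, key 1, key 2⟩

theorem IsBalancedGuess.balancedCheck {f : Fin 3 → Fin 3 → Fin 3} (hf : IsBalancedGuess f) :
    balancedCheck (f 0 0).val (f 0 1).val (f 0 2).val (f 1 0).val (f 1 1).val (f 1 2).val
      (f 2 0).val (f 2 1).val (f 2 2).val = true := by
  unfold _root_.balancedCheck
  simp only [Bool.and_eq_true]
  refine ⟨?_, notConstCode_lineCode _ (hf.2.1 0), notConstCode_lineCode _ (hf.2.1 1),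
    notConstCode_lineCode _ (hf.2.1 2), notConstCode_lineCode (fun a => f a 0) (hf.2.2.1 · 0),
    notConstCode_lineCode (fun a => f a 1) (hf.2.2.1 · 1),
    notConstCode_lineCode (fun a => f a 2) (hf.2.2.1 · 2), hf.lowCell 0 0, hf.lowCell 0 1,
    hf.lowCell 0 2, hf.lowCell 1 0, hf.lowCell 1 1, hf.lowCell 1 2, hf.lowCell 2 0,
    hf.lowCell 2 1, hf.lowCell 2 2⟩
  rw [lineCode_eq (f 0), lineCode_eq (f 1), lineCode_eq (f 2), Nat.beq_eq]
  have h := hf.1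
  have h0 := h 0
  have h1 := h 1
  have h2 := h 2
  simp only [rowHits] at h0 h1 h2
  simp only [Nat.add_eq]
  omega

/-- A guessing function that is conjugate to `shiftGuess`. -/
def IsShiftGuess (f : Fin 3 → Fin 3 → Fin 3) (l m n : Fin 3 → Fin 3) : Prop :=
  l.Bijective ∧ m.Bijective ∧ n.Bijective ∧ ∀ x z, f (l x) (n z) = m (shiftGuess x z)

theorem IsBalancedGuess.classification {f : Fin 3 → Fin 3 → Fin 3} (hf : IsBalancedGuess f) :
    onesCount (colHits f) = onesCount (rowHits f) ∧
    (onesCount (rowHits f) = 9 ∨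
      onesCount (rowHits f) = 5 ∧ (∃ β β' β'', IsPivotGuess f β β' β'') ∨
      onesCount (rowHits f) = 3 ∧ ∃ l m n, IsShiftGuess f l m n) := by
  have hft : tableGuess (f 0 0) (f 0 1) (f 0 2) (f 1 0) (f 1 1) (f 1 2) (f 2 0) (f 2 1) (f 2 2)
      = f := by
    funext a c
    fin_cases a <;> fin_cases c <;> rfl
  have h := tableGuess_classification _ _ _ _ _ _ _ _ _ hf.balancedCheck
  rw [hft] at h
  refine ⟨h.1, h.2.imp_right (Or.imp_right ?_)⟩
  rintro ⟨h3, p, hp, q, m, hq, n₀, h₀, n₁, hn₁, h₁, n₂, hn₂, hn₂', h₂⟩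
  have aff : ∀ p q : Fin 3, p ≠ 0 → Function.Bijective (fun x => q + p * x) := by
    intro p q hp
    rw [← Finite.injective_iff_bijective]
    intro x y
    revert p q x y
    decide
  refine ⟨h3, fun x => p * x, fun x => m + q * x, ![n₀, n₁, n₂], ?_, aff _ _ hq, ?_, ?_⟩
  · simpa using aff p 0 hp
  · rw [← Finite.injective_iff_bijective]
    intro x y hxy
    fin_cases x <;> fin_cases y <;> simp_all
  · intro x z
    fin_cases z
    exacts [h₀ x, h₁ x, h₂ x]

theorem injective_of_hitCount_eq_one (g : Fin 3 → Fin 3) (h : ∀ b, hitCount g b = 1) :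
    Function.Injective g := by
  have key : ∀ x y z : Fin 3, (∀ b, hitCount ![x, y, z] b = 1) → x ≠ y ∧ x ≠ z ∧ y ≠ z := by
    decide
  obtain ⟨h1, h2, h3⟩ := key (g 0) (g 1) (g 2) h
  intro x y hxy
  fin_cases x <;> fin_cases y <;> simp_all

theorem hitCount_comp (g n : Fin 3 → Fin 3) (hn : n.Bijective) (b : Fin 3) :
    hitCount (fun z => g (n z)) b = hitCount g b := by
  have h : ∀ g, hitCount g b = ∑ i, if g i = b then 1 else 0 := fun g => by
    rw [Fin.sum_univ_three]; rfl
  rw [h, h]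
  exact hn.sum_comp (fun i => if g i = b then 1 else 0)

theorem hitCount_of_injective (g m : Fin 3 → Fin 3) (hm : m.Injective) (b : Fin 3) :
    hitCount (fun z => m (g z)) (m b) = hitCount g b := by
  simp [hitCount, hm.eq_iff]

theorem hitCount_le (g : Fin 3 → Fin 3) (b : Fin 3) : hitCount g b ≤ 3 := by
  unfold hitCount
  split_ifs <;> omega

theorem eq_of_hitCount_eq_three {g : Fin 3 → Fin 3} {b : Fin 3} (h : hitCount g b = 3)
    (x : Fin 3) : g x = b := by
  unfold hitCount at h
  split_ifs at h with h0 h1 h2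
  all_goals try omega
  fin_cases x
  exacts [h0, h1, h2]

theorem eq_one_of_onesCount_eq_nine {R : Fin 3 → Fin 3 → ℕ} (h : onesCount R = 9) (a b : Fin 3) :
    R a b = 1 := by
  have hle := fun a => hitCount_le (fun b => if R a b = 1 then 1 else 0) 1
  have h0 := hle 0
  have h1 := hle 1
  have h2 := hle 2
  unfold onesCount at h
  have h3 : hitCount (fun b => if R a b = 1 then 1 else 0) 1 = 3 := by
    fin_cases a <;> simp only [Fin.zero_eta, Fin.mk_one, Fin.reduceFinMk] <;> omega
  by_contra hab
  simpa [hab] using eq_of_hitCount_eq_three h3 b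

theorem IsShiftGuess.rowHits_eq {f : Fin 3 → Fin 3 → Fin 3} {l m n : Fin 3 → Fin 3}
    (h : IsShiftGuess f l m n) (x y : Fin 3) :
    rowHits f (l x) (m y) = hitCount (shiftGuess x) y := by
  rw [rowHits, ← hitCount_comp _ n h.2.2.1]
  simp_rw [h.2.2.2]
  exact hitCount_of_injective _ _ h.2.1.1 _

theorem IsShiftGuess.colHits_eq {f : Fin 3 → Fin 3 → Fin 3} {l m n : Fin 3 → Fin 3}
    (h : IsShiftGuess f l m n) (y z : Fin 3) :
    colHits f (m y) (n z) = hitCount (fun x => shiftGuess x z) y := by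
  rw [colHits, ← hitCount_comp _ l h.1]
  simp_rw [h.2.2.2]
  exact hitCount_of_injective (fun x => shiftGuess x z) _ h.2.1.1 _

theorem IsShiftGuess.exists_shift {f g : Fin 3 → Fin 3 → Fin 3} {l m n l' m' n' : Fin 3 → Fin 3}
    (hf : IsShiftGuess f l m n) (hg : IsShiftGuess g l' m' n')
    (h : ∀ a b, rowHits g a b + colHits f a b = 2) :
    ∃ k, ∀ x, l' x = m (x + k) ∧ m' x = n (x + k) := by
  choose σ hσ using fun x => hf.2.1.2 (l' x)
  choose ω hω using fun x => hf.2.2.1.2 (m' x)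
  have key : ∀ s₀ s₁ s₂ w₀ w₁ w₂ : Fin 3, (∀ x y, hitCount (shiftGuess x) y +
      hitCount (fun t => shiftGuess t (![w₀, w₁, w₂] y)) (![s₀, s₁, s₂] x) = 2) →
      ∃ k, (s₀ = 0 + k ∧ s₁ = 1 + k ∧ s₂ = 2 + k) ∧ w₀ = 0 + k ∧ w₁ = 1 + k ∧ w₂ = 2 + k := by
    decide +kernel
  have hvec : ∀ ρ : Fin 3 → Fin 3, ![ρ 0, ρ 1, ρ 2] = ρ := by
    intro ρ; funext x; fin_cases x <;> rfl
  obtain ⟨k, ⟨h1, h2, h3⟩, h4, h5, h6⟩ := key (σ 0) (σ 1) (σ 2) (ω 0) (ω 1) (ω 2) (by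
    intro x y
    rw [hvec, hvec, ← hg.rowHits_eq, ← hf.colHits_eq, hσ, hω]
    exact h _ _)
  refine ⟨k, fun x => ?_⟩
  rw [← hσ, ← hω]
  fin_cases x
  exacts [⟨congrArg m h1, congrArg n h4⟩, ⟨congrArg m h2, congrArg n h5⟩,
    ⟨congrArg m h3, congrArg n h6⟩]

/-- There is a sequence of `k + 2` colors beginning with `x`, `y` and ending with `x'`, `y'` that
makes the guesses `f i`, …, `f (i + k - 1)` of the inner vertices wrong. -/
def GuessWalk (f : ℕ → Fin 3 → Fin 3 → Fin 3) : ℕ → ℕ → Fin 3 → Fin 3 → Fin 3 → Fin 3 → Prop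
  | _, 0, x, y, x', y' => x = x' ∧ y = y'
  | i, k + 1, x, y, x', y' => ∃ z, f i x z ≠ y ∧ GuessWalk f (i + 1) k y z x' y'

section Walk

variable {f : ℕ → Fin 3 → Fin 3 → Fin 3}

theorem GuessWalk.trans {k l : ℕ} {x' y' x'' y'' : Fin 3} : ∀ {i : ℕ} {x y : Fin 3},
    GuessWalk f i k x y x' y' → GuessWalk f (i + k) l x' y' x'' y'' →
    GuessWalk f i (k + l) x y x'' y'' := by
  induction k with
  | zero =>
    rintro i x y ⟨rfl, rfl⟩ h
    simpa using h
  | succ k ih =>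
    rintro i x y ⟨z, hz, h⟩ h'
    rw [Nat.succ_add]
    refine ⟨z, hz, ih h ?_⟩
    rwa [show i + 1 + k = i + (k + 1) by omega]

theorem GuessWalk.exists_coloring {k : ℕ} {x' y' : Fin 3} : ∀ {i : ℕ} {x y : Fin 3},
    GuessWalk f i k x y x' y' → ∃ c : ℕ → Fin 3, c 0 = x ∧ c 1 = y ∧ c k = x' ∧ c (k + 1) = y' ∧
      ∀ j < k, f (i + j) (c j) (c (j + 2)) ≠ c (j + 1) := by
  induction k with
  | zero =>
    rintro i x y ⟨rfl, rfl⟩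
    exact ⟨fun j => if j = 0 then x else y, by simp⟩
  | succ k ih =>
    rintro i x y ⟨z, hz, h⟩
    obtain ⟨c, h0, h1, h2, h3, h4⟩ := ih h
    refine ⟨fun j => if j = 0 then x else c (j - 1), by simp, by simp [h0], by simp [h2],
      by simp [h3], fun j hj => ?_⟩
    rcases Nat.eq_zero_or_pos j with rfl | hj0
    · simpa [h0, h1] using hz
    · obtain ⟨j, rfl⟩ : ∃ l, j = l + 1 := ⟨j - 1, by omega⟩
      have := h4 j (by omega)
      rw [show i + 1 + j = i + (j + 1) by omega] at this
      simpa using this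

theorem GuessWalk.cycleLosing {n : ℕ} (hn : 0 < n) (hf : ∀ i, f (i + n) = f i) {x y : Fin 3}
    (h : GuessWalk f 0 n x y x y) : CycleLosing n f := by
  obtain ⟨c, h0, h1, h2, h3, h4⟩ := h.exists_coloring
  refine CycleLosing.of_closed hn hf c (h2.trans h0.symm) (h3.trans h1.symm) ?_
  simpa using h4

theorem GuessWalk.exists_of_injective (hf : ∀ i a, Function.Injective (f i a)) (k : ℕ) :
    ∀ i x y, ∃ x' y', GuessWalk f i k x y x' y' := by
  induction k with
  | zero => exact fun i x y => ⟨x, y, rfl, rfl⟩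
  | succ k ih =>
    intro i x y
    obtain ⟨z, hz⟩ : ∃ z, f i x z ≠ y := by
      by_contra! h
      exact absurd (hf i x ((h 0).trans (h 1).symm)) (by decide)
    obtain ⟨x', y', h⟩ := ih (i + 1) y z
    exact ⟨x', y', z, hz, h⟩

theorem guessWalk_five_of_injective (hf : ∀ i a, Function.Injective (f i a))
    (hf' : ∀ i c, Function.Injective (fun a => f i a c)) (i : ℕ) (x y x' y' : Fin 3) :
    GuessWalk f i 5 x y x' y' := by
  have key : ∀ g : Fin 3 → Fin 3, g.Injective → ∀ b t, ∃ u, u ≠ t ∧ g u ≠ b := by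
    intro g hg b t
    obtain ⟨u, hu, -⟩ := exists_ne_ne t t
    obtain ⟨v, hv, hvu⟩ := exists_ne_ne t u
    by_cases h : g u = b
    · exact ⟨v, hv, fun h' => hvu (hg (h'.trans h.symm))⟩
    · exact ⟨u, hu, h⟩
  obtain ⟨u, hu, hu'⟩ := exists_common_color
    (key (fun u => f i x (f (i + 1) y u)) ((hf i x).comp (hf (i + 1) y)) y)
    (key (fun u => f (i + 4) (f (i + 3) u x') y')
      ((hf' (i + 4) y').comp (hf' (i + 3) x')) x')
  obtain ⟨v, hv, hv'⟩ := exists_ne_ne u (f (i + 2) (f (i + 1) y u) (f (i + 3) u x'))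
  exact ⟨_, hu, v, (hf (i + 1) y).ne hv, _, hv'.symm, x', (hf' (i + 3) x').ne hv, y', hu',
    rfl, rfl⟩

section Pivot

variable {β : ℕ → Fin 3}

theorem guessWalk_two_of_pivot (h₁ : ∀ i c, f i (β i) c = β (i + 1) ↔ c = β (i + 2))
    (h₂ : ∀ i a, a ≠ β i → ∃ z, z ≠ β (i + 2) ∧ f i a z ≠ β (i + 1)) (k : ℕ) :
    ∀ i x, x ≠ β i → ∃ x', x' ≠ β (i + 2 * k) ∧
      GuessWalk f i (2 * k) x (β (i + 1)) x' (β (i + 2 * k + 1)) := by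
  induction k with
  | zero => exact fun i x hx => ⟨x, hx, rfl, rfl⟩
  | succ k ih =>
    intro i x hx
    obtain ⟨z, hz, hz'⟩ := h₂ i x hx
    obtain ⟨x', hx', hw⟩ := ih (i + 2) z hz
    rw [show i + 2 + 2 * k = i + 2 * (k + 1) by omega] at hx' hw
    refine ⟨x', hx', z, hz', β (i + 3), ?_, hw⟩
    rw [(h₁ (i + 1) (β (i + 3))).2 rfl]
    exact hz.symm

theorem guessWalk_three_of_pivot (h₁ : ∀ i c, f i (β i) c = β (i + 1) ↔ c = β (i + 2))
    (h₂ : ∀ i a, a ≠ β i → f i a (β (i + 2)) ≠ β (i + 1)) (i : ℕ) (x x' : Fin 3)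
    (hx : x ≠ β i) (hx' : x' ≠ β (i + 3)) :
    GuessWalk f i 3 x (β (i + 1)) x' (β (i + 4)) := by
  refine ⟨β (i + 2), h₂ i x hx, x', ?_, β (i + 4), ?_, rfl, rfl⟩
  · exact fun h => hx' ((h₁ (i + 1) x').1 h)
  · rw [(h₁ (i + 2) (β (i + 4))).2 rfl]
    exact hx'.symm

theorem cycleLosing_of_pivot {n : ℕ} (hn : 5 ≤ n) (hf : ∀ i, f (i + n) = f i)
    (hβ : ∀ i, β (i + n) = β i) (h₁ : ∀ i c, f i (β i) c = β (i + 1) ↔ c = β (i + 2))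
    (h₂ : ∀ i a, a ≠ β i → f i a (β (i + 2)) ≠ β (i + 1))
    (h₃ : ∀ i a, a ≠ β i → ∃ z, z ≠ β (i + 2) ∧ f i a z ≠ β (i + 1)) : CycleLosing n f := by
  obtain ⟨x, hx, -⟩ := exists_ne_ne (β 0) (β 0)
  have hβ0 : β n = β 0 := by simpa using hβ 0
  have hβ1 : β (n + 1) = β 1 := by simpa [add_comm] using hβ 1
  refine GuessWalk.cycleLosing (x := x) (y := β 1) (by omega) hf ?_
  rcases Nat.even_or_odd' n with ⟨m, h | h⟩
  · obtain ⟨k, rfl⟩ : ∃ k, m = k + 3 := ⟨m - 3, by omega⟩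
    obtain ⟨y, hy, hw⟩ := guessWalk_two_of_pivot h₁ h₃ k 0 x hx
    obtain ⟨z, hz, -⟩ := exists_ne_ne (β (0 + 2 * k + 3)) (β 0)
    have h3 := guessWalk_three_of_pivot h₁ h₂ _ y z hy hz
    have h6 := guessWalk_three_of_pivot h₁ h₂ _ z x hz
      (by rw [show 0 + 2 * k + 3 + 3 = n by omega, hβ0]; exact hx)
    have := (hw.trans h3).trans h6
    rw [show 2 * k + 3 + 3 = n by omega, show 0 + 2 * k + 3 + 4 = n + 1 by omega, hβ1] at this
    exact this
  · obtain ⟨k, rfl⟩ : ∃ k, m = k + 1 := ⟨m - 1, by omega⟩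
    obtain ⟨y, hy, hw⟩ := guessWalk_two_of_pivot h₁ h₃ k 0 x hx
    have h3 := guessWalk_three_of_pivot h₁ h₂ _ y x hy
      (by rw [show 0 + 2 * k + 3 = n by omega, hβ0]; exact hx)
    have := hw.trans h3
    rw [show 2 * k + 3 = n by omega, show 0 + 2 * k + 4 = n + 1 by omega, hβ1] at this
    exact this

end Pivot

theorem exists_nsmul_eq {n : ℕ} (hn : ¬ 3 ∣ n) (k : Fin 3) : ∃ e : Fin 3, n • e = k := by
  have h3 : ∀ e : Fin 3, 3 • e = 0 := by decide
  have hmod : ∀ e : Fin 3, n • e = (n % 3) • e := by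
    intro e
    conv_lhs => rw [← Nat.mod_add_div n 3, add_nsmul, mul_comm, mul_nsmul, ]
    simp [h3]
  simp_rw [hmod]
  rcases (show n % 3 = 1 ∨ n % 3 = 2 by omega) with h | h <;> rw [h] <;> revert k <;> decide

theorem cycleLosing_of_shiftGuess {n : ℕ} (hn3 : ¬ 3 ∣ n)
    (hf : ∀ i, f (i + n) = f i) (h : ∀ i, ∃ l m n, IsShiftGuess (f i) l m n)
    (hlink : ∀ i a b, rowHits (f (i + 1)) a b + colHits (f i) a b = 2) : CycleLosing n f := by
  have h' : ∀ g : Fin 3 → Fin 3 → Fin 3, ∃ l m n : Fin 3 → Fin 3,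
      (∃ i, f i = g) → IsShiftGuess g l m n := by
    intro g
    by_cases hg : ∃ i, f i = g
    · obtain ⟨i, rfl⟩ := hg
      obtain ⟨l, m, n, h⟩ := h i
      exact ⟨l, m, n, fun _ => h⟩
    · exact ⟨id, id, id, fun h => absurd h hg⟩
  choose l m r hlmr using h'
  have hs : ∀ i, IsShiftGuess (f i) (l (f i)) (m (f i)) (r (f i)) := fun i => hlmr _ ⟨i, rfl⟩
  have hk : ∀ g g' : Fin 3 → Fin 3 → Fin 3, ∃ k, (∃ i, f i = g ∧ f (i + 1) = g') →
      ∀ x, l g' x = m g (x + k) ∧ m g' x = r g (x + k) := by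
    intro g g'
    by_cases hg : ∃ i, f i = g ∧ f (i + 1) = g'
    · obtain ⟨i, rfl, rfl⟩ := hg
      obtain ⟨k, hk⟩ := (hs i).exists_shift (hs (i + 1)) (hlink i)
      exact ⟨k, fun _ => hk⟩
    · exact ⟨0, fun h => absurd h hg⟩
  choose k hk using hk
  have hk' : ∀ i x, l (f (i + 1)) x = m (f i) (x + k (f i) (f (i + 1))) ∧
      m (f (i + 1)) x = r (f i) (x + k (f i) (f (i + 1))) := fun i => hk _ _ ⟨i, rfl, rfl⟩
  set K : ℕ → Fin 3 := fun i => ∑ j ∈ Finset.range i, k (f j) (f (j + 1)) with hK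
  have hK1 : ∀ i, K (i + 1) = K i + k (f i) (f (i + 1)) := fun i => Finset.sum_range_succ _ _
  have hKn : ∀ i, K (i + n) = K i + K n := by
    intro i
    induction i with
    | zero => simp [hK]
    | succ i ih =>
      rw [Nat.succ_add, Nat.succ_eq_add_one, hK1, ih, hK1, hf, Nat.add_right_comm, hf]
      abel
  obtain ⟨e, he⟩ := exists_nsmul_eq hn3 (K n)
  refine ⟨fun i => l (f i) (i • e - K i), fun i => ?_, fun i => ?_⟩
  · simp only [hf, hKn, add_nsmul, he]
    congr 1
    abel
  · have e1 : l (f (i + 1)) ((i + 1) • e - K (i + 1)) = m (f i) (i • e - K i + e) := by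
      rw [(hk' i _).1, hK1, add_nsmul, one_nsmul]
      congr 1
      abel
    have e2 : l (f (i + 2)) ((i + 2) • e - K (i + 2)) = r (f i) (i • e - K i + 2 • e) := by
      rw [(hk' (i + 1) _).1, hK1 (i + 1), (hk' i _).2, hK1, add_nsmul]
      congr 1
      abel
    simp only [e1, e2]
    rw [(hs i).2.2.2]
    refine (hs i).2.1.1.ne ?_
    have key : ∀ x e : Fin 3, shiftGuess x (x + 2 • e) ≠ x + e := by decide
    exact key _ _

end Walk

theorem cycleLosing_of_five_le {n : ℕ} (hn : 5 ≤ n) (hn3 : ¬ 3 ∣ n)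
    (f : ℕ → Fin 3 → Fin 3 → Fin 3) (hf : ∀ i, f (i + n) = f i) : CycleLosing n f := by
  by_contra hlose
  have hge : ∀ i a b, 2 ≤ rowHits (f (i + 1)) a b + colHits (f i) a b := by
    intro i a b
    by_contra! h
    exact hlose (CycleLosing.of_edge (by omega) hf i a b (Nat.le_of_lt_succ h))
  have hlink : ∀ i a b, rowHits (f (i + 1)) a b + colHits (f i) a b = 2 := by
    intro i a b
    have hr : ∀ a, rowHits (f (i + 1)) a 0 + rowHits (f (i + 1)) a 1 + rowHits (f (i + 1)) a 2 = 3 :=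
      fun a => hitCount_sum _
    have hc : ∀ b, colHits (f i) 0 b + colHits (f i) 1 b + colHits (f i) 2 b = 3 :=
      fun b => hitCount_sum _
    have hge := hge i
    have r0 := hr 0
    have r1 := hr 1
    have r2 := hr 2
    have c0 := hc 0
    have c1 := hc 1
    have c2 := hc 2
    have g00 := hge 0 0
    have g01 := hge 0 1
    have g02 := hge 0 2
    have g10 := hge 1 0
    have g11 := hge 1 1
    have g12 := hge 1 2
    have g20 := hge 2 0
    have g21 := hge 2 1
    have g22 := hge 2 2
    fin_cases a <;> fin_cases b <;> simp only [Fin.zero_eta, Fin.mk_one, Fin.reduceFinMk] <;> omega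
  have hf1 : ∀ i, ∃ j, f (j + 1) = f i := fun i => ⟨i + n - 1, by
    rw [← hf i]; congr 1; omega⟩
  have hbal : ∀ i, IsBalancedGuess (f (i + 1)) := by
    intro i
    refine ⟨fun b => ?_, fun a b => ?_, fun b c => ?_, fun a b c habc => ?_⟩
    · have hc : colHits (f i) 0 b + colHits (f i) 1 b + colHits (f i) 2 b = 3 := hitCount_sum _
      have h0 := hlink i 0 b
      have h1 := hlink i 1 b
      have h2 := hlink i 2 b
      omega
    · have := hlink i a b
      omega
    · have := hlink (i + 1) b c
      omega
    · by_contra! h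
      refine hlose (CycleLosing.of_path (by omega) hf i a b c habc ?_)
      have h1 := hlink i a b
      have h2 := hlink (i + 1) b c
      change rowHits (f (i + 2)) b c + colHits (f i) a b ≤ 1
      rw [add_assoc, show 1 + 1 = 2 from rfl] at h2
      omega
  have hclass := fun i => (hbal i).classification
  have hones : ∀ i, onesCount (rowHits (f (i + 1))) = onesCount (colHits (f i)) := by
    intro i
    have : ∀ a b, rowHits (f (i + 1)) a b = 1 ↔ colHits (f i) a b = 1 := by
      intro a b
      have := hlink i a b
      omega
    simp only [onesCount, this]
  have hconst : ∀ i, onesCount (rowHits (f (i + 1))) = onesCount (rowHits (f 1)) := by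
    intro i
    induction i with
    | zero => rfl
    | succ i ih => rw [hones, (hclass i).1, ih]
  rcases (hclass 0).2 with h | h | h
  · have h9 : ∀ i, onesCount (rowHits (f i)) = 9 := by
      intro i
      obtain ⟨j, hj⟩ := hf1 i
      rw [← hj, hconst]
      exact h
    have hinj : ∀ i a, Function.Injective (f i a) := fun i a =>
      injective_of_hitCount_eq_one _ (eq_one_of_onesCount_eq_nine (h9 i) a)
    have hinj' : ∀ i c, Function.Injective (fun a => f i a c) := fun i c =>
      injective_of_hitCount_eq_one _
        (fun b => eq_one_of_onesCount_eq_nine ((hones i).symm.trans (h9 (i + 1))) b c)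
    obtain ⟨k, rfl⟩ : ∃ k, n = k + 5 := ⟨n - 5, by omega⟩
    obtain ⟨x, y, hw⟩ := GuessWalk.exists_of_injective hinj k 0 0 0
    exact hlose ((hw.trans (guessWalk_five_of_injective hinj hinj' _ x y 0 0)).cycleLosing
      (by omega) hf)
  · have hp : ∀ i, ∃ β β' β'', IsPivotGuess (f i) β β' β'' := by
      intro i
      obtain ⟨j, hj⟩ := hf1 i
      rw [← hj]
      have h5 : onesCount (rowHits (f (j + 1))) = 5 := (hconst j).trans h.1
      rcases (hclass j).2 with h' | h' | h'
      · omega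
      · exact h'.2
      · omega
    have hp' : ∀ g : Fin 3 → Fin 3 → Fin 3, ∃ β β' β'' : Fin 3,
        (∃ i, f i = g) → IsPivotGuess g β β' β'' := by
      intro g
      by_cases hg : ∃ i, f i = g
      · obtain ⟨i, rfl⟩ := hg
        obtain ⟨β, β', β'', h⟩ := hp i
        exact ⟨β, β', β'', fun _ => h⟩
      · exact ⟨0, 0, 0, fun h => absurd h hg⟩
    choose β β' β'' hβ using hp'
    have hP : ∀ i, IsPivotGuess (f i) (β (f i)) (β' (f i)) (β'' (f i)) := fun i => hβ _ ⟨i, rfl⟩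
    have hnext : ∀ i, β (f (i + 1)) = β' (f i) ∧ β' (f (i + 1)) = β'' (f i) := by
      intro i
      have key : ∀ x y z w : Fin 3, (∀ a b, (a = x ∨ b = y) ↔ (a = z ∨ b = w)) →
        x = z ∧ y = w := by decide
      refine key _ _ _ _ fun a b => ?_
      rw [← (hP (i + 1)).2.2.1, ← (hP i).2.2.2]
      have := hlink i a b
      omega
    have e1 : ∀ i, β' (f i) = β (f (i + 1)) := fun i => (hnext i).1.symm
    have e2 : ∀ i, β'' (f i) = β (f (i + 2)) := fun i => by
      rw [← (hnext i).2, e1]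
    simp only [IsPivotGuess, e1, e2] at hP
    exact hlose (cycleLosing_of_pivot (β := fun i => β (f i)) hn hf (fun i => by simp only [hf])
      (fun i => (hP i).1) (fun i a ha => ((hP i).2.1 a ha).1) (fun i a ha => ((hP i).2.1 a ha).2))
  · refine hlose (cycleLosing_of_shiftGuess hn3 hf (fun i => ?_) hlink)
    obtain ⟨j, hj⟩ := hf1 i
    rw [← hj]
    have h3 : onesCount (rowHits (f (j + 1))) = 3 := (hconst j).trans h.1
    rcases (hclass j).2 with h' | h' | h'
    · omega
    · omega
    · exact h'.2

/-- The tables of a winning strategy on a cycle of length four. -/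
def fourCycleGuess : Fin 4 → Fin 3 → Fin 3 → Fin 3 :=
  ![![![2, 2, 0], ![0, 2, 1], ![1, 0, 1]], ![![0, 2, 1], ![1, 0, 1], ![2, 2, 0]],
    ![![2, 0, 1], ![0, 1, 1], ![2, 2, 0]], ![![1, 0, 2], ![0, 0, 1], ![2, 1, 2]]]

theorem exists_not_cycleLosing_four :
    ∃ T : ℕ → Fin 3 → Fin 3 → Fin 3, (∀ i, T (i + 4) = T i) ∧ ¬ CycleLosing 4 T := by
  refine ⟨fun i => fourCycleGuess (Fin.ofNat 4 (i + 1)), fun i => ?_, ?_⟩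
  · have : Fin.ofNat 4 (i + 4 + 1) = Fin.ofNat 4 (i + 1) := by
      apply Fin.ext
      simp only [Fin.ofNat]
      omega
    simp only [this]
  · rintro ⟨c, hc, h⟩
    have key : ∀ x y z w : Fin 3, fourCycleGuess 1 x z ≠ y → fourCycleGuess 2 y w ≠ z →
        fourCycleGuess 3 z x ≠ w → fourCycleGuess 0 w y ≠ x → False := by decide
    have h2 := h 2
    have h3 := h 3
    rw [show 2 + 2 = 0 + 4 from rfl, hc] at h2
    rw [show 3 + 2 = 1 + 4 from rfl, hc, show 3 + 1 = 0 + 4 from rfl, hc] at h3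
    exact key _ _ _ _ (h 0) (h 1) h2 h3

theorem Function.Periodic.nat_const {α : Type*} [PartialOrder α] {d : ℕ → α} {n : ℕ} (hn : 0 < n)
    (hd : ∀ i, d (i + n) = d i) (hanti : ∀ i, d (i + 1) ≤ d i) (i : ℕ) : d i = d 0 := by
  have ha : Antitone d := antitone_nat_of_succ_le hanti
  have hk : ∀ k, d (k * n) = d 0 := by
    intro k
    induction k with
    | zero => simp
    | succ k ih => rw [Nat.succ_mul, hd, ih]
  exact le_antisymm (ha (Nat.zero_le i)) ((hk i).symm.le.trans (ha (Nat.le_mul_of_pos_right i hn)))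

theorem exists_not_cycleLosing_of_three_dvd {n : ℕ} (hn : 0 < n) (h3 : 3 ∣ n) :
    ∃ T : ℕ → Fin 3 → Fin 3 → Fin 3, (∀ i, T (i + n) = T i) ∧ ¬ CycleLosing n T := by
  set o : ℕ → Fin 3 := fun i => (i / n) • (1 : Fin 3) with ho
  have hon : ∀ i, o (i + n) = o i + 1 := by
    intro i
    simp only [ho, Nat.add_div_right i hn, add_nsmul, one_nsmul]
  have hequiv : ∀ x z w : Fin 3, shiftGuess (x + 1) (z + 1) - (w + 1) = shiftGuess x z - w := by
    decide
  refine ⟨fun i a c => shiftGuess (a + o i) (c + o (i + 2)) - o (i + 1), fun i => ?_, ?_⟩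
  · funext a c
    simp only [Nat.add_right_comm i n, hon, ← add_assoc, hequiv]
  · rintro ⟨c, hc, h⟩
    set x : ℕ → Fin 3 := fun i => c i + o i with hx
    have hxn : ∀ i, x (i + n) = x i + 1 := by
      intro i
      simp only [hx, hc, hon]
      abel
    have hxs : ∀ i, shiftGuess (x i) (x (i + 2)) ≠ x (i + 1) := by
      intro i h'
      apply h i
      simp only [hx] at h'
      simp only [h']
      abel
    have key : ∀ x y z : Fin 3, shiftGuess x z ≠ y → z - y ≤ y - x := by decide
    have hconst := Function.Periodic.nat_const (d := fun i => x (i + 1) - x i) hn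
      (fun i => by
        simp only [Nat.add_right_comm i n 1, hxn]
        abel)
      (fun i => key _ _ _ (hxs i))
    have hsum : ∀ i, x i = x 0 + i • (x 1 - x 0) := by
      intro i
      induction i with
      | zero => simp
      | succ i ih =>
        rw [← sub_add_cancel (x (i + 1)) (x i), hconst i, ih, add_nsmul, one_nsmul]
        simp only [zero_add]
        abel
    have h3' : ∀ e : Fin 3, 3 • e = 0 := by decide
    have h0 := hxn 0
    rw [zero_add, hsum n] at h0
    obtain ⟨k, rfl⟩ := h3
    rw [mul_comm, mul_nsmul, h3'] at h0
    simp at h0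

section Cycles

variable {V : Type*} {G : SimpleGraph V}

/-- `u` runs through the vertices of a cycle of length `n`. -/
structure SimpleGraph.IsCycleMap (G : SimpleGraph V) (n : ℕ) (u : ℕ → V) : Prop where
  three_le : 3 ≤ n
  periodic : ∀ i, u (i + n) = u i
  adj : ∀ i, G.Adj (u i) (u (i + 1))
  mod_eq : ∀ i j, u i = u j → i % n = j % n

theorem SimpleGraph.Walk.IsCycle.isCycleMap {v : V} {c : G.Walk v v} (hc : c.IsCycle) :
    G.IsCycleMap c.length (fun i => c.getVert (i % c.length)) := by
  have h3 := hc.three_le_length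
  refine ⟨h3, fun i => by simp, fun i => ?_, fun i j h => ?_⟩
  · have hi := Nat.mod_lt i (by omega : 0 < c.length)
    have := c.adj_getVert_succ hi
    convert this using 1
    rw [Nat.add_mod_eq_add_mod_right (c := 1) (Nat.mod_mod i c.length).symm]
    rcases (show i % c.length + 1 < c.length ∨ i % c.length + 1 = c.length by omega) with h | h
    · rw [Nat.mod_eq_of_lt h]
    · rw [h, Nat.mod_self]; simp
  · refine hc.getVert_injOn' ?_ ?_ h
    · have := Nat.mod_lt i (by omega : 0 < c.length)
      simp only [Set.mem_ofPred_eq]; omega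
    · have := Nat.mod_lt j (by omega : 0 < c.length)
      simp only [Set.mem_ofPred_eq]; omega

theorem SimpleGraph.Walk.IsCycle.exists_getVert_eq {v : V} {c : G.Walk v v} (hc : c.IsCycle) (w : V) :
    w ∈ c.support ↔ ∃ i < c.length, c.getVert (i % c.length) = w := by
  have h3 := hc.three_le_length
  rw [SimpleGraph.Walk.mem_support_iff_exists_getVert]
  constructor
  · rintro ⟨i, rfl, hi⟩
    rcases hi.lt_or_eq with h | rfl
    · exact ⟨i, h, by rw [Nat.mod_eq_of_lt h]⟩
    · exact ⟨0, by omega, by simp⟩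
  · rintro ⟨i, hi, rfl⟩
    exact ⟨_, rfl, (Nat.mod_le _ _).trans hi.le⟩

namespace SimpleGraph.IsCycleMap

variable {n : ℕ} {u : ℕ → V}

theorem map_eq {α : Type*} (hu : G.IsCycleMap n u) {p : ℕ → α} (hp : ∀ i, p (i + n) = p i)
    {i j : ℕ} (h : u i = u j) : p i = p j := by
  have hmod : ∀ k, p (k % n) = p k := Function.Periodic.map_mod_nat hp
  rw [← hmod i, ← hmod j, hu.mod_eq i j h]

theorem map_add_eq (hu : G.IsCycleMap n u) (k : ℕ) {i j : ℕ} (h : u (i + 1) = u (j + 1)) :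
    u (i + k) = u (j + k) := by
  have h1 : u (i + 1 + (n - 1 + k)) = u (j + 1 + (n - 1 + k)) :=
    hu.map_eq (p := fun i => u (i + (n - 1 + k))) (fun i => by
      rw [Nat.add_right_comm, hu.periodic]) h
  have h3 := hu.three_le
  rwa [show i + 1 + (n - 1 + k) = i + k + n by omega, show j + 1 + (n - 1 + k) = j + k + n by omega,
    hu.periodic, hu.periodic] at h1

/-- If some strategy wins on a cycle, the game on any graph containing the cycle is winning. -/
theorem winning (hu : G.IsCycleMap n u) {T : ℕ → Fin 3 → Fin 3 → Fin 3}
    (hT : ∀ i, T (i + n) = T i) (h : ¬ CycleLosing n T) : HatGame.Winning G (fun _ => 3) := by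
  classical
  refine ⟨fun v c => if h : ∃ i, u (i + 1) = v then
    T h.choose (c (u h.choose)) (c (u (h.choose + 2))) else (0 : Fin 3), ?_, fun c => ?_⟩
  · intro v c c' hcc
    by_cases hv : ∃ i, u (i + 1) = v
    · have hs := hv.choose_spec
      simp only [dif_pos hv]
      rw [hcc, hcc]
      · conv_lhs => rw [← hs]
        exact hu.adj _
      · conv_lhs => rw [← hs]
        exact (hu.adj _).symm
    · simp only [dif_neg hv]
  · by_contra! hc
    refine h ⟨fun i => c (u i), fun i => congrArg (show V → Fin 3 from c) (hu.periodic i), fun i => ?_⟩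
    have hv : ∃ j, u (j + 1) = u (i + 1) := ⟨i, rfl⟩
    have := hc (u (i + 1))
    rw [dif_pos hv] at this
    have h0 := hu.map_add_eq 0 hv.choose_spec
    have h2 := hu.map_add_eq 2 hv.choose_spec
    simp only [add_zero] at h0
    rwa [hu.map_eq hT h0, h0, h2] at this

/-- The game on a graph which is a cycle is losing if every strategy on the cycle loses. -/
theorem not_winning (hu : G.IsCycleMap n u) (hsurj : ∀ v, ∃ i, u i = v)
    (hnbr : ∀ i v, G.Adj (u (i + 1)) v → v = u i ∨ v = u (i + 2))
    (h : ∀ T : ℕ → Fin 3 → Fin 3 → Fin 3, (∀ i, T (i + n) = T i) → CycleLosing n T) :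
    ¬ HatGame.Winning G (fun _ => 3) := by
  classical
  rintro ⟨s, hs, hwin⟩
  obtain ⟨c, hc, hlose⟩ := h (fun i a b => s (u (i + 1)) (fun v => if v = u i then a else b)) (by
    intro i
    funext a b
    rw [Nat.add_right_comm, hu.periodic, hu.periodic])
  choose idx hidx using hsurj
  have hci : ∀ i, c (idx (u i)) = c i := fun i => hu.map_eq hc (hidx _)
  obtain ⟨v, hv⟩ := hwin (fun v => c (idx v))
  obtain ⟨j, rfl⟩ : ∃ j, u (j + 1) = v := ⟨idx v + n - 1, by
    have := hu.three_le
    rw [Nat.sub_add_cancel (by omega), hu.periodic, hidx]⟩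
  refine hlose j ?_
  rw [hci] at hv
  rw [← hv]
  refine hs _ _ _ fun w hw => ?_
  by_cases hw' : w = u j
  · simp [hw', hci]
  · have := (hnbr j w hw).resolve_left hw'
    rw [if_neg hw', this, hci]

end SimpleGraph.IsCycleMap

theorem SimpleGraph.HasGoodCycle.winning (h : G.HasGoodCycle) :
    HatGame.Winning G (fun _ => 3) := by
  obtain ⟨v, c, hc, h | h⟩ := h
  · obtain ⟨T, hT, hT'⟩ := exists_not_cycleLosing_four
    have hu := hc.isCycleMap
    rw [h] at hu
    exact hu.winning hT hT'
  · have hu := hc.isCycleMap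
    obtain ⟨T, hT, hT'⟩ := exists_not_cycleLosing_of_three_dvd (by have := hu.three_le; omega) h
    exact hu.winning hT hT'

end Cycles

section Informs

variable {V : Type*} {G : SimpleGraph V}

/-- Whatever Boolean function `β` of its own color the vertex `v` wants to know, the vertices of `S`
have a strategy such that `v` learns this bit from its neighbors in `S` if `S` guesses wrong. -/
def SimpleGraph.Informs (G : SimpleGraph V) (S : Set V) (v : V) : Prop :=
  v ∉ S ∧ ∀ β : Fin 3 → Bool, ∃ (s : V → (V → Fin 3) → Fin 3) (g : (V → Fin 3) → Bool),
    (∀ w ∈ S, ∀ c c' : V → Fin 3, (∀ x, G.Adj w x → c x = c' x) → s w c = s w c') ∧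
    (∀ c c' : V → Fin 3, (∀ x, G.Adj v x → c x = c' x) → g c = g c') ∧
    ∀ c : V → Fin 3, (∀ w ∈ S, s w c ≠ c w) → g c = β (c v)

theorem SimpleGraph.Informs.insert {S : Set V} {v w : V} (h : G.Informs S v) (hvw : G.Adj v w)
    (hw : w ∉ S) : G.Informs (insert v S) w := by
  classical
  refine ⟨fun hw' => hw'.elim hvw.ne' hw, fun γ => ?_⟩
  obtain ⟨s, g, hs, hg, hsg⟩ := h.2 (fun x => decide (x = 0))
  refine ⟨fun x c => if x = v then (if g c then 0 else if γ (c w) then 1 else 2) else s x c,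
    fun c => decide (c v = 2), ?_, ?_, ?_⟩
  · intro x hx c c' hcc
    by_cases hxv : x = v
    · subst hxv
      simp only [if_true, hg c c' hcc, hcc w hvw]
    · simp only [if_neg hxv]
      exact hs x (hx.resolve_left hxv) c c' hcc
  · intro c c' hcc
    simp only [hcc v hvw.symm]
  · intro c hc
    have h1 := hsg c fun x hx => by
      have hxv : x ≠ v := fun h' => h.1 (h' ▸ hx)
      have := hc x (Or.inr hx)
      beta_reduce at this
      rwa [if_neg hxv] at this
    have h2 := hc v (Or.inl rfl)
    beta_reduce at h2 ⊢
    rw [if_pos rfl, h1] at h2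
    have key : ∀ (b : Bool) (y : Fin 3), (if decide (y = 0) = true then 0 else
      if b = true then 1 else 2) ≠ y → decide (y = 2) = b := by decide
    exact key _ _ h2

theorem SimpleGraph.Informs.winning {S T : Set V} {v : V} (hS : G.Informs S v)
    (hT : G.Informs T v) (hST : Disjoint S T) : HatGame.Winning G (fun _ => 3) := by
  classical
  obtain ⟨s, g, hs, hg, hsg⟩ := hS.2 (fun x => decide (x = 0))
  obtain ⟨t, k, ht, hk, htk⟩ := hT.2 (fun x => decide (x = 1))
  refine ⟨fun x c => if x ∈ S then s x c else if x ∈ T then t x c else if x = v then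
    (if g c then (0 : Fin 3) else if k c then (1 : Fin 3) else (2 : Fin 3)) else (0 : Fin 3), ?_, ?_⟩
  · intro x c c' hcc
    by_cases hxS : x ∈ S
    · simp only [if_pos hxS]
      exact hs x hxS c c' hcc
    by_cases hxT : x ∈ T
    · simp only [if_pos hxT, if_neg hxS]
      exact ht x hxT c c' hcc
    by_cases hxv : x = v
    · subst hxv
      simp only [if_neg hxS, if_neg hxT, hg c c' hcc, hk c c' hcc]
    · simp only [if_neg hxS, if_neg hxT, if_neg hxv]
  · intro c
    by_contra! hc
    have h1 := hsg c fun x hx => by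
      have := hc x
      rwa [if_pos hx] at this
    have h2 := htk c fun x hx => by
      have := hc x
      rwa [if_neg (fun h' => Set.disjoint_left.1 hST h' hx), if_pos hx] at this
    have h3 := hc v
    rw [if_neg hS.1, if_neg hT.1, if_pos rfl, h1, h2] at h3
    have key : ∀ y : Fin 3, (if decide (y = 0) = true then (0 : Fin 3) else
      if decide (y = 1) = true then (1 : Fin 3) else (2 : Fin 3)) = y := by decide
    exact h3 (key _)

/-- The guess of an inner vertex of a path hanging off a vertex that wants to learn a bit. -/
def relayGuess (x z : Fin 3) : Fin 3 :=
  if x = 1 then (if z = 0 then 1 else 2) else 0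

theorem relay_first : ∀ y z : Fin 3, (if z = 0 then 1 else 2) ≠ y → y ≠ 0 →
    y = 2 ∧ z = 0 ∨ y = 1 ∧ z ≠ 0 := by decide

theorem relay_step : ∀ x y z : Fin 3, (x = 2 ∧ y = 0 ∨ x = 1 ∧ y ≠ 0) → relayGuess x z ≠ y →
    (y = 2 ∧ z = 0 ∨ y = 1 ∧ z ≠ 0) := by decide

theorem relay_last : ∀ x y : Fin 3, (x = 2 ∧ y = 0 ∨ x = 1 ∧ y ≠ 0) →
    (if x = 1 then 1 else 0) ≠ y → y = 2 := by decide

theorem SimpleGraph.IsCycleMap.informs {n : ℕ} {u : ℕ → V} (hu : G.IsCycleMap n u) :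
    G.Informs {v | ∃ i, 0 < i ∧ i < n ∧ u i = v} (u 0) := by
  classical
  have h3 := hu.three_le
  have hinj : ∀ i j, i < n → j < n → u i = u j → i = j := by
    intro i j hi hj h
    have := hu.mod_eq i j h
    rwa [Nat.mod_eq_of_lt hi, Nat.mod_eq_of_lt hj] at this
  refine ⟨?_, fun β => ?_⟩
  · rintro ⟨i, h0, hi, h⟩
    exact h0.ne' (hinj _ _ hi (by omega) h)
  let T : ℕ → (V → Fin 3) → Fin 3 := fun i c =>
    if i = 1 then (if β (c (u 0)) then (if c (u 2) = 0 then 1 else 2) else 0)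
    else if i = n - 1 then (if β (c (u 0)) then (if c (u (n - 2)) = 1 then 1 else 0) else 2)
    else relayGuess (c (u (i - 1))) (c (u (i + 1)))
  have hun : u n = u 0 := by simpa using hu.periodic 0
  refine ⟨fun v c => if h : ∃ i, 0 < i ∧ i < n ∧ u i = v then T h.choose c else 0,
    fun c => decide (c (u 1) = 0 ∨ c (u (n - 1)) = 2), ?_, ?_, ?_⟩
  · intro v hv c c' hcc
    have hv' : ∃ i, 0 < i ∧ i < n ∧ u i = v := hv
    obtain ⟨h0, hn, hs⟩ := hv'.choose_spec
    simp only [dif_pos hv']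
    generalize hv'.choose = i at *
    subst hs
    obtain ⟨k, rfl⟩ : ∃ k, i = k + 1 := ⟨i - 1, by omega⟩
    have e1 : c (u k) = c' (u k) := hcc _ (hu.adj k).symm
    have e2 : c (u (k + 2)) = c' (u (k + 2)) := hcc _ (hu.adj (k + 1))
    simp only [T]
    by_cases hk : k = 0
    · subst hk
      simp only [zero_add, if_true, e1, e2]
    by_cases hk' : k + 1 = n - 1
    · obtain rfl : n = k + 2 := by omega
      rw [hun] at e2
      simp only [if_neg (show k + 1 ≠ 1 by omega), if_pos hk', Nat.add_sub_cancel, e1, e2]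
    · simp only [if_neg (show k + 1 ≠ 1 by omega), if_neg hk', Nat.add_sub_cancel, e1, e2]
  · intro c c' hcc
    have e1 : c (u 1) = c' (u 1) := hcc _ (hu.adj 0)
    have e2 : c (u (n - 1)) = c' (u (n - 1)) := hcc _ (by
      have := (hu.adj (n - 1)).symm
      rwa [Nat.sub_add_cancel (by omega), hun] at this)
    simp only [e1, e2]
  · intro c hc
    have hw : ∀ i, 0 < i → i < n → T i c ≠ c (u i) := by
      intro i h0 hi
      have hv : ∃ j, 0 < j ∧ j < n ∧ u j = u i := ⟨i, h0, hi, rfl⟩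
      have := hc (u i) hv
      beta_reduce at this
      rw [dif_pos hv] at this
      rwa [hinj _ _ hv.choose_spec.2.1 hi hv.choose_spec.2.2] at this
    have hfirst := hw 1 (by omega) (by omega)
    have hlast := hw (n - 1) (by omega) (by omega)
    simp only [T, if_true, if_neg (show n - 1 ≠ 1 by omega)] at hfirst hlast
    by_cases hb : β (c (u 0)) = true
    · rw [if_pos hb] at hfirst hlast
      rw [hb, decide_eq_true_eq, or_iff_not_imp_left]
      intro h1
      have hinv : ∀ i, i + 2 < n → c (u (i + 1)) = 2 ∧ c (u (i + 2)) = 0 ∨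
          c (u (i + 1)) = 1 ∧ c (u (i + 2)) ≠ 0 := by
        intro i
        induction i with
        | zero => exact fun _ => relay_first _ _ hfirst h1
        | succ i ih =>
          intro hi
          have := hw (i + 2) (by omega) (by omega)
          simp only [T, if_neg (show i + 2 ≠ 1 by omega), if_neg (show i + 2 ≠ n - 1 by omega)]
            at this
          exact relay_step _ _ _ (ih (by omega)) this
      obtain ⟨m, rfl⟩ : ∃ m, n = m + 3 := ⟨n - 3, by omega⟩
      exact relay_last _ _ (hinv m (by omega)) hlast
    · rw [if_neg hb] at hfirst hlast
      rw [Bool.eq_false_of_not_eq_true hb, decide_eq_false_iff_not, not_or]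
      exact ⟨hfirst.symm, hlast.symm⟩

theorem SimpleGraph.Walk.IsCycle.informs {v : V} {c : G.Walk v v} (hc : c.IsCycle) :
    G.Informs ({x | x ∈ c.support} \ {v}) v := by
  have hu := hc.isCycleMap
  have h3 := hu.three_le
  have h := hu.informs
  simp only [Nat.zero_mod, SimpleGraph.Walk.getVert_zero] at h
  convert h using 1
  ext x
  rw [Set.mem_sdiff, Set.mem_ofPred_eq, hc.exists_getVert_eq, Set.mem_ofPred_eq,
    Set.mem_singleton_iff]
  constructor
  · rintro ⟨⟨i, hi, rfl⟩, hne⟩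
    refine ⟨i, Nat.pos_of_ne_zero ?_, hi, rfl⟩
    rintro rfl
    simp at hne
  · rintro ⟨i, h0, hi, rfl⟩
    refine ⟨⟨i, hi, rfl⟩, fun h' => ?_⟩
    have := hu.mod_eq i 0 (by simpa using h')
    rw [Nat.mod_eq_of_lt hi, Nat.zero_mod] at this
    omega

theorem SimpleGraph.Walk.IsCycle.informs_of_mem [DecidableEq V] {v w : V} {c : G.Walk v v}
    (hc : c.IsCycle) (hw : w ∈ c.support) : G.Informs ({x | x ∈ c.support} \ {w}) w := by
  simpa only [SimpleGraph.Walk.mem_support_rotate_iff] using (hc.rotate hw).informs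

theorem SimpleGraph.Informs.path {A : Set V} {a b : V} {p : G.Walk a b} (hp : p.IsPath)
    (hA : ∀ i ≤ p.length, 0 < i → p.getVert i ∉ A) (h : G.Informs (A \ {a}) a) :
    ∀ k ≤ p.length, G.Informs (A \ {a} ∪ {x | ∃ i < k, p.getVert i = x}) (p.getVert k) := by
  intro k
  induction k with
  | zero => exact fun _ => by simpa using h
  | succ k ih =>
    intro hk
    have := (ih (by omega)).insert (p.adj_getVert_succ (by omega)) (w := p.getVert (k + 1)) (by
      rintro (h' | ⟨i, hi, h'⟩)
      · exact hA _ hk (by omega) h'.1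
      · have := hp.getVert_injOn (by simp only [Set.mem_ofPred_eq]; omega)
          (by simp only [Set.mem_ofPred_eq]; omega) h'
        omega)
    convert this using 1
    ext x
    simp only [Set.mem_union, Set.mem_insert_iff, Set.mem_ofPred_eq, Nat.lt_succ_iff_lt_or_eq,
      or_and_right, exists_or, exists_eq_left, eq_comm (a := p.getVert k)]
    rw [← or_assoc, or_comm]

/-- Two cycles in a connected graph that share at most one vertex make the game winning. -/
theorem SimpleGraph.Connected.winning_of_isCycle (hG : G.Connected) {v w : V} {c : G.Walk v v}
    {d : G.Walk w w} (hc : c.IsCycle) (hd : d.IsCycle)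
    (h : ({x | x ∈ c.support} ∩ {x | x ∈ d.support} : Set V).Subsingleton) :
    HatGame.Winning G (fun _ => 3) := by
  classical
  have hex : ∃ k a b, a ∈ c.support ∧ b ∈ d.support ∧ ∃ p : G.Walk a b, p.length = k :=
    ⟨_, v, w, c.start_mem_support, d.start_mem_support, (hG.preconnected v w).some, rfl⟩
  have hmin := fun k => Nat.find_min' hex (m := k)
  obtain ⟨a, b, ha, hb, p₀, hp₀⟩ := Nat.find_spec hex
  rw [← hp₀] at hmin
  have hmin' : ∀ {x y : V} (q : G.Walk x y), x ∈ c.support → y ∈ d.support →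
      p₀.bypass.length ≤ q.length := fun q hx hy =>
    (SimpleGraph.Walk.length_bypass_le_length p₀).trans (hmin _ ⟨_, _, hx, hy, q, rfl⟩)
  have hp := SimpleGraph.Walk.bypass_isPath p₀
  generalize p₀.bypass = p at hp hmin'
  have h1 := SimpleGraph.Informs.path hp (A := {x | x ∈ c.support}) (fun i hi h0 hx => by
    have := hmin' (p.drop i) hx hb
    simp only [SimpleGraph.Walk.drop_length] at this
    omega) (hc.informs_of_mem ha) p.length le_rfl
  rw [SimpleGraph.Walk.getVert_length] at h1
  refine h1.winning (hd.informs_of_mem hb) (Set.disjoint_left.2 ?_)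
  rintro x (hx | ⟨i, hi, rfl⟩) ⟨hxd, hxb⟩
  · have h0 := hmin' (SimpleGraph.Walk.nil : G.Walk x x) hx.1 hxd
    have hab : a = b := SimpleGraph.Walk.eq_of_length_eq_zero (Nat.le_zero.1 h0)
    subst hab
    exact hxb (h ⟨hx.1, hxd⟩ ⟨ha, hb⟩)
  · have := hmin' (p.take i) ha hxd
    simp only [SimpleGraph.Walk.take_length] at this
    omega

end Informs

section Losing

theorem HatGame.Winning.const_three_of_le {V : Type*} {G : SimpleGraph V} {q : ℕ} (hq : 3 ≤ q)
    (h : HatGame.Winning G (fun _ => q)) : HatGame.Winning G (fun _ => 3) := by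
  obtain ⟨s, hs, hw⟩ := h
  refine ⟨fun v c => if h : (s v (fun u => Fin.castLE hq (c u))).val < 3 then ⟨_, h⟩ else 0,
    ?_, ?_⟩
  · intro v c c' hcc
    simp only [hs v (fun u => Fin.castLE hq (c u)) (fun u => Fin.castLE hq (c' u))
      fun u hu => by rw [hcc u hu]]
  · intro c
    obtain ⟨v, hv⟩ := hw (fun u => Fin.castLE hq (c u))
    have hlt : (s v (fun u => Fin.castLE hq (c u))).val < 3 := hv ▸ (c v).isLt
    refine ⟨v, ?_⟩
    simp only [dif_pos hlt]
    apply Fin.ext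
    simp [hv]

theorem SimpleGraph.Adj.winning_two {V : Type*} {G : SimpleGraph V} {a b : V} (hab : G.Adj a b) :
    HatGame.Winning G (fun _ => 2) := by
  classical
  refine ⟨fun v c => if v = a then (c b : Fin 2) else if v = b then (c a + 1 : Fin 2) else
    (0 : Fin 2), ?_, ?_⟩
  · intro v c c' hcc
    by_cases hva : v = a
    · subst hva
      simp only [if_true, hcc b hab]
    by_cases hvb : v = b
    · subst hvb
      simp only [if_true, if_neg hva, hcc a hab.symm]
    · simp only [if_neg hva, if_neg hvb]
  · intro c
    have key : ∀ x y : Fin 2, y = x ∨ x + 1 = y := by decide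
    rcases key (c a) (c b) with h | h
    · exact ⟨a, by simpa using h⟩
    · exact ⟨b, by simpa [hab.ne'] using h⟩

theorem HatGame.Winning.exists_adj {V : Type*} {G : SimpleGraph V} {q : ℕ} (hq : 2 ≤ q)
    (h : HatGame.Winning G (fun _ => q)) : ∃ v w, G.Adj v w := by
  obtain ⟨s, hs, hw⟩ := h
  by_contra! hG
  have : Nontrivial (Fin q) := Fin.nontrivial_iff_two_le.2 hq
  choose f hf using fun x : Fin q => exists_ne x
  let c₀ : V → Fin q := fun _ => ⟨0, by omega⟩
  obtain ⟨v, hv⟩ := hw (fun v => f (s v c₀))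
  rw [hs v _ c₀ fun u hu => absurd hu (hG v u)] at hv
  exact hf _ hv.symm

theorem HatGame.number_eq_two_iff {V : Type*} {G : SimpleGraph V} :
    HatGame.number G = 2 ↔
      (∃ v w, G.Adj v w) ∧ ¬ HatGame.Winning G (fun _ => 3) := by
  constructor
  · intro h
    have hne : {q : ℕ | HatGame.Winning G (fun _ => q)}.Nonempty := by
      by_contra hne
      rw [Set.not_nonempty_iff_eq_empty] at hne
      rw [HatGame.number, hne, csSup_empty] at h
      simp at h
    have hbdd : BddAbove {q : ℕ | HatGame.Winning G (fun _ => q)} := by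
      by_contra hbdd
      rw [HatGame.number, Nat.sSup_of_not_bddAbove hbdd] at h
      omega
    have h2 := Nat.sSup_mem hne hbdd
    change HatGame.Winning G (fun _ => HatGame.number G) at h2
    rw [h] at h2
    refine ⟨h2.exists_adj le_rfl, fun h3 => ?_⟩
    have := le_csSup hbdd h3
    change 3 ≤ HatGame.number G at this
    omega
  · rintro ⟨⟨v, w, hvw⟩, h3⟩
    refine IsGreatest.csSup_eq ⟨hvw.winning_two, fun q hq => ?_⟩
    by_contra! hlt
    exact h3 (HatGame.Winning.const_three_of_le hlt hq)

theorem HatGame.Winning.induce_compl_singleton {V : Type*} {G : SimpleGraph V} {l u : V}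
    (hlu : ∀ v, G.Adj l v ↔ v = u) (h : HatGame.Winning G (fun _ => 3)) :
    HatGame.Winning (G.induce {l}ᶜ) (fun _ => 3) := by
  classical
  have hul : u ≠ l := ((hlu u).2 rfl).ne'
  obtain ⟨s, hs, hw⟩ := h
  let e : (({l}ᶜ : Set V) → Fin 3) → Fin 3 → V → Fin 3 := fun c y v =>
    if hv : v ∈ ({l}ᶜ : Set V) then c ⟨v, hv⟩ else y
  have hel : ∀ c y, e c y l = y := fun c y => dif_neg (by simp)
  have hev : ∀ c y (v : ({l}ᶜ : Set V)), e c y v = c v := fun c y v => dif_pos v.2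
  let f : Fin 3 → Fin 3 := fun x => s l (fun _ => x)
  have hf : ∀ c y, s l (e c y) = f (c ⟨u, hul⟩) := fun c y => hs l _ _ fun v hv => by
    obtain rfl := (hlu v).1 hv
    exact hev c y ⟨v, hul⟩
  have hcongr : ∀ (v : ({l}ᶜ : Set V)) (c c' : ({l}ᶜ : Set V) → Fin 3) (y : Fin 3),
      (∀ x, (G.induce {l}ᶜ).Adj v x → c x = c' x) → s v (e c y) = s v (e c' y) := by
    intro v c c' y hcc
    refine hs v _ _ fun x hx => ?_
    by_cases hxl : x = l
    · rw [hxl, hel, hel]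
    · exact ((hev c y ⟨x, hxl⟩).trans (hcc ⟨x, hxl⟩ hx)).trans (hev c' y ⟨x, hxl⟩).symm
  refine ⟨fun v c => if (v : V) = u then
      (if hx : ∃ x : Fin 3, ∀ y ≠ f x, s u (e c y) = x then hx.choose else 0)
    else s v (e c 0), ?_, ?_⟩
  · intro v c c' hcc
    by_cases hv : (v : V) = u
    · subst hv
      simp only [if_true, fun y => hcongr v c c' y hcc]
    · simp only [if_neg hv, hcongr v c c' 0 hcc]
  · intro c
    by_contra! hc
    have hu : ∃ y, y ≠ f (c ⟨u, hul⟩) ∧ s u (e c y) ≠ c ⟨u, hul⟩ := by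
      by_contra! hall
      have hx : ∃ x : Fin 3, ∀ y ≠ f x, s u (e c y) = x := ⟨_, hall⟩
      have := hc ⟨u, hul⟩
      beta_reduce at this
      rw [if_pos rfl, dif_pos hx] at this
      have key : ∀ a b : Fin 3, ∃ y, y ≠ a ∧ y ≠ b := by decide
      obtain ⟨y, h1, h2⟩ := key (f hx.choose) (f (c ⟨u, hul⟩))
      exact this ((hx.choose_spec y h1).symm.trans (hall y h2))
    obtain ⟨y, hy, hsu⟩ := hu
    obtain ⟨v, hv⟩ := hw (e c y)
    by_cases hvl : v = l
    · subst hvl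
      rw [hf, hel] at hv
      exact hy hv.symm
    by_cases hvu : v = u
    · subst hvu
      exact hsu (hv.trans (hev c y ⟨v, hul⟩))
    · have := hc ⟨v, hvl⟩
      beta_reduce at this
      rw [if_neg hvu] at this
      apply this
      rw [← hev c y ⟨v, hvl⟩, ← hv]
      refine hs v _ _ fun x hx => ?_
      have hxl : x ≠ l := fun h' => hvu ((hlu v).1 (h' ▸ hx.symm))
      exact (hev c 0 ⟨x, hxl⟩).trans (hev c y ⟨x, hxl⟩).symm

end Losing

section Pseudotree

variable {V : Type*} {G : SimpleGraph V}

theorem SimpleGraph.HasGoodCycle.of_induce {S : Set V} (h : (G.induce S).HasGoodCycle) :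
    G.HasGoodCycle := by
  obtain ⟨v, c, hc, hlen⟩ := h
  let f := SimpleGraph.Embedding.induce (G := G) S
  exact ⟨_, c.map f.toHom, hc.map f.injective, by rwa [SimpleGraph.Walk.length_map]⟩

theorem SimpleGraph.IsPseudotree.induce {S : Set V} (hG : G.IsPseudotree)
    (hS : (G.induce S).Connected) : (G.induce S).IsPseudotree := by
  refine ⟨hS, fun v w c d hc hd => ?_⟩
  let f := SimpleGraph.Embedding.induce (G := G) S
  have h := hG.2 _ _ _ _ (hc.map (f := f.toHom) f.injective) (hd.map (f := f.toHom) f.injective)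
  ext e
  have he := Set.ext_iff.1 h (Sym2.map f e)
  have hinj := Sym2.map.injective f.injective
  simp only [SimpleGraph.Walk.edges_map, Set.mem_ofPred_eq] at he ⊢
  exact (List.mem_map_of_injective hinj).symm.trans (he.trans (List.mem_map_of_injective hinj))

theorem SimpleGraph.IsPseudotree.card_edgeFinset [Fintype V] [DecidableEq V]
    [DecidableRel G.Adj] (hG : G.IsPseudotree) {v : V} {c : G.Walk v v} (hc : c.IsCycle) :
    G.edgeFinset.card = Fintype.card V := by
  obtain ⟨e, he⟩ : ∃ e, e ∈ c.edges := List.exists_mem_of_ne_nil _ fun h => by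
    have h3 := hc.three_le_length
    rw [← SimpleGraph.Walk.length_edges, h] at h3
    simp at h3
  have heG := c.edges_subset_edgeSet he
  induction e with | _ x y
  have hbridge : ¬ G.IsBridge s(x, y) := fun hb =>
    (SimpleGraph.isBridge_iff_forall_cycle_notMem heG).1 hb c hc he
  have hT : (G.deleteEdges {s(x, y)}).IsTree := by
    refine ⟨hG.1.connected_delete_edge_of_not_isBridge hbridge, fun w p hp => ?_⟩
    have hle := G.deleteEdges_le {s(x, y)}
    have h := hG.2 _ _ _ _ hc (hp.mapLe hle)
    have hmem := (Set.ext_iff.1 h s(x, y)).1 he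
    simp only [SimpleGraph.Walk.edges_mapLe_eq_edges, Set.mem_ofPred_eq] at hmem
    have := p.edges_subset_edgeSet hmem
    rw [SimpleGraph.edgeSet_deleteEdges] at this
    exact this.2 rfl
  have hcard := hT.card_edgeFinset
  have herase : (G.deleteEdges {s(x, y)}).edgeFinset = G.edgeFinset.erase s(x, y) := by
    ext e
    simp [SimpleGraph.edgeSet_deleteEdges, and_comm]
  rw [herase, Finset.card_erase_add_one (SimpleGraph.mem_edgeFinset.2 heG)] at hcard
  exact hcard

theorem SimpleGraph.IsCycleMap.eq_or_eq_of_degree_eq_two [Fintype V] [DecidableRel G.Adj] {n : ℕ}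
    {u : ℕ → V} (hu : G.IsCycleMap n u) {i : ℕ} (hdeg : G.degree (u (i + 1)) = 2) {v : V}
    (hv : G.Adj (u (i + 1)) v) : v = u i ∨ v = u (i + 2) := by
  classical
  have hne : u i ≠ u (i + 2) := fun h => by
    have h1 : i ≡ i + 2 [MOD n] := hu.mod_eq _ _ h
    have h2 := (Nat.modEq_iff_dvd' (by omega)).1 h1
    have h3 := hu.three_le
    rw [Nat.add_sub_cancel_left] at h2
    exact absurd (Nat.le_of_dvd (by omega) h2) (by omega)
  have hsub : {u i, u (i + 2)} ⊆ G.neighborFinset (u (i + 1)) := by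
    intro x hx
    rw [Finset.mem_insert, Finset.mem_singleton] at hx
    rw [SimpleGraph.mem_neighborFinset]
    rcases hx with rfl | rfl
    · exact (hu.adj i).symm
    · exact hu.adj (i + 1)
  have heq := Finset.eq_of_subset_of_card_le hsub (by
    rw [SimpleGraph.card_neighborFinset_eq_degree, hdeg, Finset.card_pair hne])
  rw [← SimpleGraph.mem_neighborFinset, ← heq, Finset.mem_insert, Finset.mem_singleton] at hv
  exact hv

theorem SimpleGraph.IsCycleMap.surjective {n : ℕ} {u : ℕ → V} (hu : G.IsCycleMap n u)
    (hG : G.Connected)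
    (hnbr : ∀ i v, G.Adj (u (i + 1)) v → v = u i ∨ v = u (i + 2)) (v : V) : ∃ i, u i = v := by
  obtain ⟨p⟩ := hG.preconnected v (u 0)
  generalize hw : u 0 = w at p
  induction p with
  | nil => exact ⟨0, hw⟩
  | cons h p ih =>
    obtain ⟨i, rfl⟩ := ih hw
    have h3 := hu.three_le
    have hi : u (i + n - 1 + 1) = u i := by
      rw [Nat.sub_add_cancel (by omega), hu.periodic]
    rcases hnbr (i + n - 1) _ (hi ▸ h.symm) with h | h
    · exact ⟨_, h.symm⟩
    · exact ⟨_, h.symm⟩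

theorem SimpleGraph.IsPseudotree.not_winning_of_degree_ne_one [Fintype V] [DecidableRel G.Adj]
    [Nontrivial V] (hG : G.IsPseudotree) (hgood : ¬ G.HasGoodCycle) (hdeg : ∀ v, G.degree v ≠ 1) :
    ¬ HatGame.Winning G (fun _ => 3) := by
  classical
  have hcyc : ¬ G.IsAcyclic := fun h => by
    obtain ⟨v, hv⟩ := SimpleGraph.IsTree.exists_vert_degree_one_of_nontrivial ⟨hG.1, h⟩
    exact hdeg v hv
  simp only [SimpleGraph.IsAcyclic, not_forall, not_not] at hcyc
  obtain ⟨v, c, hc⟩ := hcyc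
  have hu := hc.isCycleMap
  have hdeg2 : ∀ v, 2 ≤ G.degree v := fun v => by
    have h0 := hG.1.preconnected.degree_pos_of_nontrivial v
    have h1 := hdeg v
    omega
  have hsum : ∑ v, G.degree v = ∑ _v : V, 2 := by
    rw [G.sum_degrees_eq_twice_card_edges, hG.card_edgeFinset hc, Finset.sum_const, smul_eq_mul,
      mul_comm, Finset.card_univ]
  have hdeg_eq : ∀ v, 2 = G.degree v := fun v =>
    (Finset.sum_eq_sum_iff_of_le fun v _ => hdeg2 v).1 hsum.symm v (Finset.mem_univ v)
  have hnbr := fun i v hv => hu.eq_or_eq_of_degree_eq_two (i := i) (hdeg_eq _).symm (v := v) hv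
  have h3 : ¬ 3 ∣ c.length := fun h => hgood ⟨v, c, hc, Or.inr h⟩
  have h4 : c.length ≠ 4 := fun h => hgood ⟨v, c, hc, Or.inl h⟩
  have h5 : 5 ≤ c.length := by
    have := hc.three_le_length
    omega
  exact hu.not_winning (hu.surjective hG.1 hnbr) hnbr fun T hT => cycleLosing_of_five_le h5 h3 T hT

/-- A pseudotree without cycles of length four or divisible by three loses with three colors. -/
theorem SimpleGraph.IsPseudotree.not_winning [Fintype V] (hG : G.IsPseudotree)
    (hgood : ¬ G.HasGoodCycle) : ¬ HatGame.Winning G (fun _ => 3) := by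
  classical
  induction hn : Fintype.card V using Nat.strong_induction_on generalizing V with
  | _ n ih =>
    by_cases hdeg : ∃ l, G.degree l = 1
    · obtain ⟨l, hl⟩ := hdeg
      obtain ⟨u, hlu, huniq⟩ := SimpleGraph.degree_eq_one_iff_existsUnique_adj.1 hl
      refine fun hwin => ih _ ?_
        (hG.induce (hG.1.induce_compl_singleton_of_degree_eq_one hl))
        (fun h => hgood h.of_induce) rfl
        (hwin.induce_compl_singleton (u := u) fun v => ⟨huniq v, fun h => h ▸ hlu⟩)
      rw [← hn]
      exact Fintype.card_subtype_lt (x := l) (by simp)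
    · push Not at hdeg
      rcases subsingleton_or_nontrivial V with hV | hV
      · intro hwin
        obtain ⟨v, w, hvw⟩ := hwin.exists_adj (by norm_num)
        exact hvw.ne (Subsingleton.elim v w)
      · exact hG.not_winning_of_degree_ne_one hgood hdeg

end Pseudotree

/-- For a cactus graph `G`, the hat guessing number equals 2 iff `G` is a
pseudotree with at least one edge and no cycle of length 4 or divisible by 3. -/
theorem cactus_hgNumber_eq_two_iff {V : Type*} [Fintype V] (G : SimpleGraph V)
    (hG : G.IsCactus) :
    HatGame.number G = 2 ↔
      (G.IsPseudotree ∧ (∃ v w : V, G.Adj v w) ∧ ¬ G.HasGoodCycle) := by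
  rw [HatGame.number_eq_two_iff]
  constructor
  · rintro ⟨hadj, h3⟩
    refine ⟨⟨hG.1, fun v w c d hc hd => ?_⟩, hadj, fun h => h3 h.winning⟩
    by_contra hne
    exact h3 (hG.1.winning_of_isCycle hc hd (hG.2 _ _ _ _ hc hd hne))
  · rintro ⟨hpt, hadj, hgood⟩
    exact ⟨hadj, hpt.not_winning hgood⟩
end
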